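/- There exists ε > 0 and N such that for every odd n ≥ N: with probability at least ε over a pair (B, C) of independent random balanced n-sided dice with law μ_n, one has |P(B,C) − 1/4| > ε, where P(B,C) denotes the probability over a third independent balanced die A ~ μ_n that A beats B and A beats C. -/

import Mathlib

open MeasureTheory ProbabilityTheory Set


noncomputable def extendDie (n : ℕ) (s : ℝ) (a : Fin (n - 1) → ℝ) : Fin n → ℝ :=
  fun i => if h : (i : ℕ) < n - 1 then a ⟨i, h⟩ else s - ∑ j, a j

noncomputable def diceMeasure (n : ℕ) (lo hi s : ℝ) : Measure (Fin n → ℝ) :=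
  Measure.map (extendDie n s)
    (ProbabilityTheory.cond volume
      {a : Fin (n - 1) → ℝ | (∀ i, a i ∈ Set.Icc lo hi) ∧ (s - ∑ i, a i) ∈ Set.Icc lo hi})

def beats {n : ℕ} (A B : Fin n → ℝ) : Prop :=
  0 < ∑ i : Fin n, ∑ j : Fin n,
      ((if B j < A i then (1 : ℝ) else 0) - (if A i < B j then (1 : ℝ) else 0))


/-! ## Part B : the uniform measure on the cube -/

/-- Uniform measure on the unit interval. -/
noncomputable abbrev U01 : Measure ℝ := volume.restrict (Ico (0:ℝ) 1)

instance instProbU01 : IsProbabilityMeasure U01 := ⟨by simp [U01]⟩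

/-- Uniform measure on the unit cube. -/
noncomputable abbrev cubeM (ι : Type*) [Fintype ι] : Measure (ι → ℝ) := Measure.pi fun _ => U01

theorem integral_U01 (h : ℝ → ℝ) : ∫ x, h x ∂U01 = ∫ x in (0:ℝ)..1, h x := by
  rw [intervalIntegral.integral_of_le zero_le_one, ← integral_Ico_eq_integral_Ioc]

theorem integrable_of_bdd {Ω : Type*} [MeasurableSpace Ω] {μ : Measure Ω} [IsFiniteMeasure μ]
    {f : Ω → ℝ} (hf : Measurable f) {C : ℝ} (hC : ∀ x, |f x| ≤ C) : Integrable f μ :=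
  Integrable.of_bound hf.aestronglyMeasurable C (Filter.Eventually.of_forall hC)

theorem cube_second_moment (ι : Type*) [Fintype ι] {h : ℝ → ℝ} (hm : Measurable h) {C : ℝ}
    (hC : ∀ x, |h x| ≤ C) (h0 : ∫ x, h x ∂U01 = 0) :
    ∫ x, (∑ i, h (x i)) ^ 2 ∂(cubeM ι) = Fintype.card ι * ∫ x, h x ^ 2 ∂U01 := by
  have hL : MemLp h 2 U01 := MemLp.of_bound hm.aestronglyMeasurable C (Filter.Eventually.of_forall hC)
  have hv := variance_sum_pi (μ := fun _ : ι => U01) (X := fun _ : ι => h) (fun _ => hL)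
  have hmean : ∫ x, (∑ i, fun ω : ι → ℝ => h (ω i)) x ∂(cubeM ι) = 0 := by
    simp only [Finset.sum_apply]
    rw [integral_finsetSum]
    · apply Finset.sum_eq_zero
      intro i _
      have := (measurePreserving_eval (fun _ : ι => U01) i)
      have h2 := integral_map (μ := cubeM ι) (φ := Function.eval i) (f := h)
        (measurable_pi_apply i).aemeasurable hm.aestronglyMeasurable
      rw [this.map_eq] at h2
      rw [← h0, h2]
    · intro i _
      exact integrable_of_bdd (hm.comp (measurable_pi_apply i)) (fun x => hC _)
  rw [variance_of_integral_eq_zero _ hmean] at hv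
  · simp only [Finset.sum_apply, Finset.sum_const, Finset.card_univ, nsmul_eq_mul] at hv
    rw [hv, variance_of_integral_eq_zero hm.aemeasurable h0]
  · refine Measurable.aemeasurable ?_
    have e : (∑ i, fun ω : ι → ℝ => h (ω i)) = fun ω => ∑ i, h (ω i) := by ext; simp
    rw [e]
    exact Finset.measurable_sum _ (fun i _ => hm.comp (measurable_pi_apply i))

/-- Piecewise translation swapping `R` and `R + v`. -/
theorem measurePreserving_swap {G : Type*} [MeasurableSpace G] [AddCommGroup G] [MeasurableAdd G]
    (μ : Measure G) [μ.IsAddLeftInvariant] (v : G) (R₁ R₂ : Set G) (h1 : MeasurableSet R₁)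
    (h2 : MeasurableSet R₂) (h12 : ∀ x, x ∈ R₁ ↔ v + x ∈ R₂) (hd : Disjoint R₁ R₂) (T : G → G)
    (hT1 : ∀ x ∈ R₁, T x = v + x) (hT2 : ∀ x ∈ R₂, T x = -v + x)
    (hT3 : ∀ x, x ∉ R₁ → x ∉ R₂ → T x = x) : MeasurePreserving T μ μ := by
  classical
  have hTe : T = fun x => if x ∈ R₁ then v + x else if x ∈ R₂ then -v + x else x := by
    funext x
    by_cases a : x ∈ R₁
    · simp [a, hT1 x a]
    · by_cases b : x ∈ R₂
      · simp [a, b, hT2 x b]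
      · simp [a, b, hT3 x a b]
  have hTm : Measurable T := by
    rw [hTe]
    exact Measurable.ite h1 (measurable_const_add v)
      (Measurable.ite h2 (measurable_const_add (-v)) measurable_id)
  refine ⟨hTm, ?_⟩
  ext S hS
  rw [Measure.map_apply hTm hS]
  have key : ∀ S : Set G, μ S = μ (S ∩ R₁) + (μ ((S \ R₁) ∩ R₂) + μ ((S \ R₁) \ R₂)) := by
    intro S
    rw [measure_inter_add_sdiff _ h2, measure_inter_add_sdiff _ h1]
  rw [key S, key (T ⁻¹' S)]
  have e1 : T ⁻¹' S ∩ R₁ = (fun x => v + x) ⁻¹' ((S \ R₁) ∩ R₂) := by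
    ext x
    simp only [mem_inter_iff, mem_preimage, mem_sdiff]
    constructor
    · rintro ⟨a, b⟩
      rw [hT1 x b] at a
      exact ⟨⟨a, fun c => hd.le_bot ⟨c, (h12 x).1 b⟩⟩, (h12 x).1 b⟩
    · rintro ⟨⟨a, b⟩, c⟩
      have d := (h12 x).2 c
      exact ⟨by rw [hT1 x d]; exact a, d⟩
  have e2 : (T ⁻¹' S \ R₁) ∩ R₂ = (fun x => -v + x) ⁻¹' (S ∩ R₁) := by
    ext x
    simp only [mem_inter_iff, mem_preimage, mem_sdiff]
    have hx : -v + x ∈ R₁ ↔ x ∈ R₂ := by rw [h12]; simp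
    constructor
    · rintro ⟨⟨a, b⟩, c⟩
      rw [hT2 x c] at a
      exact ⟨a, hx.2 c⟩
    · rintro ⟨a, b⟩
      have d := hx.1 b
      exact ⟨⟨by rw [hT2 x d]; exact a, fun c => hd.le_bot ⟨c, d⟩⟩, d⟩
  have e3 : (T ⁻¹' S \ R₁) \ R₂ = (S \ R₁) \ R₂ := by
    ext x
    simp only [mem_preimage, mem_sdiff]
    constructor
    · rintro ⟨⟨a, b⟩, c⟩
      rw [hT3 x b c] at a; exact ⟨⟨a, b⟩, c⟩
    · rintro ⟨⟨a, b⟩, c⟩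
      exact ⟨⟨by rw [hT3 x b c]; exact a, b⟩, c⟩
  rw [e1, e2, e3, measure_preimage_add, measure_preimage_add]
  rw [← add_assoc, ← add_assoc, add_comm (μ (S \ R₁ ∩ R₂))]

theorem centralBinom_sq (k : ℕ) : (Nat.centralBinom k) ^ 2 * (2 * k + 1) ≤ 16 ^ k := by
  induction k with
  | zero => simp
  | succ k ih =>
    have h := Nat.succ_mul_centralBinom_succ k
    have h2 : ((k+1) * Nat.centralBinom (k+1))^2 * (2*(k+1)+1)
        = 4 * ((2*k+1) * (2*k+3)) * ((Nat.centralBinom k)^2 * (2*k+1)) := by rw [h]; ring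
    have h3 : ((k+1) * Nat.centralBinom (k+1))^2 * (2*(k+1)+1) ≤ 4 * (4 * (k+1)^2) * 16^k := by
      rw [h2]
      apply Nat.mul_le_mul _ ih
      nlinarith
    have h4 : (k+1)^2 * ((Nat.centralBinom (k+1))^2 * (2*(k+1)+1)) ≤ (k+1)^2 * 16^(k+1) := by
      rw [pow_succ 16]; nlinarith
    exact Nat.le_of_mul_le_mul_left h4 (by positivity)

theorem choose_sq_mul (m j : ℕ) : (m.choose j) ^ 2 * m ≤ 4 ^ m := by
  have h1 : m.choose j ≤ m.choose (m/2) := Nat.choose_le_middle j m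
  have h2 : (m.choose (m/2))^2 * (m+1) ≤ 4 ^ m := by
    rcases Nat.even_or_odd' m with ⟨k, rfl | rfl⟩
    · have := centralBinom_sq k
      rw [Nat.centralBinom] at this
      have e : 2 * k / 2 = k := by omega
      rw [e, pow_mul]; norm_num; exact this
    · have := centralBinom_sq (k+1)
      have e : (2 * k + 1) / 2 = k := by omega
      have e2 : Nat.centralBinom (k+1) = 2 * (2*k+1).choose k := by
        rw [Nat.centralBinom, show 2*(k+1) = (2*k+1)+1 by ring, Nat.choose_succ_succ,
          Nat.choose_symm_half]; ring
      rw [e2] at this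
      rw [e, pow_succ 4, pow_mul]
      rw [pow_succ 16] at this
      norm_num at this ⊢
      nlinarith
  calc (m.choose j)^2 * m ≤ (m.choose (m/2))^2 * (m+1) := by gcongr; omega
    _ ≤ _ := h2

theorem choose_le_div_sqrt (m j : ℕ) (hm : 1 ≤ m) : (m.choose j : ℝ) ≤ 2 ^ m / √m := by
  have h := choose_sq_mul m j
  have hr : ((m.choose j : ℝ)) ^ 2 * m ≤ 4 ^ m := by exact_mod_cast h
  have hm' : (0:ℝ) < m := by exact_mod_cast hm
  rw [le_div_iff₀ (Real.sqrt_pos.2 hm')]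
  apply le_of_sq_le_sq _ (by positivity)
  rw [mul_pow, Real.sq_sqrt hm'.le, ← pow_mul, mul_comm m 2, pow_mul]
  norm_num; exact hr

theorem card_window (ι : Type*) [Fintype ι] [DecidableEq ι] (c : ℝ) (hm : 1 ≤ Fintype.card ι) :
    ((Finset.univ.filter (fun e : Finset ι => c ≤ (e.card : ℝ) / 2 ∧ (e.card : ℝ) / 2 ≤ c + 1)).card : ℝ)
      ≤ 3 * (2 ^ (Fintype.card ι) / √(Fintype.card ι)) := by
  set k0 := ⌈2 * c⌉₊
  have hsub : (Finset.univ.filter (fun e : Finset ι => c ≤ (e.card : ℝ) / 2 ∧ (e.card : ℝ) / 2 ≤ c + 1))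
      ⊆ (Finset.univ.powersetCard k0 ∪ Finset.univ.powersetCard (k0+1)) ∪ Finset.univ.powersetCard (k0+2) := by
    intro e he
    simp only [Finset.mem_filter, Finset.mem_univ, true_and] at he
    simp only [Finset.mem_union, Finset.mem_powersetCard_univ]
    have h1 : k0 ≤ e.card := Nat.ceil_le.2 (by linarith)
    have h2 : e.card ≤ k0 + 2 := by
      have : (2 * c) ≤ k0 := Nat.le_ceil _
      have : (e.card : ℝ) ≤ ((k0 + 2 : ℕ) : ℝ) := by push_cast; linarith
      exact_mod_cast this
    omega
  have hc := (Finset.card_le_card hsub).trans ((Finset.card_union_le _ _).trans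
    (Nat.add_le_add_right (Finset.card_union_le _ _) _))
  simp only [Finset.card_powersetCard, Finset.card_univ] at hc
  have hc' : ((Finset.univ.filter (fun e : Finset ι => c ≤ (e.card : ℝ) / 2 ∧ (e.card : ℝ) / 2 ≤ c + 1)).card : ℝ)
     ≤ ((Fintype.card ι).choose k0 : ℝ) + (Fintype.card ι).choose (k0+1) + (Fintype.card ι).choose (k0+2) := by
    exact_mod_cast hc
  have a1 := choose_le_div_sqrt (Fintype.card ι) k0 hm
  have a2 := choose_le_div_sqrt (Fintype.card ι) (k0+1) hm
  have a3 := choose_le_div_sqrt (Fintype.card ι) (k0+2) hm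
  linarith

/-- half flip -/
noncomputable def hflip (y : ℝ) : ℝ := if Int.fract y < 1/2 then y + 1/2 else y - 1/2

theorem hflip_mp : MeasurePreserving hflip U01 U01 := by
  have hv : MeasurePreserving hflip volume volume := by
    refine measurePreserving_swap volume (1/2 : ℝ) {y | Int.fract y < 1/2} {y | ¬ Int.fract y < 1/2}
      (measurableSet_lt measurable_fract measurable_const)
      (measurableSet_lt measurable_fract measurable_const).compl ?_ ?_ _ ?_ ?_ ?_
    · intro x
      simp only [mem_ofPred_eq, not_lt]
      constructor
      · intro h
        have : Int.fract (1/2 + x) = Int.fract x + 1/2 := by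
          rw [Int.fract_eq_iff]
          refine ⟨by linarith [Int.fract_nonneg x], by linarith, ⌊x⌋, ?_⟩
          have := Int.self_sub_floor x
          linarith
        linarith [Int.fract_nonneg x]
      · intro h
        by_contra hx
        push Not at hx
        have : Int.fract (1/2 + x) = Int.fract x - 1/2 := by
          rw [Int.fract_eq_iff]
          refine ⟨by linarith [Int.fract_nonneg x], by linarith [Int.fract_lt_one x], ⌊x⌋ + 1, ?_⟩
          have := Int.self_sub_floor x
          push_cast
          linarith
        linarith [Int.fract_lt_one x]
    · exact disjoint_compl_right
    · intro x hx; simp only [mem_ofPred_eq] at hx; simp only [hflip, if_pos hx]; ring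
    · intro x hx; simp only [mem_ofPred_eq] at hx; simp only [hflip, if_neg hx]; ring
    · intro x h1 h2; exact absurd h1 h2
  have := hv.restrict_preimage (s := Ico (0:ℝ) 1) measurableSet_Ico
  have e : hflip ⁻¹' Ico (0:ℝ) 1 = Ico 0 1 := by
    ext y
    simp only [mem_preimage, mem_Ico, hflip]
    have hfl := Int.self_sub_floor y
    have h0 := Int.fract_nonneg y
    have h1 := Int.fract_lt_one y
    split_ifs with h
    · constructor
      · rintro ⟨a, b⟩
        have : (⌊y⌋ : ℝ) < 1 := by linarith
        have h2 : ⌊y⌋ < 1 := by exact_mod_cast this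
        have : (-1 : ℝ) < ⌊y⌋ := by linarith
        have h3 : -1 < ⌊y⌋ := by exact_mod_cast this
        have : ⌊y⌋ = 0 := by omega
        rw [this] at hfl; push_cast at hfl
        constructor <;> linarith
      · rintro ⟨a, b⟩
        have : ⌊y⌋ = 0 := Int.floor_eq_zero_iff.2 ⟨a, b⟩
        rw [this] at hfl; push_cast at hfl
        constructor <;> linarith
    · push Not at h
      constructor
      · rintro ⟨a, b⟩
        have : (⌊y⌋ : ℝ) < 1 := by linarith
        have h2 : ⌊y⌋ < 1 := by exact_mod_cast this
        have : (-1 : ℝ) < ⌊y⌋ := by linarith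
        have h3 : -1 < ⌊y⌋ := by exact_mod_cast this
        have : ⌊y⌋ = 0 := by omega
        rw [this] at hfl; push_cast at hfl
        constructor <;> linarith
      · rintro ⟨a, b⟩
        have : ⌊y⌋ = 0 := Int.floor_eq_zero_iff.2 ⟨a, b⟩
        rw [this] at hfl; push_cast at hfl
        constructor <;> linarith
  rwa [e] at this

/-- Concentration bound. -/
theorem cube_conc (ι : Type*) [Fintype ι] (hm : 1 ≤ Fintype.card ι) (t : ℝ) :
    (cubeM ι).real {x | t ≤ ∑ i, x i ∧ ∑ i, x i ≤ t + 1} ≤ 3 / √(Fintype.card ι) := by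
  classical
  set E : Set (ι → ℝ) := {x | t ≤ ∑ i, x i ∧ ∑ i, x i ≤ t + 1} with hE
  have hsum : Measurable (fun x : ι → ℝ => ∑ i, x i) :=
    Finset.measurable_sum _ (fun i _ => measurable_pi_apply i)
  have hEm : MeasurableSet E :=
    (measurableSet_le measurable_const hsum).inter (measurableSet_le hsum measurable_const)
  let T : Finset ι → (ι → ℝ) → (ι → ℝ) := fun e x i => if i ∈ e then hflip (x i) else x i
  have hT : ∀ e, MeasurePreserving (T e) (cubeM ι) (cubeM ι) := by
    intro e
    have := measurePreserving_pi (μ := fun _ : ι => U01) (ν := fun _ : ι => U01)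
      (f := fun i => if i ∈ e then hflip else id) (by
        intro i
        by_cases hi : i ∈ e
        · simp only [hi, if_true]; exact hflip_mp
        · simp only [hi, if_false]; exact MeasurePreserving.id _)
    convert this using 1
    funext x i
    simp only [T]; split_ifs <;> rfl
  have h1 : ∀ e, (cubeM ι).real E = ∫ x, E.indicator (1 : (ι → ℝ) → ℝ) (T e x) ∂(cubeM ι) := by
    intro e
    rw [← (hT e).measureReal_preimage hEm.nullMeasurableSet,
      ← integral_indicator_one ((hT e).measurable hEm)]
    rfl
  have hind : Measurable (E.indicator (1 : (ι → ℝ) → ℝ)) := measurable_one.indicator hEm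
  have hindb : ∀ x, |E.indicator (1 : (ι → ℝ) → ℝ) x| ≤ 1 := by
    intro x; by_cases hx : x ∈ E <;> simp [hx]
  have h2 : (2:ℝ) ^ (Fintype.card ι) * (cubeM ι).real E
      = ∫ x, ∑ e : Finset ι, E.indicator (1 : (ι → ℝ) → ℝ) (T e x) ∂(cubeM ι) := by
    rw [integral_finsetSum]
    · rw [← Finset.sum_congr rfl (fun e _ => h1 e)]
      simp [Finset.card_univ]
    · intro e _
      exact integrable_of_bdd (hind.comp (hT e).measurable) (fun x => hindb _)
  have h3 : ∀ x, ∑ e : Finset ι, E.indicator (1 : (ι → ℝ) → ℝ) (T e x)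
      ≤ 3 * (2 ^ (Fintype.card ι) / √(Fintype.card ι)) := by
    intro x
    set B : Finset ι := Finset.univ.filter (fun i => ¬ Int.fract (x i) < 1/2)
    set r : ℝ := ∑ i, (if Int.fract (x i) < 1/2 then x i else x i - 1/2)
    have hs : ∀ e : Finset ι, ∑ i, T e x i = r + ((symmDiff e B).card : ℝ) / 2 := by
      intro e
      have : ((symmDiff e B).card : ℝ) / 2 = ∑ i, if i ∈ symmDiff e B then (1/2 : ℝ) else 0 := by
        rw [Finset.sum_ite_mem]; simp [div_eq_mul_inv]
      rw [this, ← Finset.sum_add_distrib]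
      apply Finset.sum_congr rfl
      intro i _
      have hB : i ∈ B ↔ ¬ Int.fract (x i) < 1/2 := by simp [B]
      simp only [T, Finset.mem_symmDiff, hB, hflip]
      by_cases a : i ∈ e <;> by_cases b : Int.fract (x i) < 1/2 <;> simp only [a, b] <;> norm_num
    have h4 : ∑ e : Finset ι, E.indicator (1 : (ι → ℝ) → ℝ) (T e x)
       = ∑ e : Finset ι, if (t - r ≤ (e.card : ℝ)/2 ∧ (e.card : ℝ)/2 ≤ t - r + 1) then (1:ℝ) else 0 := by
      rw [← Equiv.sum_comp (Function.Involutive.toPerm (fun e : Finset ι => symmDiff e B)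
        (fun e => symmDiff_symmDiff_cancel_right B e)) (fun e : Finset ι =>
          if (t - r ≤ (e.card : ℝ)/2 ∧ (e.card : ℝ)/2 ≤ t - r + 1) then (1:ℝ) else 0)]
      apply Finset.sum_congr rfl
      intro e _
      simp only [indicator, hE, mem_ofPred_eq, hs, Pi.one_apply]
      change _ = if (t - r ≤ ((symmDiff e B).card : ℝ)/2 ∧ ((symmDiff e B).card : ℝ)/2 ≤ t - r + 1)
        then (1:ℝ) else 0
      congr 1
      apply propext
      constructor
      · rintro ⟨a, b⟩; constructor <;> linarith
      · rintro ⟨a, b⟩; constructor <;> linarith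
    rw [h4, Finset.sum_boole]
    exact card_window ι (t - r) hm
  have h5 : (2:ℝ) ^ (Fintype.card ι) * (cubeM ι).real E ≤ 3 * (2 ^ (Fintype.card ι) / √(Fintype.card ι)) := by
    rw [h2]
    calc _ ≤ ∫ x, 3 * ((2:ℝ) ^ (Fintype.card ι) / √(Fintype.card ι)) ∂(cubeM ι) := by
          apply integral_mono_of_nonneg
          · exact Filter.Eventually.of_forall (fun x => Finset.sum_nonneg (fun e _ => by
              by_cases hx : T e x ∈ E <;> simp [hx]))
          · exact integrable_const _
          · exact Filter.Eventually.of_forall h3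
      _ = _ := by simp
  have hp : (0:ℝ) < 2 ^ (Fintype.card ι) := by positivity
  have : (2:ℝ) ^ (Fintype.card ι) * (cubeM ι).real E ≤ 2 ^ (Fintype.card ι) * (3 / √(Fintype.card ι)) := by
    rw [show (2:ℝ) ^ (Fintype.card ι) * (3 / √(Fintype.card ι)) = 3 * (2 ^ (Fintype.card ι) / √(Fintype.card ι)) by ring]
    exact h5
  exact le_of_mul_le_mul_left this hp


theorem refl_mp : MeasurePreserving (fun y : ℝ => 1 - y) U01 U01 := by
  have h : MeasurePreserving (fun y : ℝ => 1 - y) volume volume :=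
    Measure.measurePreserving_sub_left volume 1
  have := h.restrict_preimage (s := Ico (0:ℝ) 1) measurableSet_Ico
  have e : (fun y : ℝ => 1 - y) ⁻¹' Ico (0:ℝ) 1 = Ioc 0 1 := by
    ext y; simp only [mem_preimage, mem_Ico, mem_Ioc]
    constructor <;> rintro ⟨a, b⟩ <;> constructor <;> linarith
  rw [e] at this
  rwa [Measure.restrict_congr_set (Ioc_ae_eq_Icc.trans Ico_ae_eq_Icc.symm)] at this

theorem measurable_sum_coord (ι : Type*) [Fintype ι] : Measurable (fun x : ι → ℝ => ∑ i, x i) :=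
    Finset.measurable_sum _ (fun i _ => measurable_pi_apply i)

theorem cube_ae_mem (ι : Type*) [Fintype ι] : ∀ᵐ x ∂(cubeM ι), ∀ i, x i ∈ Ico (0:ℝ) 1 := by
  rw [ae_all_iff]
  intro i
  have : ∀ᵐ y ∂U01, y ∈ Ico (0:ℝ) 1 := ae_restrict_mem measurableSet_Ico
  exact (Measure.tendsto_eval_ae_ae (μ := fun _ : ι => U01) (i := i)).eventually this

theorem cube_cheb (k : ℕ) (hk : 1 ≤ k) :
    1 / 2 ≤ (cubeM (Fin k)).real {x | |∑ i, x i - k / 2| ≤ √k} := by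
  -- bounded version of `x - 1/2`
  let h : ℝ → ℝ := fun x => max (-1) (min 1 (x - 1/2))
  have hm : Measurable h := by fun_prop
  have hb : ∀ x, |h x| ≤ 1 := by
    intro x; rw [abs_le]; exact ⟨le_max_left _ _, max_le (by norm_num) (min_le_left _ _)⟩
  have hin : ∀ x ∈ Ico (0:ℝ) 1, h x = x - 1/2 := by
    intro x hx
    simp only [h]
    rw [min_eq_right (by linarith [hx.2]), max_eq_right (by linarith [hx.1])]
  have h0 : ∫ x, h x ∂U01 = 0 := by
    rw [setIntegral_congr_fun measurableSet_Ico hin, integral_U01 (fun x => x - 1/2)]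
    rw [intervalIntegral.integral_sub (by simp) (by simp)]
    simp
  have h2 : ∫ x, h x ^ 2 ∂U01 ≤ 1/4 := by
    rw [setIntegral_congr_fun (g := fun x => (x-1/2)^2) measurableSet_Ico (fun x hx => by
      simp only [hin x hx])]
    calc ∫ x in Ico (0:ℝ) 1, (x - 1/2)^2 ≤ ∫ x in Ico (0:ℝ) 1, (1/4 : ℝ) := by
          apply setIntegral_mono_on
          · exact (ContinuousOn.integrableOn_Icc (by fun_prop)).mono_set Ico_subset_Icc_self
          · simp
          · exact measurableSet_Ico
          · intro x hx; nlinarith [hx.1, hx.2]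
      _ = 1/4 := by simp
  have hs := cube_second_moment (Fin k) hm hb h0
  set S : (Fin k → ℝ) → ℝ := fun x => ∑ i, h (x i)
  have hSm : Measurable S := Finset.measurable_sum _ (fun i _ => hm.comp (measurable_pi_apply i))
  have hSb : ∀ x, |S x| ≤ k := by
    intro x
    calc |S x| ≤ ∑ i, |h (x i)| := Finset.abs_sum_le_sum_abs _ _
      _ ≤ ∑ i : Fin k, (1:ℝ) := Finset.sum_le_sum (fun i _ => hb _)
      _ = k := by simp
  have hSi : Integrable (fun x => S x ^ 2) (cubeM (Fin k)) :=
    integrable_of_bdd (C := (k:ℝ)^2) (by fun_prop) (fun x => by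
      rw [abs_pow]; exact pow_le_pow_left₀ (abs_nonneg _) (hSb x) 2)
  have hmk := mul_meas_ge_le_integral_of_nonneg (μ := cubeM (Fin k)) (f := fun x => S x ^ 2)
    (Filter.Eventually.of_forall (fun x => sq_nonneg _)) hSi (k:ℝ)
  have hkp : (0:ℝ) < k := by exact_mod_cast hk
  have hreal : (cubeM (Fin k)).real {x | (k:ℝ) ≤ S x ^ 2} ≤ 1/4 := by
    have : (k:ℝ) * (cubeM (Fin k)).real {x | (k:ℝ) ≤ S x ^ 2} ≤ k * (1/4) := by
      refine hmk.trans ?_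
      rw [hs]; simp only [Fintype.card_fin]; gcongr
    exact le_of_mul_le_mul_left this hkp
  have hset : MeasurableSet {x | (k:ℝ) ≤ S x ^ 2} := measurableSet_le measurable_const (by fun_prop)
  have hcompl := measureReal_compl (μ := cubeM (Fin k)) hset
  rw [probReal_univ] at hcompl
  have : (cubeM (Fin k)).real {x | (k:ℝ) ≤ S x ^ 2}ᶜ ≤ (cubeM (Fin k)).real {x | |∑ i, x i - k / 2| ≤ √k} := by
    apply ENNReal.toReal_mono (measure_ne_top _ _)
    apply measure_mono_ae
    filter_upwards [cube_ae_mem (Fin k)] with x hx hx2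
    have hx3 : ¬ ((k:ℝ) ≤ S x ^ 2) := hx2
    have e : S x = ∑ i, x i - k/2 := by
      simp only [S]
      rw [Finset.sum_congr rfl (fun i _ => hin _ (hx i)), Finset.sum_sub_distrib]
      simp [div_eq_mul_inv]
    change |∑ i, x i - k / 2| ≤ √k
    rw [← e]
    apply Real.abs_le_sqrt
    linarith
  linarith

theorem cube_diff (k : ℕ) (hk : 1 ≤ k) :
    1 / (44 * √k) ≤ ((cubeM (Fin k)).prod (cubeM (Fin k))).real
      {p | |∑ i, p.1 i - ∑ i, p.2 i| ≤ 1/4} := by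
  set P := cubeM (Fin k)
  have hkp : (1:ℝ) ≤ k := by exact_mod_cast hk
  have hsk : (1:ℝ) ≤ √k := by rw [Real.one_le_sqrt]; exact hkp
  set J : (Fin k → ℝ) → ℤ := fun x => ⌊4 * ∑ i, x i⌋
  have hJ : Measurable J := Int.measurable_floor.comp ((measurable_sum_coord (Fin k)).const_mul 4)
  set F : Finset ℤ := Finset.Icc ⌊4 * (k/2 - √k : ℝ)⌋ ⌊4 * (k/2 + √k : ℝ)⌋
  have hF : (F.card : ℝ) ≤ 11 * √k := by
    simp only [F, Int.card_Icc]
    have h1 := Int.floor_le (4 * (k/2 + √k : ℝ))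
    have h2 := Int.lt_floor_add_one (4 * (k/2 - √k : ℝ))
    have h3 : ⌊4 * (k/2 - √k : ℝ)⌋ ≤ ⌊4 * (k/2 + √k : ℝ)⌋ := Int.floor_le_floor (by linarith)
    have h4 : (((⌊4 * (k/2 + √k : ℝ)⌋ + 1 - ⌊4 * (k/2 - √k : ℝ)⌋).toNat : ℤ) : ℝ)
        = ⌊4 * (k/2 + √k : ℝ)⌋ + 1 - ⌊4 * (k/2 - √k : ℝ)⌋ := by
      rw [Int.toNat_of_nonneg (by omega)]; push_cast; ring
    have h5 : ((⌊4 * (k/2 + √k : ℝ)⌋ + 1 - ⌊4 * (k/2 - √k : ℝ)⌋).toNat : ℝ)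
      = ⌊4 * (k/2 + √k : ℝ)⌋ + 1 - ⌊4 * (k/2 - √k : ℝ)⌋ := by rw [← h4]; norm_cast
    rw [h5]; linarith
  have hsum : 1/2 ≤ ∑ j ∈ F, P.real (J ⁻¹' {j}) := by
    refine (cube_cheb k hk).trans ?_
    rw [← measureReal_biUnion_finset]
    · apply measureReal_mono _ (measure_ne_top _ _)
      intro x hx
      have hx' : |∑ i, x i - k / 2| ≤ √k := hx
      rw [abs_le] at hx'
      simp only [mem_iUnion]
      refine ⟨J x, ?_, rfl⟩
      simp only [F, Finset.mem_Icc, J]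
      exact ⟨Int.floor_le_floor (by linarith), Int.floor_le_floor (by linarith)⟩
    · intro a _ b _ hab
      exact (disjoint_singleton.2 hab).preimage J
    · intro j _; exact hJ (measurableSet_singleton j)
  have hcs : (∑ j ∈ F, P.real (J ⁻¹' {j}))^2 ≤ F.card * ∑ j ∈ F, P.real (J ⁻¹' {j}) ^ 2 :=
    sq_sum_le_card_mul_sum_sq
  have hle : ∑ j ∈ F, P.real (J ⁻¹' {j}) ^ 2 ≤ (P.prod P).real {p | |∑ i, p.1 i - ∑ i, p.2 i| ≤ 1/4} := by
    have e : ∀ j, P.real (J ⁻¹' {j}) ^ 2 = (P.prod P).real ((J ⁻¹' {j}) ×ˢ (J ⁻¹' {j})) := by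
      intro j; rw [measureReal_prod_prod, sq]
    rw [Finset.sum_congr rfl (fun j _ => e j), ← measureReal_biUnion_finset]
    · apply measureReal_mono _ (measure_ne_top _ _)
      intro p hp
      simp only [mem_iUnion] at hp
      obtain ⟨j, _, h1, h2⟩ := hp
      have h1 : ⌊4 * ∑ i, p.1 i⌋ = j := h1
      have h2 : ⌊4 * ∑ i, p.2 i⌋ = j := h2
      rw [Int.floor_eq_iff] at h1 h2
      change |∑ i, p.1 i - ∑ i, p.2 i| ≤ 1/4
      rw [abs_le]; constructor <;> linarith
    · intro a _ b _ hab
      exact Disjoint.set_prod_left ((disjoint_singleton.2 hab).preimage J) _ _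
    · intro j _; exact (hJ (measurableSet_singleton j)).prod (hJ (measurableSet_singleton j))
  rw [div_le_iff₀ (by positivity)]
  set s := ∑ j ∈ F, P.real (J ⁻¹' {j})
  set q := ∑ j ∈ F, P.real (J ⁻¹' {j})^2
  have hq : 0 ≤ q := Finset.sum_nonneg (fun j _ => sq_nonneg _)
  have : (1/4 : ℝ) ≤ s^2 := by nlinarith
  have h6 : (F.card : ℝ) * q ≤ 11 * √k * q := by gcongr
  have h7 : 11 * √k * q ≤ 11 * √k * (P.prod P).real {p | |∑ i, p.1 i - ∑ i, p.2 i| ≤ 1/4} := by gcongr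
  linarith

/-- Lower bound for the central probability. -/
theorem cube_center (ι : Type*) [Fintype ι] (k : ℕ) (hk : 1 ≤ k) (hc : Fintype.card ι = k + k) :
    1 / (44 * √k) ≤ (cubeM ι).real {x | |∑ i, x i - k| ≤ 1/4} := by
  refine (cube_diff k hk).trans (le_of_eq ?_)
  have eqv : Fin k ⊕ Fin k ≃ ι := Fintype.equivOfCardEq (by simp [hc])
  have m1 : MeasurePreserving (fun y : Fin k → ℝ => fun i => 1 - y i) (cubeM (Fin k)) (cubeM (Fin k)) :=
    measurePreserving_pi (μ := fun _ : Fin k => U01) (ν := fun _ : Fin k => U01)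
      (f := fun _ y => 1 - y) (fun _ => refl_mp)
  have m2 := (MeasurePreserving.id (cubeM (Fin k))).prod m1
  have m3 := measurePreserving_sumPiEquivProdPi_symm (fun _ : Fin k ⊕ Fin k => U01)
  have m4 := measurePreserving_piCongrLeft (fun _ : ι => U01) eqv
  have m5 := m4.comp (m3.comp m2)
  have hset : MeasurableSet {x : ι → ℝ | |∑ i, x i - k| ≤ 1/4} :=
    measurableSet_le ((measurable_sum_coord ι).sub_const _).abs measurable_const
  rw [← m5.measureReal_preimage hset.nullMeasurableSet]
  congr 1
  ext p
  simp only [mem_preimage, mem_ofPred_eq]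
  rw [← Equiv.sum_comp eqv]
  simp only [Function.comp_apply, MeasurableEquiv.coe_piCongrLeft, Equiv.piCongrLeft_apply_apply]
  rw [Fintype.sum_sum_type]
  have e : (∑ i : Fin k, (MeasurableEquiv.sumPiEquivProdPi (fun _ : Fin k ⊕ Fin k => ℝ)).symm
      (Prod.map id (fun y i => 1 - y i) p) (Sum.inl i)
      + ∑ i : Fin k, (MeasurableEquiv.sumPiEquivProdPi (fun _ : Fin k ⊕ Fin k => ℝ)).symm
      (Prod.map id (fun y i => 1 - y i) p) (Sum.inr i)) = ∑ i, p.1 i + ∑ i, (1 - p.2 i) := rfl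
  rw [e, Finset.sum_sub_distrib]
  simp only [Finset.sum_const, Finset.card_univ, Fintype.card_fin, nsmul_eq_mul, mul_one]
  rw [show ∑ i, p.1 i + ((k:ℝ) - ∑ i, p.2 i) - k = ∑ i, p.1 i - ∑ i, p.2 i by ring]


/-! ## Part C : the dice measure -/

/-- The event on which the last face lies in the unit interval. -/
def Qset (m : ℕ) : Set (Fin (m + m) → ℝ) := {x | (m : ℝ) + 1/2 - ∑ i, x i ∈ Icc (0:ℝ) 1}

theorem measurableSet_Qset (m : ℕ) : MeasurableSet (Qset m) :=
  ((measurable_sum_coord (Fin (m+m))).const_sub _) measurableSet_Icc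

/-- Conditional measure on the first even number of faces. -/
noncomputable def nuM (m : ℕ) : Measure (Fin (m + m) → ℝ) := ProbabilityTheory.cond (cubeM (Fin (m+m))) (Qset m)

noncomputable def extM (m : ℕ) (x : Fin (m + m) → ℝ) : Fin (m + m + 1) → ℝ :=
  Fin.snoc (α := fun _ => ℝ) x ((m : ℝ) + 1/2 - ∑ i, x i)

noncomputable def muM (m : ℕ) : Measure (Fin (m + m + 1) → ℝ) := Measure.map (extM m) (nuM m)

theorem measurable_extM (m : ℕ) : Measurable (extM m) := by
  rw [measurable_pi_iff]
  intro i
  refine Fin.lastCases ?_ (fun j => ?_) i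
  · simp only [extM, Fin.snoc_last]
    exact (measurable_sum_coord (Fin (m+m))).const_sub _
  · simp only [extM, Fin.snoc_castSucc]
    exact measurable_pi_apply j

theorem volume_restrict_cube (ι : Type*) [Fintype ι] :
    (volume : Measure (ι → ℝ)).restrict {a | ∀ i, a i ∈ Icc (0:ℝ) 1} = cubeM ι := by
  have e : {a : ι → ℝ | ∀ i, a i ∈ Icc (0:ℝ) 1} = Set.univ.pi fun _ => Icc (0:ℝ) 1 := by
    ext a; exact ⟨fun h i _ => h i, fun h i => h i (mem_univ i)⟩
  rw [e, volume_pi, Measure.restrict_pi_pi]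
  congr 1
  funext i
  exact Measure.restrict_congr_set Ico_ae_eq_Icc.symm

theorem dice_eq (m : ℕ) : diceMeasure (m + m + 1) 0 1 (((m + m + 1 : ℕ) : ℝ) / 2) = muM m := by
  have hs : (((m + m + 1 : ℕ) : ℝ) / 2) = (m : ℝ) + 1/2 := by push_cast; ring
  rw [hs]
  unfold diceMeasure muM
  have h1 : (extendDie (m+m+1) ((m:ℝ)+1/2)) = extM m := by
    funext x i
    refine Fin.lastCases ?_ (fun j => ?_) i
    · simp only [extM, Fin.snoc_last, extendDie]
      rw [dif_neg (by simp)]; rfl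
    · simp only [extM, Fin.snoc_castSucc, extendDie]
      rw [dif_pos (by simp)]; rfl
  rw [h1]
  congr 1
  unfold nuM ProbabilityTheory.cond
  have hv := volume_restrict_cube (Fin (m+m))
  have hQ := measurableSet_Qset m
  have e : {a : Fin (m+m+1-1) → ℝ | (∀ i, a i ∈ Set.Icc (0:ℝ) 1) ∧ ((m:ℝ)+1/2 - ∑ i, a i) ∈ Set.Icc (0:ℝ) 1}
     = Qset m ∩ {a : Fin (m+m) → ℝ | ∀ i, a i ∈ Icc (0:ℝ) 1} := by
    ext a; exact And.comm
  rw [e, ← hv, Measure.restrict_apply hQ, Measure.restrict_restrict hQ]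

theorem Z_lower (m : ℕ) (hm : 1 ≤ m) : 1 / (44 * √m) ≤ (cubeM (Fin (m+m))).real (Qset m) := by
  refine (cube_center (Fin (m+m)) m hm (by simp)).trans ?_
  apply measureReal_mono _ (measure_ne_top _ _)
  intro x hx
  have hx : |∑ i, x i - m| ≤ 1/4 := hx
  rw [abs_le] at hx
  change (m : ℝ) + 1/2 - ∑ i, x i ∈ Icc (0:ℝ) 1
  constructor <;> linarith

theorem Z_upper (m : ℕ) (hm : 1 ≤ m) : (cubeM (Fin (m+m))).real (Qset m) ≤ 3 / √m := by
  have h := cube_conc (Fin (m+m)) (by simp; omega) ((m:ℝ) - 1/2)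
  have hm' : (0:ℝ) < m := by exact_mod_cast hm
  calc _ ≤ _ := by
        apply measureReal_mono (s₂ := {x : Fin (m+m) → ℝ | (m:ℝ) - 1/2 ≤ ∑ i, x i ∧ ∑ i, x i ≤ (m:ℝ) - 1/2 + 1}) _ (measure_ne_top _ _)
        intro x hx
        have hx : (m : ℝ) + 1/2 - ∑ i, x i ∈ Icc (0:ℝ) 1 := hx
        change (m:ℝ) - 1/2 ≤ ∑ i, x i ∧ ∑ i, x i ≤ (m:ℝ) - 1/2 + 1
        constructor <;> linarith [hx.1, hx.2]
    _ ≤ _ := h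
    _ ≤ 3 / √m := by
        simp only [Fintype.card_fin]
        apply div_le_div_of_nonneg_left (by norm_num) (Real.sqrt_pos.2 hm')
        apply Real.sqrt_le_sqrt; push_cast; linarith

theorem Z_ne (m : ℕ) (hm : 1 ≤ m) : (cubeM (Fin (m+m))) (Qset m) ≠ 0 := by
  intro h
  have h1 := Z_lower m hm
  have hm' : (0:ℝ) < m := by exact_mod_cast hm
  rw [Measure.real, h] at h1
  have : 0 < 1 / (44 * √m) := by positivity
  simp at h1
  have := Real.sqrt_pos.2 hm'
  linarith [inv_pos.2 this]

theorem prob_nuM (m : ℕ) (hm : 1 ≤ m) : IsProbabilityMeasure (nuM m) :=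
  cond_isProbabilityMeasure (Z_ne m hm)

theorem prob_muM (m : ℕ) (hm : 1 ≤ m) : IsProbabilityMeasure (muM m) := by
  have := prob_nuM m hm
  exact Measure.isProbabilityMeasure_map (measurable_extM m).aemeasurable

theorem integral_nuM (m : ℕ) (f : (Fin (m+m) → ℝ) → ℝ) :
    ∫ x, f x ∂(nuM m) = ((cubeM (Fin (m+m))).real (Qset m))⁻¹ * ∫ x, (Qset m).indicator f x ∂(cubeM (Fin (m+m))) := by
  unfold nuM ProbabilityTheory.cond
  rw [integral_smul_measure, integral_indicator (measurableSet_Qset m), ENNReal.toReal_inv]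
  rfl

/-- Comparison with the uniform measure for a subset of coordinates. -/
theorem nu_compare (m : ℕ) (hm : 1 ≤ m) (p : Fin (m+m) → Prop) [DecidablePred p]
    (hp : Fintype.card {i // ¬ p i} = m) (G : ({i // p i} → ℝ) → ℝ) (hG : Measurable G)
    (hG0 : ∀ u, 0 ≤ G u) (C : ℝ) (hGC : ∀ u, G u ≤ C) :
    ∫ x, G (fun i => x i) ∂(nuM m) ≤ 132 * ∫ u, G u ∂(cubeM {i // p i}) := by
  rw [integral_nuM]
  have hm' : (0:ℝ) < m := by exact_mod_cast hm
  have hsq := Real.sqrt_pos.2 hm'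
  set E : Set (({i // p i} → ℝ) × ({i // ¬ p i} → ℝ)) :=
    {q | (m : ℝ) + 1/2 - (∑ i, q.1 i + ∑ i, q.2 i) ∈ Icc (0:ℝ) 1} with hE
  have hsm : Measurable (fun q : (({i // p i} → ℝ) × ({i // ¬ p i} → ℝ)) =>
      (m : ℝ) + 1/2 - (∑ i, q.1 i + ∑ i, q.2 i)) :=
    (((measurable_sum_coord _).comp measurable_fst).add
      ((measurable_sum_coord _).comp measurable_snd)).const_sub _
  have hEm : MeasurableSet E := hsm measurableSet_Icc
  set g : (({i // p i} → ℝ) × ({i // ¬ p i} → ℝ)) → ℝ := E.indicator (fun q => G q.1) with hg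
  have hgm : Measurable g := (hG.comp measurable_fst).indicator hEm
  have hg0 : ∀ q, 0 ≤ g q := fun q => indicator_nonneg (fun _ _ => hG0 _) q
  have hgC : ∀ q, |g q| ≤ C := by
    intro q
    rw [abs_of_nonneg (hg0 q)]
    by_cases hq : q ∈ E
    · simp only [hg, indicator_of_mem hq]; exact hGC _
    · simp only [hg, indicator_of_notMem hq]; exact (hG0 q.1).trans (hGC _)
  have mp := measurePreserving_piEquivPiSubtypeProd (fun _ : Fin (m+m) => U01) p
  have h1 : ∫ x, (Qset m).indicator (fun x => G (fun i => x i)) x ∂(cubeM (Fin (m+m)))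
      = ∫ q, g q ∂((cubeM {i // p i}).prod (cubeM {i // ¬ p i})) := by
    rw [← mp.integral_comp']
    apply integral_congr_ae
    refine Filter.Eventually.of_forall (fun x => ?_)
    simp only [hg, indicator]
    have hiff : x ∈ Qset m ↔ (MeasurableEquiv.piEquivPiSubtypeProd (fun _ : Fin (m+m) => ℝ) p) x ∈ E := by
      change (m : ℝ) + 1/2 - ∑ i, x i ∈ Icc (0:ℝ) 1 ↔
        (m : ℝ) + 1/2 - (∑ i : {i // p i}, x i + ∑ i : {i // ¬ p i}, x i) ∈ Icc (0:ℝ) 1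
      rw [Fintype.sum_subtype_add_sum_subtype p (fun i => x i)]
    by_cases hx : x ∈ Qset m
    · rw [if_pos hx, if_pos (hiff.1 hx)]; rfl
    · rw [if_neg hx, if_neg (fun h => hx (hiff.2 h))]
  have h2 : ∫ q, g q ∂((cubeM {i // p i}).prod (cubeM {i // ¬ p i})) ≤ (3 / √m) * ∫ u, G u ∂(cubeM {i // p i}) := by
    rw [integral_prod _ (integrable_of_bdd hgm hgC), ← integral_const_mul]
    apply integral_mono_of_nonneg
    · exact Filter.Eventually.of_forall (fun u => integral_nonneg (fun z => hg0 _))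
    · exact (integrable_of_bdd hG (C := C) (fun u => by rw [abs_of_nonneg (hG0 u)]; exact hGC u)).const_mul _
    · refine Filter.Eventually.of_forall (fun u => ?_)
      set s : Set ({i // ¬ p i} → ℝ) := {z | (m:ℝ) - 1/2 - ∑ i, u i ≤ ∑ i, z i ∧
        ∑ i, z i ≤ (m:ℝ) - 1/2 - ∑ i, u i + 1} with hs
      have hsmm : MeasurableSet s :=
        (measurableSet_le measurable_const (measurable_sum_coord _)).inter
          (measurableSet_le (measurable_sum_coord _) measurable_const)
      have e : ∀ z, g (u, z) = s.indicator (fun _ => G u) z := by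
        intro z
        have hiff : (u, z) ∈ E ↔ z ∈ s := by
          change (m : ℝ) + 1/2 - (∑ i, u i + ∑ i, z i) ∈ Icc (0:ℝ) 1 ↔ (m:ℝ) - 1/2 - ∑ i, u i ≤ ∑ i, z i ∧
            ∑ i, z i ≤ (m:ℝ) - 1/2 - ∑ i, u i + 1
          constructor
          · rintro ⟨a, b⟩; constructor <;> linarith
          · rintro ⟨a, b⟩; constructor <;> linarith
        simp only [hg, indicator, hiff]
      have h3 := cube_conc {i // ¬ p i} (by rw [hp]; exact hm) ((m:ℝ) - 1/2 - ∑ i, u i)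
      rw [hp] at h3
      simp only [e]
      rw [integral_indicator_const _ hsmm, smul_eq_mul]
      exact mul_le_mul_of_nonneg_right h3 (hG0 u)
  rw [h1]
  have hI : 0 ≤ ∫ u, G u ∂(cubeM {i // p i}) := integral_nonneg hG0
  have hZ := Z_lower m hm
  have hZi : ((cubeM (Fin (m+m))).real (Qset m))⁻¹ ≤ 44 * √m := by
    rw [inv_le_comm₀ (lt_of_lt_of_le (by positivity) hZ) (by positivity)]
    simpa using hZ
  calc _ ≤ (44 * √m) * ((3 / √m) * ∫ u, G u ∂(cubeM {i // p i})) := by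
        apply mul_le_mul hZi h2 (integral_nonneg hg0) (by positivity)
    _ = _ := by field_simp; ring

theorem integral_muM (m : ℕ) {f : (Fin (m+m+1) → ℝ) → ℝ} (hf : Measurable f) :
    ∫ a, f a ∂(muM m) = ∫ x, f (extM m x) ∂(nuM m) :=
  integral_map (measurable_extM m).aemeasurable hf.aestronglyMeasurable

theorem sum_ext (m : ℕ) (h : ℝ → ℝ) (x : Fin (m+m) → ℝ) :
    ∑ i, h (extM m x i) = (∑ i : {i : Fin (m+m) // (i:ℕ) < m}, h (x i) + ∑ i : {i : Fin (m+m) // ¬ (i:ℕ) < m}, h (x i))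
      + h (extM m x (Fin.last _)) := by
  rw [Fin.sum_univ_castSucc, Fintype.sum_subtype_add_sum_subtype (fun i : Fin (m+m) => (i:ℕ) < m) (fun i => h (x i))]
  simp [extM]

theorem card_lo (m : ℕ) : Fintype.card {i : Fin (m+m) // (i:ℕ) < m} = m := by
  have := Fin.card_filter_val_lt (n := m+m) (m := m)
  rw [Fintype.card_subtype, this]; omega

theorem card_hi (m : ℕ) : Fintype.card {i : Fin (m+m) // ¬ (i:ℕ) < m} = m := by
  rw [Fintype.card_subtype_compl, card_lo]; simp

/-- Variance bound under the dice measure. -/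
theorem mu_var (m : ℕ) (hm : 1 ≤ m) {h : ℝ → ℝ} (hh : Measurable h) {C : ℝ} (hC : ∀ x, |h x| ≤ C)
    (h0 : ∫ x, h x ∂U01 = 0) :
    ∫ a, (∑ i, h (a i)) ^ 2 ∂(muM m) ≤ 792 * m * ∫ x, h x ^ 2 ∂U01 + 3 * ∫ a, h (a (Fin.last _)) ^ 2 ∂(muM m) := by
  have := prob_nuM m hm
  have hC0 : 0 ≤ C := (abs_nonneg _).trans (hC 0)
  rw [integral_muM m (by fun_prop), integral_muM m (by fun_prop)]
  have key : ∀ (p : Fin (m+m) → Prop) [DecidablePred p], Fintype.card {i // p i} = m →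
     Fintype.card {i // ¬ p i} = m → ∫ x, (∑ i : {i // p i}, h (x i))^2 ∂(nuM m) ≤ 132 * (m * ∫ x, h x ^ 2 ∂U01) := by
    intro p _ h1 h2
    have hb : ∀ u : {i // p i} → ℝ, |∑ i, h (u i)| ≤ m * C := by
      intro u
      calc _ ≤ ∑ i, |h (u i)| := Finset.abs_sum_le_sum_abs _ _
        _ ≤ ∑ i : {i // p i}, C := Finset.sum_le_sum (fun i _ => hC _)
        _ = m * C := by simp [h1]
    have := nu_compare m hm p h2 (fun u => (∑ i, h (u i))^2) (by fun_prop) (fun u => sq_nonneg _)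
      ((m*C)^2) (fun u => by rw [← sq_abs]; exact pow_le_pow_left₀ (abs_nonneg _) (hb u) 2)
    rw [cube_second_moment {i // p i} hh hC h0, h1] at this
    exact this
  have k1 := key (fun i => (i:ℕ) < m) (card_lo m) (card_hi m)
  have k2 := key (fun i => ¬ (i:ℕ) < m) (card_hi m) (by
    simp only [not_not]; exact card_lo m)
  have bd : ∀ (p : Fin (m+m) → Prop) [DecidablePred p],
      Integrable (fun x : Fin (m+m) → ℝ => (∑ i : {i // p i}, h (x i))^2) (nuM m) := by
    intro p _
    refine integrable_of_bdd (C := ((Fintype.card {i // p i}) * C)^2) (by fun_prop) (fun u => ?_)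
    rw [abs_pow]
    apply pow_le_pow_left₀ (abs_nonneg _)
    calc _ ≤ ∑ i : {i // p i}, |h (u i)| := Finset.abs_sum_le_sum_abs _ _
        _ ≤ ∑ i : {i // p i}, C := Finset.sum_le_sum (fun i _ => hC _)
        _ = _ := by simp
  have bl : Integrable (fun x : Fin (m+m) → ℝ => h (extM m x (Fin.last _))^2) (nuM m) := by
    have := measurable_extM m
    refine integrable_of_bdd (C := C^2) (by fun_prop) (fun u => ?_)
    rw [abs_pow]
    exact pow_le_pow_left₀ (abs_nonneg _) (hC _) 2
  calc ∫ x, (∑ i, h (extM m x i)) ^ 2 ∂(nuM m)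
      ≤ ∫ x, (3 * (∑ i : {i : Fin (m+m) // (i:ℕ) < m}, h (x i))^2
        + 3 * (∑ i : {i : Fin (m+m) // ¬ (i:ℕ) < m}, h (x i))^2 + 3 * h (extM m x (Fin.last _))^2) ∂(nuM m) := by
        apply integral_mono_of_nonneg (Filter.Eventually.of_forall (fun _ => sq_nonneg _))
        · exact (((bd _).const_mul 3).add ((bd _).const_mul 3)).add (bl.const_mul 3)
        · refine Filter.Eventually.of_forall (fun x => ?_)
          simp only [sum_ext]
          set a := ∑ i : {i : Fin (m+m) // (i:ℕ) < m}, h (x i)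
          set b := ∑ i : {i : Fin (m+m) // ¬ (i:ℕ) < m}, h (x i)
          set c := h (extM m x (Fin.last _))
          nlinarith [sq_nonneg (a-b), sq_nonneg (b-c), sq_nonneg (a-c)]
    _ = 3 * ∫ x, (∑ i : {i : Fin (m+m) // (i:ℕ) < m}, h (x i))^2 ∂(nuM m)
        + 3 * ∫ x, (∑ i : {i : Fin (m+m) // ¬ (i:ℕ) < m}, h (x i))^2 ∂(nuM m)
        + 3 * ∫ x, h (extM m x (Fin.last _))^2 ∂(nuM m) := by
        have hadd : Integrable (fun x : Fin (m+m) → ℝ => 3 * (∑ i : {i : Fin (m+m) // (i:ℕ) < m}, h (x i))^2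
          + 3 * (∑ i : {i : Fin (m+m) // ¬ (i:ℕ) < m}, h (x i))^2) (nuM m) :=
          ((bd _).const_mul 3).add ((bd _).const_mul 3)
        rw [integral_add hadd (bl.const_mul 3),
          integral_add ((bd _).const_mul 3) ((bd _).const_mul 3), integral_const_mul, integral_const_mul,
          integral_const_mul]
    _ ≤ _ := by linarith


/-! ## Part C2 : invariance of the dice measure, absence of ties -/

/-- The displacement of the pair exchange. -/
noncomputable def dl (x y : ℝ) : ℝ :=
  if (0 ≤ x ∧ x < 1/4) ∧ (3/4 ≤ y ∧ y < 1) then 1/4 else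
  if (1/4 ≤ x ∧ x < 1/2) ∧ (1/2 ≤ y ∧ y < 3/4) then -(1/4) else 0

/-- The pair exchange on coordinates `i` and `j`. -/
noncomputable def TT {ι : Type*} [DecidableEq ι] (i j : ι) (x : ι → ℝ) : ι → ℝ :=
  fun k => x k + (if k = i then dl (x i) (x j) else if k = j then - dl (x i) (x j) else 0)

theorem TT_i {ι : Type*} [DecidableEq ι] (i j : ι) (x : ι → ℝ) : TT i j x i = x i + dl (x i) (x j) := by
  simp [TT]

theorem TT_j {ι : Type*} [DecidableEq ι] (i j : ι) (hij : i ≠ j) (x : ι → ℝ) :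
    TT i j x j = x j - dl (x i) (x j) := by
  simp [TT, hij.symm, sub_eq_add_neg]

theorem TT_k {ι : Type*} [DecidableEq ι] (i j k : ι) (hki : k ≠ i) (hkj : k ≠ j) (x : ι → ℝ) :
    TT i j x k = x k := by
  simp [TT, hki, hkj]

theorem TT_sum {ι : Type*} [DecidableEq ι] [Fintype ι] (i j : ι) (hij : i ≠ j) (x : ι → ℝ) :
    ∑ k, TT i j x k = ∑ k, x k := by
  have : ∀ k, (if k = i then dl (x i) (x j) else if k = j then - dl (x i) (x j) else 0)
    = (if k = i then dl (x i) (x j) else 0) + (if k = j then - dl (x i) (x j) else 0) := by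
    intro k
    by_cases h : k = i
    · subst h; simp [hij]
    · simp [h]
  simp only [TT, this, Finset.sum_add_distrib, Finset.sum_ite_eq', Finset.mem_univ, if_true]
  ring

theorem TT_mp_volume {ι : Type*} [DecidableEq ι] [Fintype ι] (i j : ι) (hij : i ≠ j) :
    MeasurePreserving (TT i j) (volume : Measure (ι → ℝ)) volume := by
  have mi : Measurable (fun x : ι → ℝ => x i) := measurable_pi_apply i
  have mj : Measurable (fun x : ι → ℝ => x j) := measurable_pi_apply j
  refine measurePreserving_swap volume
    (fun k => if k = i then (1/4:ℝ) else if k = j then -(1/4) else 0)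
    {x | (0 ≤ x i ∧ x i < 1/4) ∧ (3/4 ≤ x j ∧ x j < 1)}
    {x | (1/4 ≤ x i ∧ x i < 1/2) ∧ (1/2 ≤ x j ∧ x j < 3/4)} ?_ ?_ ?_ ?_ _ ?_ ?_ ?_
  · exact ((measurableSet_le measurable_const mi).inter (measurableSet_lt mi measurable_const)).inter
      ((measurableSet_le measurable_const mj).inter (measurableSet_lt mj measurable_const))
  · exact ((measurableSet_le measurable_const mi).inter (measurableSet_lt mi measurable_const)).inter
      ((measurableSet_le measurable_const mj).inter (measurableSet_lt mj measurable_const))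
  · intro x
    simp only [mem_ofPred_eq, Pi.add_apply, if_true, if_neg hij.symm]
    constructor
    · rintro ⟨⟨a, b⟩, c, d⟩; refine ⟨⟨?_, ?_⟩, ?_, ?_⟩ <;> linarith
    · rintro ⟨⟨a, b⟩, c, d⟩; refine ⟨⟨?_, ?_⟩, ?_, ?_⟩ <;> linarith
  · rw [Set.disjoint_left]
    rintro x ⟨⟨a, b⟩, c, d⟩ ⟨⟨a', b'⟩, c', d'⟩
    linarith
  · intro x hx
    have : dl (x i) (x j) = 1/4 := if_pos hx
    funext k
    simp only [TT, this, Pi.add_apply]; ring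
  · intro x hx
    have h0 : ¬ ((0 ≤ x i ∧ x i < 1/4) ∧ (3/4 ≤ x j ∧ x j < 1)) := by
      rintro ⟨⟨a, b⟩, c, d⟩
      linarith [hx.1.1]
    have : dl (x i) (x j) = -(1/4) := by
      unfold dl; rw [if_neg h0]; exact if_pos hx
    funext k
    simp only [TT, this, Pi.add_apply, Pi.neg_apply]
    split_ifs <;> ring
  · intro x hx hx'
    have : dl (x i) (x j) = 0 := by
      unfold dl; exact (if_neg hx).trans (if_neg hx')
    funext k
    simp [TT, this]

theorem dl_mem (x y : ℝ) : ((0 ≤ x + dl x y ∧ x + dl x y ≤ 1) ∧ (0 ≤ y - dl x y ∧ y - dl x y ≤ 1))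
    ↔ ((0 ≤ x ∧ x ≤ 1) ∧ (0 ≤ y ∧ y ≤ 1)) := by
  unfold dl
  split_ifs with h h'
  · obtain ⟨⟨a, b⟩, c, d⟩ := h
    constructor <;> intro _ <;> (refine ⟨⟨?_, ?_⟩, ?_, ?_⟩ <;> linarith)
  · obtain ⟨⟨a, b⟩, c, d⟩ := h'
    constructor <;> intro _ <;> (refine ⟨⟨?_, ?_⟩, ?_, ?_⟩ <;> linarith)
  · simp

theorem TT_cube {ι : Type*} [DecidableEq ι] (i j : ι) (hij : i ≠ j) (x : ι → ℝ) :
    (∀ k, TT i j x k ∈ Icc (0:ℝ) 1) ↔ (∀ k, x k ∈ Icc (0:ℝ) 1) := by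
  have key := dl_mem (x i) (x j)
  constructor
  · intro h k
    have h1 := h i
    have h2 := h j
    rw [TT_i] at h1
    rw [TT_j i j hij] at h2
    have := key.1 ⟨h1, h2⟩
    by_cases hi : k = i
    · subst hi; exact this.1
    · by_cases hj : k = j
      · subst hj; exact this.2
      · have := h k; rwa [TT_k i j k hi hj] at this
  · intro h k
    have := key.2 ⟨h i, h j⟩
    by_cases hi : k = i
    · subst hi; rw [TT_i]; exact this.1
    · by_cases hj : k = j
      · subst hj; rw [TT_j i k hij]; exact this.2
      · rw [TT_k i j k hi hj]; exact h k

theorem TT_mp_nu (m : ℕ) (i j : Fin (m+m)) (hij : i ≠ j) :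
    MeasurePreserving (TT i j) (nuM m) (nuM m) := by
  have h0 := TT_mp_volume (ι := Fin (m+m)) i j hij
  have hQ := measurableSet_Qset m
  have hcm : MeasurableSet {a : Fin (m+m) → ℝ | ∀ i, a i ∈ Icc (0:ℝ) 1} := by
    have : {a : Fin (m+m) → ℝ | ∀ i, a i ∈ Icc (0:ℝ) 1} = Set.univ.pi fun _ => Icc (0:ℝ) 1 := by
      ext a; exact ⟨fun h i _ => h i, fun h i => h i (mem_univ i)⟩
    rw [this]; exact MeasurableSet.univ_pi (fun _ => measurableSet_Icc)
  have h1 := h0.restrict_preimage hcm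
  have e1 : TT i j ⁻¹' {a : Fin (m+m) → ℝ | ∀ i, a i ∈ Icc (0:ℝ) 1} = {a : Fin (m+m) → ℝ | ∀ i, a i ∈ Icc (0:ℝ) 1} := by
    ext x; exact TT_cube i j hij x
  rw [e1, volume_restrict_cube] at h1
  have h2 := h1.restrict_preimage hQ
  have e2 : TT i j ⁻¹' (Qset m) = Qset m := by
    ext x
    change (m : ℝ) + 1/2 - ∑ k, TT i j x k ∈ Icc (0:ℝ) 1 ↔ (m : ℝ) + 1/2 - ∑ k, x k ∈ Icc (0:ℝ) 1
    rw [TT_sum i j hij]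
  rw [e2] at h2
  exact h2.smul_measure _

theorem TT_ext (m : ℕ) (i j : Fin (m+m)) (hij : i ≠ j) (x : Fin (m+m) → ℝ) :
    extM m (TT i j x) = TT i.castSucc j.castSucc (extM m x) := by
  funext k
  refine Fin.lastCases ?_ (fun k => ?_) k
  · rw [TT_k _ _ _ (Fin.castSucc_lt_last i).ne' (Fin.castSucc_lt_last j).ne']
    simp only [extM, Fin.snoc_last, TT_sum i j hij]
  · simp only [TT, extM, Fin.snoc_castSucc, Fin.castSucc_inj]

theorem measurable_TT {ι : Type*} [DecidableEq ι] [Fintype ι] (i j : ι) (hij : i ≠ j) : Measurable (TT i j) :=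
  (TT_mp_volume i j hij).measurable

theorem TT_mp_mu (m : ℕ) (i j : Fin (m+m)) (hij : i ≠ j) :
    MeasurePreserving (TT i.castSucc j.castSucc) (muM m) (muM m) := by
  have hij' : i.castSucc ≠ j.castSucc := fun h => hij (Fin.castSucc_inj.1 h)
  refine ⟨measurable_TT _ _ hij', ?_⟩
  unfold muM
  rw [Measure.map_map (measurable_TT _ _ hij') (measurable_extM m)]
  have : TT i.castSucc j.castSucc ∘ extM m = extM m ∘ TT i j := by
    funext x; exact (TT_ext m i j hij x).symm
  rw [this, ← Measure.map_map (measurable_extM m) (TT_mp_nu m i j hij).measurable, (TT_mp_nu m i j hij).map_eq]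

theorem hyperplane_null (ι : Type*) [Fintype ι] [Nonempty ι] (c : ℝ) :
    (cubeM ι) {x | ∑ i, x i = c} = 0 := by
  classical
  rw [← volume_restrict_cube]
  apply le_antisymm _ zero_le
  refine (Measure.restrict_apply_le _ _).trans (le_of_eq ?_)
  obtain ⟨i0⟩ := ‹Nonempty ι›
  let L : (ι → ℝ) →ₗ[ℝ] ℝ := ∑ i, LinearMap.proj i
  have hL : ∀ x, L x = ∑ i, x i := by intro x; simp [L]
  let s : AffineSubspace ℝ (ι → ℝ) := AffineSubspace.mk' (Pi.single i0 c) (LinearMap.ker L)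
  have hs : ∀ x, x ∈ s ↔ ∑ i, x i = c := by
    intro x
    simp only [s, AffineSubspace.mem_mk', LinearMap.mem_ker, vsub_eq_sub, hL, Pi.sub_apply,
      Finset.sum_sub_distrib]
    simp [sub_eq_zero]
  have : {x : ι → ℝ | ∑ i, x i = c} = (s : Set (ι → ℝ)) := by
    ext x; exact (hs x).symm
  rw [this]
  apply Measure.addHaar_affineSubspace
  intro h
  have : Pi.single i0 (c+1) ∈ s := by rw [h]; trivial
  rw [hs] at this
  simp at this

theorem nu_ac (m : ℕ) : nuM m ≪ cubeM (Fin (m+m)) := cond_absolutelyContinuous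

theorem mu_coord_null (m : ℕ) (hm : 1 ≤ m) (i : Fin (m+m+1)) (c : ℝ) : ∀ᵐ a ∂(muM m), a i ≠ c := by
  have hme : MeasurableSet {a : Fin (m+m+1) → ℝ | a i ≠ c} :=
    (measurableSet_eq_fun (measurable_pi_apply i) measurable_const).compl
  rw [muM, ae_map_iff (measurable_extM m).aemeasurable hme]
  apply nu_ac m
  refine Fin.lastCases ?_ (fun k => ?_) i
  · have : Nonempty (Fin (m+m)) := ⟨⟨0, by omega⟩⟩
    have h := hyperplane_null (Fin (m+m)) ((m:ℝ) + 1/2 - c)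
    have h' : ∀ᵐ x ∂(cubeM (Fin (m+m))), ¬ (∑ i, x i = (m:ℝ) + 1/2 - c) := by
      rw [ae_iff]; simpa using h
    filter_upwards [h'] with x hx
    simp only [extM, Fin.snoc_last]
    intro e; apply hx; linarith
  · filter_upwards [Measure.ae_eval_ne (μ := fun _ : Fin (m+m) => U01) k c] with x hx
    simpa [extM] using hx

theorem mu_mem (m : ℕ) : ∀ᵐ a ∂(muM m), (∀ i, a i ∈ Icc (0:ℝ) 1) ∧ ∑ i, a i = (m:ℝ) + 1/2 := by
  have hme : MeasurableSet {a : Fin (m+m+1) → ℝ | (∀ i, a i ∈ Icc (0:ℝ) 1) ∧ ∑ i, a i = (m:ℝ) + 1/2} := by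
    apply MeasurableSet.inter
    · have : {a : Fin (m+m+1) → ℝ | ∀ i, a i ∈ Icc (0:ℝ) 1} = Set.univ.pi fun _ => Icc (0:ℝ) 1 := by
        ext a; exact ⟨fun h i _ => h i, fun h i => h i (mem_univ i)⟩
      change MeasurableSet {a : Fin (m+m+1) → ℝ | ∀ i, a i ∈ Icc (0:ℝ) 1}
      rw [this]; exact MeasurableSet.univ_pi (fun _ => measurableSet_Icc)
    · exact (measurable_sum_coord (Fin (m+m+1))) (measurableSet_singleton _)
  rw [muM, ae_map_iff (measurable_extM m).aemeasurable hme]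
  have h1 : ∀ᵐ x ∂(nuM m), ∀ i, x i ∈ Ico (0:ℝ) 1 := nu_ac m (cube_ae_mem _)
  have h2 : ∀ᵐ x ∂(nuM m), x ∈ Qset m := ae_cond_mem (measurableSet_Qset m)
  filter_upwards [h1, h2] with x hx hq
  refine ⟨fun i => ?_, ?_⟩
  · refine Fin.lastCases ?_ (fun k => ?_) i
    · simp only [extM, Fin.snoc_last]; exact hq
    · simp only [extM, Fin.snoc_castSucc]; exact ⟨(hx k).1, (hx k).2.le⟩
  · rw [Fin.sum_univ_castSucc]
    simp [extM]

/-- Almost surely no two faces differ by an integer. -/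
theorem no_ties (m : ℕ) (hm : 1 ≤ m) :
    ∀ᵐ q ∂((muM m).prod (muM m)), ∀ i j, ∀ z : ℤ, q.2 j ≠ q.1 i + (z:ℝ) := by
  have := prob_muM m hm
  rw [ae_all_iff]; intro i
  rw [ae_all_iff]; intro j
  rw [ae_all_iff]; intro z
  have hme : MeasurableSet {q : (Fin (m+m+1) → ℝ) × (Fin (m+m+1) → ℝ) | q.2 j ≠ q.1 i + (z:ℝ)} := by
    apply MeasurableSet.compl
    apply measurableSet_eq_fun <;> fun_prop
  rw [Measure.ae_prod_iff_ae_ae hme]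
  exact Filter.Eventually.of_forall (fun b => mu_coord_null m hm j (b i + (z:ℝ)))


/-! ## Part C3 : lower bound on pair probabilities -/

def lo (m : ℕ) (I : Fin m) : Fin (m+m) := Fin.castAdd m I
def up (m : ℕ) (I : Fin m) : Fin (m+m) := Fin.natAdd m I

theorem lo_ne_up (m : ℕ) (I J : Fin m) : lo m I ≠ up m J := by
  intro h
  have := congrArg Fin.val h
  simp [lo, up] at this
  omega

theorem U01_Ico (a : ℝ) (h0 : 0 ≤ a) (h1 : a + 1/8 ≤ 1) : U01 (Ico a (a+1/8)) = ENNReal.ofReal (1/8) := by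
  rw [Measure.restrict_apply measurableSet_Ico, inter_eq_left.2 (Ico_subset_Ico h0 h1), Real.volume_Ico]
  congr 1; ring

theorem pair_prob (m : ℕ) (hm : 2 ≤ m) (I : Fin m) (δ : ℝ) (h0 : 0 ≤ δ) (h1 : δ ≤ 1/8) :
    1/8448 ≤ (muM m).real {a | (δ ≤ a (lo m I).castSucc ∧ a (lo m I).castSucc < δ + 1/8) ∧
      (3/4 + δ ≤ a (up m I).castSucc ∧ a (up m I).castSucc < 3/4 + δ + 1/8)} := by
  classical
  have := prob_nuM m (by omega)
  set i := lo m I with hi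
  set j := up m I with hj
  have hij : i ≠ j := lo_ne_up m I I
  set S : Set (Fin (m+m) → ℝ) := {x | (δ ≤ x i ∧ x i < δ + 1/8) ∧ (3/4 + δ ≤ x j ∧ x j < 3/4 + δ + 1/8)} with hS
  have mm : ∀ (κ : Type) [Fintype κ] (k : κ), Measurable (fun x : κ → ℝ => x k) := fun κ _ k => measurable_pi_apply k
  have hSm : MeasurableSet S :=
    ((measurableSet_le measurable_const (mm _ i)).inter (measurableSet_lt (mm _ i) measurable_const)).inter
      ((measurableSet_le measurable_const (mm _ j)).inter (measurableSet_lt (mm _ j) measurable_const))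
  have e1 : (muM m).real {a | (δ ≤ a i.castSucc ∧ a i.castSucc < δ + 1/8) ∧
      (3/4 + δ ≤ a j.castSucc ∧ a j.castSucc < 3/4 + δ + 1/8)} = (nuM m).real S := by
    unfold muM
    rw [map_measureReal_apply (measurable_extM m)]
    · congr 1
      ext x
      simp [extM, hS]
    · exact ((measurableSet_le measurable_const (mm _ i.castSucc)).inter (measurableSet_lt (mm _ i.castSucc) measurable_const)).inter
        ((measurableSet_le measurable_const (mm _ j.castSucc)).inter (measurableSet_lt (mm _ j.castSucc) measurable_const))
  have e2 : (nuM m).real S = ((cubeM (Fin (m+m))).real (Qset m))⁻¹ * (cubeM (Fin (m+m))).real (Qset m ∩ S) := by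
    unfold nuM
    rw [Measure.real, cond_apply (measurableSet_Qset m), ENNReal.toReal_mul, ENNReal.toReal_inv]; rfl
  let p : Fin (m+m) → Prop := fun k => k = i ∨ k = j
  have hfil : Finset.univ.filter p = {i, j} := by
    ext k; simp [p]
  have hc2 : Fintype.card {k // p k} = 2 := by
    rw [Fintype.card_subtype, hfil, Finset.card_pair hij]
  have hc : Fintype.card {k // ¬ p k} = (m-1) + (m-1) := by
    rw [Fintype.card_subtype_compl, hc2, Fintype.card_fin]; omega
  have hsum : ∀ x : Fin (m+m) → ℝ, ∑ k : {k // p k}, x k = x i + x j := by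
    intro x
    rw [← Finset.sum_subtype (Finset.univ.filter p) (by simp) (fun k => x k), hfil, Finset.sum_pair hij]
  set Bx : Set ({k // p k} → ℝ) := Set.univ.pi fun k => if k.1 = i then Ico δ (δ+1/8) else Ico (3/4+δ) (3/4+δ+1/8) with hB
  set Ct : Set ({k // ¬ p k} → ℝ) := {z | |∑ k, z k - ((m-1:ℕ):ℝ)| ≤ 1/4} with hC
  have hCm : MeasurableSet Ct := measurableSet_le (((measurable_sum_coord _).sub_const _).abs) measurable_const
  have hBm : MeasurableSet Bx := by
    apply MeasurableSet.univ_pi; intro k; split_ifs <;> exact measurableSet_Ico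
  have mB : (cubeM {k // p k}).real Bx = 1/64 := by
    rw [Measure.real, hB, Measure.pi_pi]
    have : ∀ k : {k // p k}, U01 (if k.1 = i then Ico δ (δ+1/8) else Ico (3/4+δ) (3/4+δ+1/8)) = ENNReal.ofReal (1/8) := by
      intro k
      split_ifs
      · exact U01_Ico _ h0 (by linarith)
      · exact U01_Ico _ (by linarith) (by linarith)
    simp only [this, Finset.prod_const, Finset.card_univ, hc2]
    rw [ENNReal.toReal_pow, ENNReal.toReal_ofReal (by norm_num)]; norm_num
  have mC := cube_center {k // ¬ p k} (m-1) (by omega) hc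
  have mp := measurePreserving_piEquivPiSubtypeProd (fun _ : Fin (m+m) => U01) p
  have hsub : (MeasurableEquiv.piEquivPiSubtypeProd (fun _ : Fin (m+m) => ℝ) p) ⁻¹' (Bx ×ˢ Ct) ⊆ Qset m ∩ S := by
    rintro x ⟨hx1, hx2⟩
    have hx2 : |∑ k : {k // ¬ p k}, x k - ((m-1:ℕ):ℝ)| ≤ 1/4 := hx2
    have b1 := hx1 ⟨i, Or.inl rfl⟩ (mem_univ _)
    have b2 := hx1 ⟨j, Or.inr rfl⟩ (mem_univ _)
    beta_reduce at b1 b2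
    rw [if_pos rfl] at b1
    rw [if_neg hij.symm] at b2
    have b1 : x i ∈ Ico δ (δ+1/8) := b1
    have b2 : x j ∈ Ico (3/4+δ) (3/4+δ+1/8) := b2
    refine ⟨?_, b1, b2⟩
    change (m : ℝ) + 1/2 - ∑ i, x i ∈ Icc (0:ℝ) 1
    rw [← Fintype.sum_subtype_add_sum_subtype p (fun i => x i), hsum]
    rw [Nat.cast_sub (by omega), abs_le] at hx2
    push_cast at hx2
    obtain ⟨u1, u2⟩ := b1
    obtain ⟨u3, u4⟩ := b2
    obtain ⟨u5, u6⟩ := hx2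
    constructor <;> linarith
  have hlow : 1/64 * (1/(44*√((m-1:ℕ):ℝ))) ≤ (cubeM (Fin (m+m))).real (Qset m ∩ S) := by
    calc _ ≤ (cubeM {k // p k}).real Bx * (cubeM {k // ¬ p k}).real Ct := by
          rw [mB]; exact mul_le_mul_of_nonneg_left mC (by norm_num)
      _ = ((cubeM {k // p k}).prod (cubeM {k // ¬ p k})).real (Bx ×ˢ Ct) := by
          rw [measureReal_prod_prod]
      _ = (cubeM (Fin (m+m))).real ((MeasurableEquiv.piEquivPiSubtypeProd (fun _ : Fin (m+m) => ℝ) p) ⁻¹' (Bx ×ˢ Ct)) := by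
          rw [Measure.real, Measure.real, ← mp.measure_preimage (hBm.prod hCm).nullMeasurableSet]
      _ ≤ _ := measureReal_mono hsub (measure_ne_top _ _)
  rw [e1, e2]
  have hm' : (0:ℝ) < m := by exact_mod_cast (by omega : 0 < m)
  have hm1 : (0:ℝ) < ((m-1:ℕ):ℝ) := by exact_mod_cast (by omega : 0 < m - 1)
  have hs1 := Real.sqrt_pos.2 hm'
  have hs2 := Real.sqrt_pos.2 hm1
  have hle : √((m-1:ℕ):ℝ) ≤ √m := Real.sqrt_le_sqrt (by exact_mod_cast Nat.sub_le m 1)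
  have hZ := Z_upper m (by omega)
  have hZl := Z_lower m (by omega)
  have hZp : 0 < (cubeM (Fin (m+m))).real (Qset m) := lt_of_lt_of_le (by positivity) hZl
  have hZi : √m / 3 ≤ ((cubeM (Fin (m+m))).real (Qset m))⁻¹ := by
    rw [le_inv_comm₀ (by positivity) hZp, inv_div]; exact hZ
  calc (1/8448 : ℝ) = √m / 3 * (1/64 * (1/(44*√m))) := by field_simp; norm_num
    _ ≤ ((cubeM (Fin (m+m))).real (Qset m))⁻¹ * (1/64 * (1/(44*√((m-1:ℕ):ℝ)))) := by
        gcongr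
    _ ≤ _ := by gcongr


/-! ## Part R : Riesz products -/

section Riesz
variable {Ω ι : Type*} [MeasurableSpace Ω] (μ : Measure Ω) [IsProbabilityMeasure μ]

theorem mp_integral {T : Ω → Ω} (hT : MeasurePreserving T μ μ) {F : Ω → ℂ} (hF : Measurable F) :
    ∫ x, F (T x) ∂μ = ∫ x, F x ∂μ := by
  conv_rhs => rw [← hT.map_eq]
  rw [integral_map hT.measurable.aemeasurable hF.aestronglyMeasurable]

theorem mp_integralR {T : Ω → Ω} (hT : MeasurePreserving T μ μ) {F : Ω → ℝ} (hF : Measurable F) :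
    ∫ x, F (T x) ∂μ = ∫ x, F x ∂μ := by
  conv_rhs => rw [← hT.map_eq]
  rw [integral_map hT.measurable.aemeasurable hF.aestronglyMeasurable]

theorem fac_norm (l t : ℝ) (ht : |t| ≤ 1) : ‖(1 + Complex.I * ((l * t : ℝ) : ℂ))‖ ^ 2 ≤ 1 + l ^ 2 := by
  rw [Complex.sq_norm, Complex.normSq_apply]
  simp
  have : t ^ 2 ≤ 1 := by rw [← sq_abs]; exact pow_le_one₀ (abs_nonneg _) ht
  nlinarith [sq_nonneg l]

theorem fac_norm' (l t : ℝ) (ht : |t| ≤ 1) : ‖(1 + Complex.I * ((l * t : ℝ) : ℂ))‖ ≤ 1 + |l| := by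
  refine (norm_add_le _ _).trans ?_
  simp only [norm_one, norm_mul, Complex.norm_I, one_mul, Complex.norm_real, Real.norm_eq_abs]
  nlinarith [abs_nonneg l, abs_mul l t]

theorem riesz_drop [DecidableEq ι] (T : ι → Ω → Ω) (hT : ∀ I, MeasurePreserving (T I) μ μ)
    (θ : ι → Ω → ℝ) (hθm : ∀ I, Measurable (θ I)) (hθ1 : ∀ I x, |θ I x| ≤ 1)
    (hodd : ∀ I x, θ I (T I x) = - θ I x) (heven : ∀ I J, I ≠ J → ∀ x, θ J (T I x) = θ J x) (l : ℝ)
    (S : Finset ι) (F : Ω → ℂ) (hF : Measurable F) (C : ℝ) (hC : ∀ x, ‖F x‖ ≤ C)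
    (hinv : ∀ I ∈ S, ∀ x, F (T I x) = F x) :
    ∫ x, F x * ∏ I ∈ S, (1 + Complex.I * ((l * θ I x : ℝ) : ℂ)) ∂μ = ∫ x, F x ∂μ := by
  induction S using Finset.induction_on generalizing F C with
  | empty => simp
  | insert I S hI ih =>
    have hPm : ∀ S : Finset ι, Measurable (fun x => ∏ J ∈ S, (1 + Complex.I * ((l * θ J x : ℝ) : ℂ))) := by
      intro S
      refine Finset.measurable_prod _ (fun J _ => ?_)
      have := hθm J
      fun_prop
    have hPb : ∀ x, ‖∏ J ∈ S, (1 + Complex.I * ((l * θ J x : ℝ) : ℂ))‖ ≤ (1+|l|)^S.card := by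
      intro x
      rw [norm_prod]
      refine (Finset.prod_le_prod (fun _ _ => norm_nonneg _) (fun J _ => fac_norm' l _ (hθ1 J x))).trans ?_
      simp
    have hC0 : 0 ≤ C := by
      by_contra h
      push Not at h
      have hb : ∀ x : Ω, False := fun x => by linarith [norm_nonneg (F x), hC x]
      have : IsEmpty Ω := ⟨hb⟩
      have h1 := measure_univ (μ := μ)
      rw [univ_eq_empty_iff.2 this] at h1
      simp at h1
    have i1 : Integrable (fun x => F x * ∏ J ∈ S, (1 + Complex.I * ((l * θ J x : ℝ) : ℂ))) μ := by
      refine Integrable.of_bound (hF.mul (hPm S)).aestronglyMeasurable (C * (1+|l|)^S.card)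
        (Filter.Eventually.of_forall (fun x => ?_))
      rw [norm_mul]
      exact mul_le_mul (hC x) (hPb x) (norm_nonneg _) hC0
    have hGm : Measurable (fun x => (θ I x : ℂ) * (F x * ∏ J ∈ S, (1 + Complex.I * ((l * θ J x : ℝ) : ℂ)))) :=
      (Complex.measurable_ofReal.comp (hθm I)).mul (hF.mul (hPm S))
    have i2 : Integrable (fun x => (θ I x : ℂ) * (F x * ∏ J ∈ S, (1 + Complex.I * ((l * θ J x : ℝ) : ℂ)))) μ := by
      refine Integrable.of_bound hGm.aestronglyMeasurable (1 * (C * (1+|l|)^S.card))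
        (Filter.Eventually.of_forall (fun x => ?_))
      rw [norm_mul, norm_mul]
      refine mul_le_mul ?_ (mul_le_mul (hC x) (hPb x) (norm_nonneg _) hC0) (by positivity) (by norm_num)
      rw [Complex.norm_real]; exact hθ1 I x
    have hz : ∫ x, (θ I x : ℂ) * (F x * ∏ J ∈ S, (1 + Complex.I * ((l * θ J x : ℝ) : ℂ))) ∂μ = 0 := by
      have h := mp_integral μ (hT I) hGm
      have e : ∀ x, (θ I (T I x) : ℂ) * (F (T I x) * ∏ J ∈ S, (1 + Complex.I * ((l * θ J (T I x) : ℝ) : ℂ)))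
         = - ((θ I x : ℂ) * (F x * ∏ J ∈ S, (1 + Complex.I * ((l * θ J x : ℝ) : ℂ)))) := by
        intro x
        rw [hodd, hinv I (Finset.mem_insert_self _ _), Finset.prod_congr rfl (fun J hJ => by
          rw [heven I J (fun h => hI (h ▸ hJ))])]
        push_cast; ring
      simp only [e] at h
      rw [integral_neg] at h
      exact self_eq_neg.1 h.symm
    have e : ∀ x, F x * ∏ J ∈ insert I S, (1 + Complex.I * ((l * θ J x : ℝ) : ℂ))
      = F x * ∏ J ∈ S, (1 + Complex.I * ((l * θ J x : ℝ) : ℂ)) +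
        (Complex.I * l) * ((θ I x : ℂ) * (F x * ∏ J ∈ S, (1 + Complex.I * ((l * θ J x : ℝ) : ℂ)))) := by
      intro x
      rw [Finset.prod_insert hI]; push_cast; ring
    simp only [e]
    rw [integral_add i1 (i2.const_mul _), integral_const_mul, hz, mul_zero, add_zero]
    exact ih F hF C hC (fun J hJ => hinv J (Finset.mem_insert_of_mem hJ))

/-- The imaginary part of the Riesz product. -/
noncomputable def rz [Fintype ι] (θ : ι → Ω → ℝ) (l : ℝ) (x : Ω) : ℝ :=
  (∏ I, (1 + Complex.I * ((l * θ I x : ℝ) : ℂ))).im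

theorem measurable_rz [Fintype ι] (θ : ι → Ω → ℝ) (hθm : ∀ I, Measurable (θ I)) (l : ℝ) : Measurable (rz θ l) := by
  refine Complex.measurable_im.comp (Finset.measurable_prod _ (fun J _ => ?_))
  have := hθm J
  fun_prop

theorem prod_bound [Fintype ι] (θ : ι → Ω → ℝ) (hθ1 : ∀ I x, |θ I x| ≤ 1) (l : ℝ)
    (hl : l ^ 2 * Fintype.card ι ≤ 1) (x : Ω) : ‖∏ I, (1 + Complex.I * ((l * θ I x : ℝ) : ℂ))‖ ≤ 2 := by
  have h : ‖∏ I, (1 + Complex.I * ((l * θ I x : ℝ) : ℂ))‖ ^ 2 ≤ 2 ^ 2 := by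
    rw [norm_prod, ← Finset.prod_pow]
    calc _ ≤ ∏ _I : ι, (1 + l^2) := Finset.prod_le_prod (fun _ _ => sq_nonneg _) (fun J _ => fac_norm l _ (hθ1 J x))
      _ = (1 + l^2) ^ Fintype.card ι := by simp
      _ ≤ (Real.exp (l^2)) ^ Fintype.card ι := by
          apply pow_le_pow_left₀ (by positivity)
          linarith [Real.add_one_le_exp (l^2)]
      _ = Real.exp (Fintype.card ι * l^2) := by rw [← Real.exp_nat_mul]
      _ ≤ Real.exp 1 := Real.exp_le_exp.2 (by linarith)
      _ ≤ 2 ^ 2 := by linarith [Real.exp_one_lt_d9]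
  exact le_of_sq_le_sq h (by norm_num)

theorem rz_bound [Fintype ι] (θ : ι → Ω → ℝ) (hθ1 : ∀ I x, |θ I x| ≤ 1) (l : ℝ)
    (hl : l ^ 2 * Fintype.card ι ≤ 1) (x : Ω) : |rz θ l x| ≤ 2 :=
  (Complex.abs_im_le_norm _).trans (prod_bound θ hθ1 l hl x)

/-- Pairing of an additive function with the Riesz product. -/
theorem riesz_pair [DecidableEq ι] [Fintype ι] (T : ι → Ω → Ω) (hT : ∀ I, MeasurePreserving (T I) μ μ)
    (θ : ι → Ω → ℝ) (hθm : ∀ I, Measurable (θ I)) (hθ1 : ∀ I x, |θ I x| ≤ 1)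
    (hodd : ∀ I x, θ I (T I x) = - θ I x) (heven : ∀ I J, I ≠ J → ∀ x, θ J (T I x) = θ J x) (l : ℝ)
    (hl : l ^ 2 * Fintype.card ι ≤ 1)
    (g : ι → Ω → ℝ) (hg : ∀ I, Measurable (g I)) (C : ℝ) (hgC : ∀ I x, |g I x| ≤ C)
    (hginv : ∀ I J, I ≠ J → ∀ x, g J (T I x) = g J x)
    (g0 : Ω → ℝ) (hg0 : Measurable g0) (hg0C : ∀ x, |g0 x| ≤ C) (hg0inv : ∀ I x, g0 (T I x) = g0 x) :
    ∫ x, (∑ I, g I x + g0 x) * rz θ l x ∂μ = l * ∑ I, ∫ x, g I x * θ I x ∂μ := by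
  have hPm : Measurable (fun x => ∏ J, (1 + Complex.I * ((l * θ J x : ℝ) : ℂ))) := by
    refine Finset.measurable_prod _ (fun J _ => ?_)
    have := hθm J
    fun_prop
  have intg : ∀ u : Ω → ℝ, Measurable u → (∀ x, |u x| ≤ C) →
      Integrable (fun x => (u x : ℂ) * ∏ J, (1 + Complex.I * ((l * θ J x : ℝ) : ℂ))) μ := by
    intro u hu huC
    refine Integrable.of_bound ((Complex.measurable_ofReal.comp hu).mul hPm).aestronglyMeasurable (C * 2)
      (Filter.Eventually.of_forall (fun x => ?_))
    rw [norm_mul, Complex.norm_real]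
    exact mul_le_mul (huC x) (prod_bound θ hθ1 l hl x) (norm_nonneg _) ((abs_nonneg _).trans (huC x))
  have im_eq : ∀ u : Ω → ℝ, Measurable u → (∀ x, |u x| ≤ C) →
      ∫ x, u x * rz θ l x ∂μ = (∫ x, (u x : ℂ) * ∏ J, (1 + Complex.I * ((l * θ J x : ℝ) : ℂ)) ∂μ).im := by
    intro u hu huC
    have := integral_im (intg u hu huC)
    refine Eq.trans ?_ this
    congr 1
    funext x
    simp [rz, Complex.mul_im]
  have intr : ∀ u : Ω → ℝ, Measurable u → (∀ x, |u x| ≤ C) → Integrable (fun x => u x * rz θ l x) μ := by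
    intro u hu huC
    refine integrable_of_bdd (C := C * 2) (hu.mul (measurable_rz θ hθm l)) (fun x => ?_)
    rw [abs_mul]
    exact mul_le_mul (huC x) (rz_bound θ hθ1 l hl x) (abs_nonneg _) ((abs_nonneg _).trans (huC x))
  have h0 : ∫ x, g0 x * rz θ l x ∂μ = 0 := by
    rw [im_eq g0 hg0 hg0C, riesz_drop μ T hT θ hθm hθ1 hodd heven l Finset.univ (fun x => (g0 x : ℂ))
      (Complex.measurable_ofReal.comp hg0) C (fun x => by rw [Complex.norm_real]; exact hg0C x)
      (fun I _ x => by rw [hg0inv])]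
    rw [integral_complex_ofReal, Complex.ofReal_im]
  have hI : ∀ I, ∫ x, g I x * rz θ l x ∂μ = l * ∫ x, g I x * θ I x ∂μ := by
    intro I
    rw [im_eq _ (hg I) (hgC I)]
    have e : ∀ x, (g I x : ℂ) * ∏ J, (1 + Complex.I * ((l * θ J x : ℝ) : ℂ))
       = ((g I x : ℂ) * (1 + Complex.I * ((l * θ I x : ℝ) : ℂ))) *
         ∏ J ∈ Finset.univ.erase I, (1 + Complex.I * ((l * θ J x : ℝ) : ℂ)) := by
      intro x
      rw [← Finset.mul_prod_erase Finset.univ _ (Finset.mem_univ I)]; ring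
    simp only [e]
    have hmθ := hθm I
    have hmg := hg I
    rw [riesz_drop μ T hT θ hθm hθ1 hodd heven l (Finset.univ.erase I)
      (fun x => (g I x : ℂ) * (1 + Complex.I * ((l * θ I x : ℝ) : ℂ))) (by fun_prop) (C * (1+|l|)) ?_ ?_]
    · have i1 : Integrable (fun x => (g I x : ℂ) * (1 + Complex.I * ((l * θ I x : ℝ) : ℂ))) μ := by
        refine Integrable.of_bound (by fun_prop) (C * (1+|l|)) (Filter.Eventually.of_forall (fun x => ?_))
        rw [norm_mul, Complex.norm_real]
        exact mul_le_mul (hgC I x) (fac_norm' l _ (hθ1 I x)) (norm_nonneg _) ((abs_nonneg _).trans (hgC I x))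
      have := integral_im i1
      refine this.symm.trans ?_
      rw [← integral_const_mul]
      congr 1
      funext x
      simp
      ring
    · intro x
      rw [norm_mul, Complex.norm_real]
      exact mul_le_mul (hgC I x) (fac_norm' l _ (hθ1 I x)) (norm_nonneg _) ((abs_nonneg _).trans (hgC I x))
    · intro J hJ x
      have hJ := (Finset.mem_erase.1 hJ).1
      rw [hginv J I hJ, heven J I hJ]
  have e : ∀ x, (∑ I, g I x + g0 x) * rz θ l x = ∑ I, g I x * rz θ l x + g0 x * rz θ l x := by
    intro x; rw [add_mul, Finset.sum_mul]
  simp only [e]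
  rw [integral_add (integrable_finsetSum _ (fun I _ => intr _ (hg I) (hgC I))) (intr g0 hg0 hg0C), h0, add_zero,
    integral_finsetSum _ (fun I _ => intr _ (hg I) (hgC I)), Finset.mul_sum]
  exact Finset.sum_congr rfl (fun I _ => hI I)

end Riesz


/-! ## Part R2 : lower bound for the mean absolute comparison sum -/

/-- The comparison kernel. -/
noncomputable def kk (x y : ℝ) : ℝ := (if y < x then (1 : ℝ) else 0) - (if x < y then (1 : ℝ) else 0)

theorem kk_abs (x y : ℝ) : |kk x y| ≤ 1 := by
  unfold kk
  split_ifs <;> norm_num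

@[fun_prop]
theorem measurable_kk {X : Type*} [MeasurableSpace X] {f g : X → ℝ} (hf : Measurable f) (hg : Measurable g) :
    Measurable (fun x => kk (f x) (g x)) := by
  unfold kk
  exact (Measurable.ite (measurableSet_lt hg hf) measurable_const measurable_const).sub
    (Measurable.ite (measurableSet_lt hf hg) measurable_const measurable_const)

/-- The odd test function of a pair. -/
noncomputable def thP (δ x y : ℝ) : ℝ :=
  (if (δ ≤ x ∧ x < δ + 1/8) ∧ (3/4 + δ ≤ y ∧ y < 3/4 + δ + 1/8) then 1 else 0)
  - (if (δ + 1/4 ≤ x ∧ x < δ + 1/4 + 1/8) ∧ (1/2 + δ ≤ y ∧ y < 1/2 + δ + 1/8) then 1 else 0)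

theorem thP_abs (δ x y : ℝ) : |thP δ x y| ≤ 1 := by
  unfold thP
  split_ifs <;> norm_num

@[fun_prop]
theorem measurable_thP (δ : ℝ) {X : Type*} [MeasurableSpace X] {f g : X → ℝ} (hf : Measurable f) (hg : Measurable g) :
    Measurable (fun x => thP δ (f x) (g x)) := by
  unfold thP
  refine (Measurable.ite ?_ measurable_const measurable_const).sub
    (Measurable.ite ?_ measurable_const measurable_const)
  · exact ((measurableSet_le measurable_const hf).inter (measurableSet_lt hf measurable_const)).inter
      ((measurableSet_le measurable_const hg).inter (measurableSet_lt hg measurable_const))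
  · exact ((measurableSet_le measurable_const hf).inter (measurableSet_lt hf measurable_const)).inter
      ((measurableSet_le measurable_const hg).inter (measurableSet_lt hg measurable_const))

theorem thP_cases (δ x y : ℝ) (h0 : 0 ≤ δ) (h1 : δ ≤ 1/8) :
    (((δ ≤ x ∧ x < δ + 1/8) ∧ (3/4 + δ ≤ y ∧ y < 3/4 + δ + 1/8)) ∧ dl x y = 1/4 ∧ thP δ x y = 1
      ∧ thP δ (x + dl x y) (y - dl x y) = -1)
    ∨ (((δ + 1/4 ≤ x ∧ x < δ + 1/4 + 1/8) ∧ (1/2 + δ ≤ y ∧ y < 1/2 + δ + 1/8)) ∧ dl x y = -(1/4) ∧ thP δ x y = -1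
      ∧ thP δ (x + dl x y) (y - dl x y) = 1)
    ∨ (thP δ x y = 0 ∧ thP δ (x + dl x y) (y - dl x y) = 0) := by
  by_cases hA : (δ ≤ x ∧ x < δ + 1/8) ∧ (3/4 + δ ≤ y ∧ y < 3/4 + δ + 1/8)
  · left
    obtain ⟨⟨a, b⟩, c, d⟩ := hA
    have hd : dl x y = 1/4 := if_pos ⟨⟨by linarith, by linarith⟩, by linarith, by linarith⟩
    refine ⟨⟨⟨a, b⟩, c, d⟩, hd, ?_, ?_⟩
    · unfold thP
      rw [if_pos ⟨⟨a, b⟩, c, d⟩, if_neg (by rintro ⟨⟨a', b'⟩, c', d'⟩; linarith)]; norm_num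
    · rw [hd]; unfold thP
      rw [if_neg (by rintro ⟨⟨a', b'⟩, c', d'⟩; linarith), if_pos ⟨⟨by linarith, by linarith⟩, by linarith, by linarith⟩]
      norm_num
  · right
    by_cases hB : (δ + 1/4 ≤ x ∧ x < δ + 1/4 + 1/8) ∧ (1/2 + δ ≤ y ∧ y < 1/2 + δ + 1/8)
    · left
      obtain ⟨⟨a, b⟩, c, d⟩ := hB
      have hd : dl x y = -(1/4) := by
        unfold dl
        rw [if_neg (by rintro ⟨⟨a', b'⟩, c', d'⟩; linarith), if_pos ⟨⟨by linarith, by linarith⟩, by linarith, by linarith⟩]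
      refine ⟨⟨⟨a, b⟩, c, d⟩, hd, ?_, ?_⟩
      · unfold thP
        rw [if_neg hA, if_pos ⟨⟨a, b⟩, c, d⟩]; norm_num
      · rw [hd]; unfold thP
        rw [if_pos ⟨⟨by linarith, by linarith⟩, by linarith, by linarith⟩, if_neg (by rintro ⟨⟨a', b'⟩, c', d'⟩; linarith)]
        norm_num
    · right
      constructor
      · unfold thP; rw [if_neg hA, if_neg hB]; norm_num
      · by_cases hC : (0 ≤ x ∧ x < 1/4) ∧ (3/4 ≤ y ∧ y < 1)
        · have hd : dl x y = 1/4 := if_pos hC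
          obtain ⟨⟨a, b⟩, c, d⟩ := hC
          rw [hd]; unfold thP
          rw [if_neg (by rintro ⟨⟨a', b'⟩, c', d'⟩; linarith), if_neg]
          · norm_num
          · rintro ⟨⟨a', b'⟩, c', d'⟩
            exact hA ⟨⟨by linarith, by linarith⟩, by linarith, by linarith⟩
        · by_cases hD : (1/4 ≤ x ∧ x < 1/2) ∧ (1/2 ≤ y ∧ y < 3/4)
          · have hd : dl x y = -(1/4) := (if_neg hC).trans (if_pos hD)
            obtain ⟨⟨a, b⟩, c, d⟩ := hD
            rw [hd]; unfold thP
            rw [if_neg, if_neg (by rintro ⟨⟨a', b'⟩, c', d'⟩; linarith)]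
            · norm_num
            · rintro ⟨⟨a', b'⟩, c', d'⟩
              exact hB ⟨⟨by linarith, by linarith⟩, by linarith, by linarith⟩
          · have hd : dl x y = 0 := (if_neg hC).trans (if_neg hD)
            rw [hd, add_zero, sub_zero]
            unfold thP; rw [if_neg hA, if_neg hB]; norm_num

theorem thP_odd (δ x y : ℝ) (h0 : 0 ≤ δ) (h1 : δ ≤ 1/8) : thP δ (x + dl x y) (y - dl x y) = - thP δ x y := by
  rcases thP_cases δ x y h0 h1 with ⟨_, _, h, h'⟩ | ⟨_, _, h, h'⟩ | ⟨h, h'⟩ <;> rw [h, h'] <;> norm_num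

noncomputable def K4 (x y x' y' : ℝ) : ℝ := (kk x x' + kk y x') + (kk x y' + kk y y')

theorem kk_pos {x y : ℝ} (h : y < x) : kk x y = 1 := by
  unfold kk; rw [if_pos h, if_neg (by linarith)]; norm_num
theorem kk_neg {x y : ℝ} (h : x < y) : kk x y = -1 := by
  unfold kk; rw [if_neg (by linarith), if_pos h]; norm_num

theorem K4_base {x y x' y' : ℝ} (h : (0 ≤ x ∧ x < 1/8) ∧ (3/4 ≤ y ∧ y < 7/8))
    (h' : (1/8 ≤ x' ∧ x' < 1/4) ∧ (7/8 ≤ y' ∧ y' < 1)) :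
    K4 x y x' y' = -2 ∧ K4 (x+1/4) (y-1/4) x' y' = 0 ∧ K4 x y (x'+1/4) (y'-1/4) = 0
      ∧ K4 (x+1/4) (y-1/4) (x'+1/4) (y'-1/4) = -2 := by
  obtain ⟨⟨a, b⟩, c, d⟩ := h
  obtain ⟨⟨a', b'⟩, c', d'⟩ := h'
  refine ⟨?_, ?_, ?_, ?_⟩
  · unfold K4
    rw [kk_neg (by linarith), kk_pos (by linarith), kk_neg (by linarith), kk_neg (by linarith)]; norm_num
  · unfold K4
    rw [kk_pos (by linarith), kk_pos (by linarith), kk_neg (by linarith), kk_neg (by linarith)]; norm_num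
  · unfold K4
    rw [kk_neg (by linarith), kk_pos (by linarith), kk_neg (by linarith), kk_pos (by linarith)]; norm_num
  · unfold K4
    rw [kk_neg (by linarith), kk_pos (by linarith), kk_neg (by linarith), kk_neg (by linarith)]; norm_num

theorem second_diff (x y x' y' : ℝ) :
    (K4 x y x' y' - K4 (x + dl x y) (y - dl x y) x' y' - K4 x y (x' + dl x' y') (y' - dl x' y')
      + K4 (x + dl x y) (y - dl x y) (x' + dl x' y') (y' - dl x' y')) * (thP 0 x y * thP (1/8) x' y')
    = -4 * (thP 0 x y ^ 2 * thP (1/8) x' y' ^ 2) := by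
  rcases thP_cases 0 x y (by norm_num) (by norm_num) with ⟨⟨⟨a, b⟩, c, d⟩, hd, h, -⟩ | ⟨⟨⟨a, b⟩, c, d⟩, hd, h, -⟩ | ⟨h, -⟩
  · rcases thP_cases (1/8) x' y' (by norm_num) (by norm_num) with ⟨⟨⟨a', b'⟩, c', d'⟩, hd', h', -⟩ | ⟨⟨⟨a', b'⟩, c', d'⟩, hd', h', -⟩ | ⟨h', -⟩
    · obtain ⟨e1, e2, e3, e4⟩ := K4_base (x := x) (y := y) (x' := x') (y' := y')
        ⟨⟨by linarith, by linarith⟩, by linarith, by linarith⟩ ⟨⟨by linarith, by linarith⟩, by linarith, by linarith⟩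
      rw [hd, hd', h, h', e1, e2, e3, e4]; norm_num
    · obtain ⟨e1, e2, e3, e4⟩ := K4_base (x := x) (y := y) (x' := x' + -(1/4)) (y' := y' - -(1/4))
        ⟨⟨by linarith, by linarith⟩, by linarith, by linarith⟩ ⟨⟨by linarith, by linarith⟩, by linarith, by linarith⟩
      rw [neg_add_cancel_right, sub_neg_eq_add, add_sub_cancel_right] at e3 e4
      rw [sub_neg_eq_add] at e1 e2
      rw [hd, hd', h, h', sub_neg_eq_add, e1, e2, e3, e4]; norm_num
    · rw [h']; ring
  · rcases thP_cases (1/8) x' y' (by norm_num) (by norm_num) with ⟨⟨⟨a', b'⟩, c', d'⟩, hd', h', -⟩ | ⟨⟨⟨a', b'⟩, c', d'⟩, hd', h', -⟩ | ⟨h', -⟩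
    · obtain ⟨e1, e2, e3, e4⟩ := K4_base (x := x + -(1/4)) (y := y - -(1/4)) (x' := x') (y' := y')
        ⟨⟨by linarith, by linarith⟩, by linarith, by linarith⟩ ⟨⟨by linarith, by linarith⟩, by linarith, by linarith⟩
      rw [neg_add_cancel_right, sub_neg_eq_add, add_sub_cancel_right] at e2 e4
      rw [sub_neg_eq_add] at e1 e3
      rw [hd, hd', h, h', sub_neg_eq_add, e1, e2, e3, e4]; norm_num
    · obtain ⟨e1, e2, e3, e4⟩ := K4_base (x := x + -(1/4)) (y := y - -(1/4)) (x' := x' + -(1/4)) (y' := y' - -(1/4))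
        ⟨⟨by linarith, by linarith⟩, by linarith, by linarith⟩ ⟨⟨by linarith, by linarith⟩, by linarith, by linarith⟩
      simp only [neg_add_cancel_right, sub_neg_eq_add, add_sub_cancel_right] at e1 e2 e3 e4
      rw [hd, hd', h, h', sub_neg_eq_add, sub_neg_eq_add, e1, e2, e3, e4]; norm_num
    · rw [h']; ring
  · rw [h]; ring

abbrev Die (m : ℕ) := Fin (m+m+1) → ℝ
def lc (m : ℕ) (I : Fin m) : Fin (m+m+1) := (lo m I).castSucc
def uc (m : ℕ) (I : Fin m) : Fin (m+m+1) := (up m I).castSucc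

theorem lc_ne_uc (m : ℕ) (I J : Fin m) : lc m I ≠ uc m J := fun h => lo_ne_up m I J (Fin.castSucc_inj.1 h)
theorem lc_inj (m : ℕ) {I J : Fin m} (h : I ≠ J) : lc m I ≠ lc m J := by
  intro e
  apply h
  have := Fin.castSucc_inj.1 e
  exact Fin.castAdd_injective _ _ this
theorem uc_inj (m : ℕ) {I J : Fin m} (h : I ≠ J) : uc m I ≠ uc m J := by
  intro e
  apply h
  have := Fin.castSucc_inj.1 e
  exact Fin.natAdd_injective _ _ this

theorem sum_die (m : ℕ) (h : ℝ → ℝ) (a : Die m) :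
    ∑ i, h (a i) = ∑ I, (h (a (lc m I)) + h (a (uc m I))) + h (a (Fin.last _)) := by
  rw [Fin.sum_univ_castSucc, Fin.sum_univ_add, Finset.sum_add_distrib]
  rfl

noncomputable def th (m : ℕ) (δ : ℝ) (I : Fin m) (a : Die m) : ℝ := thP δ (a (lc m I)) (a (uc m I))
noncomputable def Tp (m : ℕ) (I : Fin m) : Die m → Die m := TT (lc m I) (uc m I)

theorem Tp_mp (m : ℕ) (I : Fin m) : MeasurePreserving (Tp m I) (muM m) (muM m) :=
  TT_mp_mu m (lo m I) (up m I) (lo_ne_up m I I)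
theorem Tp_l (m : ℕ) (I : Fin m) (a : Die m) : Tp m I a (lc m I) = a (lc m I) + dl (a (lc m I)) (a (uc m I)) := TT_i _ _ _
theorem Tp_u (m : ℕ) (I : Fin m) (a : Die m) : Tp m I a (uc m I) = a (uc m I) - dl (a (lc m I)) (a (uc m I)) :=
  TT_j _ _ (lc_ne_uc m I I) _
theorem Tp_l' (m : ℕ) {I J : Fin m} (h : I ≠ J) (a : Die m) : Tp m I a (lc m J) = a (lc m J) :=
  TT_k _ _ _ (lc_inj m h.symm) (lc_ne_uc m J I) a
theorem Tp_u' (m : ℕ) {I J : Fin m} (h : I ≠ J) (a : Die m) : Tp m I a (uc m J) = a (uc m J) :=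
  TT_k _ _ _ (lc_ne_uc m I J).symm (uc_inj m h.symm) a
theorem Tp_last (m : ℕ) (I : Fin m) (a : Die m) : Tp m I a (Fin.last _) = a (Fin.last _) :=
  TT_k _ _ _ (Fin.castSucc_lt_last _).ne' (Fin.castSucc_lt_last _).ne' a

theorem measurable_th (m : ℕ) (δ : ℝ) (I : Fin m) : Measurable (th m δ I) := by
  unfold th; fun_prop
theorem th_abs (m : ℕ) (δ : ℝ) (I : Fin m) (a : Die m) : |th m δ I a| ≤ 1 := thP_abs _ _ _
theorem th_odd (m : ℕ) (δ : ℝ) (h0 : 0 ≤ δ) (h1 : δ ≤ 1/8) (I : Fin m) (a : Die m) :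
    th m δ I (Tp m I a) = - th m δ I a := by
  unfold th; rw [Tp_l, Tp_u]; exact thP_odd _ _ _ h0 h1
theorem th_even (m : ℕ) (δ : ℝ) (I J : Fin m) (h : I ≠ J) (a : Die m) : th m δ J (Tp m I a) = th m δ J a := by
  unfold th; rw [Tp_l' m h, Tp_u' m h]

theorem rz_dice (m : ℕ) (hm : 1 ≤ m) (δ : ℝ) (h0 : 0 ≤ δ) (h1 : δ ≤ 1/8) (l : ℝ) (hl : l^2 * m ≤ 1)
    (h : ℝ → ℝ) (hh : Measurable h) (C : ℝ) (hC : ∀ x, |h x| ≤ C) :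
    ∫ a, (∑ i, h (a i)) * rz (th m δ) l a ∂(muM m)
      = l * ∑ I, ∫ a, (h (a (lc m I)) + h (a (uc m I))) * th m δ I a ∂(muM m) := by
  have := prob_muM m hm
  have hC0 : 0 ≤ C := (abs_nonneg _).trans (hC 0)
  simp only [sum_die]
  refine riesz_pair (muM m) (Tp m) (Tp_mp m) (th m δ) (measurable_th m δ) (th_abs m δ) (th_odd m δ h0 h1)
    (th_even m δ) l (by simpa using hl) (fun I a => h (a (lc m I)) + h (a (uc m I))) (fun I => by fun_prop)
    (C + C) (fun I x => (abs_add_le _ _).trans (add_le_add (hC _) (hC _)))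
    (fun I J hIJ x => by rw [Tp_l' m hIJ, Tp_u' m hIJ]) (fun a => h (a (Fin.last _))) (by fun_prop)
    (fun x => by linarith [hC (x (Fin.last _))]) (fun I x => by rw [Tp_last])

/-- Mean of the squared test function. -/
noncomputable def th2 (m : ℕ) (δ : ℝ) (I : Fin m) : ℝ := ∫ a, th m δ I a ^ 2 ∂(muM m)

theorem th2_lower (m : ℕ) (hm : 2 ≤ m) (δ : ℝ) (h0 : 0 ≤ δ) (h1 : δ ≤ 1/8) (I : Fin m) : 1/8448 ≤ th2 m δ I := by
  have := prob_muM m (by omega)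
  have hp := pair_prob m hm I δ h0 h1
  refine hp.trans ?_
  have hs : MeasurableSet {a : Die m | (δ ≤ a (lo m I).castSucc ∧ a (lo m I).castSucc < δ + 1/8) ∧
      (3/4 + δ ≤ a (up m I).castSucc ∧ a (up m I).castSucc < 3/4 + δ + 1/8)} := by
    have h1 : Measurable (fun a : Die m => a (lo m I).castSucc) := measurable_pi_apply _
    have h2 : Measurable (fun a : Die m => a (up m I).castSucc) := measurable_pi_apply _
    exact ((measurableSet_le measurable_const h1).inter (measurableSet_lt h1 measurable_const)).inter
        ((measurableSet_le measurable_const h2).inter (measurableSet_lt h2 measurable_const))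
  rw [← integral_indicator_one hs]
  unfold th2
  have mt := measurable_th m δ I
  apply integral_mono_of_nonneg
  · exact Filter.Eventually.of_forall (fun a => indicator_nonneg (fun _ _ => zero_le_one) a)
  · refine integrable_of_bdd (C := 1) (by fun_prop) (fun a => ?_)
    rw [abs_pow]; exact pow_le_one₀ (abs_nonneg _) (th_abs m δ I a)
  · refine Filter.Eventually.of_forall (fun a => ?_)
    apply indicator_le' _ (fun _ _ => sq_nonneg _)
    intro a ha
    have : th m δ I a = 1 := by
      rcases thP_cases δ (a (lc m I)) (a (uc m I)) h0 h1 with ⟨_, _, h, _⟩ | ⟨⟨⟨h, _⟩, _⟩, _, _, _⟩ | ⟨h, _⟩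
      · exact h
      · exfalso; have := ha.1.2; unfold lc at h; linarith
      · exfalso
        have ha' : (δ ≤ a (lc m I) ∧ a (lc m I) < δ + 1/8) ∧
          (3/4 + δ ≤ a (uc m I) ∧ a (uc m I) < 3/4 + δ + 1/8) := ha
        unfold thP at h
        rw [if_pos ha'] at h
        split_ifs at h with h2
        · have := ha.1.2; have := h2.1.1; unfold lc at this; linarith
        · norm_num at h
    simp [this]

theorem pair_exact (m : ℕ) (hm : 1 ≤ m) (I J : Fin m) :
    ∫ q, K4 (q.1 (lc m I)) (q.1 (uc m I)) (q.2 (lc m J)) (q.2 (uc m J)) * (th m 0 I q.1 * th m (1/8) J q.2)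
      ∂((muM m).prod (muM m)) = - (th2 m 0 I * th2 m (1/8) J) := by
  have := prob_muM m hm
  set g : Die m × Die m → ℝ := fun q =>
    K4 (q.1 (lc m I)) (q.1 (uc m I)) (q.2 (lc m J)) (q.2 (uc m J)) * (th m 0 I q.1 * th m (1/8) J q.2) with hg
  have m1 := measurable_th m 0 I
  have m2 := measurable_th m (1/8) J
  have hgm : Measurable g := by
    simp only [hg, K4]; fun_prop
  have hgb : ∀ q, |g q| ≤ 4 := by
    intro q
    have hK : |K4 (q.1 (lc m I)) (q.1 (uc m I)) (q.2 (lc m J)) (q.2 (uc m J))| ≤ 4 := by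
      unfold K4
      have := fun x y => abs_le.1 (kk_abs x y)
      rw [abs_le]
      constructor
      · linarith [(this (q.1 (lc m I)) (q.2 (lc m J))).1, (this (q.1 (uc m I)) (q.2 (lc m J))).1,
          (this (q.1 (lc m I)) (q.2 (uc m J))).1, (this (q.1 (uc m I)) (q.2 (uc m J))).1]
      · linarith [(this (q.1 (lc m I)) (q.2 (lc m J))).2, (this (q.1 (uc m I)) (q.2 (lc m J))).2,
          (this (q.1 (lc m I)) (q.2 (uc m J))).2, (this (q.1 (uc m I)) (q.2 (uc m J))).2]
    simp only [hg, abs_mul]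
    have h11 : |th m 0 I q.1| * |th m (1/8) J q.2| ≤ 1 * 1 :=
      mul_le_mul (th_abs _ _ _ _) (th_abs _ _ _ _) (abs_nonneg _) (by norm_num)
    have := mul_le_mul hK h11 (by positivity) (by norm_num)
    linarith
  have p1 : MeasurePreserving (Prod.map (Tp m I) id) ((muM m).prod (muM m)) ((muM m).prod (muM m)) :=
    (Tp_mp m I).prod (MeasurePreserving.id _)
  have p2 : MeasurePreserving (Prod.map id (Tp m J)) ((muM m).prod (muM m)) ((muM m).prod (muM m)) :=
    (MeasurePreserving.id _).prod (Tp_mp m J)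
  have p3 : MeasurePreserving (Prod.map (Tp m I) (Tp m J)) ((muM m).prod (muM m)) ((muM m).prod (muM m)) :=
    (Tp_mp m I).prod (Tp_mp m J)
  have q1 := mp_integralR _ p1 hgm
  have q2 := mp_integralR _ p2 hgm
  have q3 := mp_integralR _ p3 hgm
  have i0 : Integrable g ((muM m).prod (muM m)) := integrable_of_bdd hgm hgb
  have i1 : Integrable (fun q => g (Prod.map (Tp m I) id q)) ((muM m).prod (muM m)) :=
    integrable_of_bdd (hgm.comp p1.measurable) (fun q => hgb _)
  have i2 : Integrable (fun q => g (Prod.map id (Tp m J) q)) ((muM m).prod (muM m)) :=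
    integrable_of_bdd (hgm.comp p2.measurable) (fun q => hgb _)
  have i3 : Integrable (fun q => g (Prod.map (Tp m I) (Tp m J) q)) ((muM m).prod (muM m)) :=
    integrable_of_bdd (hgm.comp p3.measurable) (fun q => hgb _)
  have e : ∫ q, ((g q + g (Prod.map (Tp m I) id q)) + (g (Prod.map id (Tp m J) q) + g (Prod.map (Tp m I) (Tp m J) q)))
      ∂((muM m).prod (muM m)) = 4 * ∫ q, g q ∂((muM m).prod (muM m)) := by
    have i01 : Integrable (fun q => g q + g (Prod.map (Tp m I) id q)) ((muM m).prod (muM m)) := i0.add i1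
    have i23 : Integrable (fun q => g (Prod.map id (Tp m J) q) + g (Prod.map (Tp m I) (Tp m J) q)) ((muM m).prod (muM m)) := i2.add i3
    rw [integral_add i01 i23, integral_add i0 i1, integral_add i2 i3, q1, q2, q3]; ring
  have e2 : ∀ q, ((g q + g (Prod.map (Tp m I) id q)) + (g (Prod.map id (Tp m J) q) + g (Prod.map (Tp m I) (Tp m J) q)))
     = -4 * (th m 0 I q.1 ^ 2 * th m (1/8) J q.2 ^ 2) := by
    rintro ⟨a, b⟩
    have := second_diff (a (lc m I)) (a (uc m I)) (b (lc m J)) (b (uc m J))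
    simp only [hg, Prod.map, id, th_odd m 0 le_rfl (by norm_num), th_odd m (1/8) (by norm_num) le_rfl, Tp_l, Tp_u]
    simp only [th]
    linear_combination this
  simp only [e2] at e
  rw [integral_const_mul, integral_prod_mul (fun a => th m 0 I a ^ 2) (fun b => th m (1/8) J b ^ 2)] at e
  unfold th2
  linarith


/-- The comparison sum. -/
noncomputable def Kb (m : ℕ) (A B : Die m) : ℝ := ∑ i, ∑ j, kk (A i) (B j)

theorem measurable_Kb (m : ℕ) : Measurable (fun q : Die m × Die m => Kb m q.1 q.2) := by
  unfold Kb; fun_prop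

theorem Kb_abs (m : ℕ) (A B : Die m) : |Kb m A B| ≤ (m+m+1)^2 := by
  unfold Kb
  calc _ ≤ ∑ i : Fin (m+m+1), ∑ j : Fin (m+m+1), (1:ℝ) := by
        refine (Finset.abs_sum_le_sum_abs _ _).trans (Finset.sum_le_sum (fun i _ => ?_))
        exact (Finset.abs_sum_le_sum_abs _ _).trans (Finset.sum_le_sum (fun j _ => kk_abs _ _))
    _ = _ := by simp; ring

theorem sumkk_abs (m : ℕ) (A : Die m) (y : ℝ) : |∑ i, kk (A i) y| ≤ (m+m+1) := by
  calc _ ≤ ∑ i : Fin (m+m+1), (1:ℝ) := by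
        exact (Finset.abs_sum_le_sum_abs _ _).trans (Finset.sum_le_sum (fun j _ => kk_abs _ _))
    _ = _ := by simp

theorem EK_lower (m : ℕ) (hm : 2 ≤ m) :
    (1/8448)^2 / 4 * m ≤ ∫ q, |Kb m q.1 q.2| ∂((muM m).prod (muM m)) := by
  have := prob_muM m (by omega)
  have hm' : (0:ℝ) < m := by exact_mod_cast (by omega : 0 < m)
  set l : ℝ := 1 / √m with hl
  have hl2 : l^2 * m = 1 := by
    rw [hl, div_pow, Real.sq_sqrt hm'.le]; field_simp
  set R := rz (th m 0) l with hR
  set R' := rz (th m (1/8)) l with hR'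
  have mR : Measurable R := measurable_rz _ (measurable_th m 0) l
  have mR' : Measurable R' := measurable_rz _ (measurable_th m _) l
  have bR : ∀ a, |R a| ≤ 2 := rz_bound _ (th_abs m 0) l (by simpa using hl2.le)
  have bR' : ∀ a, |R' a| ≤ 2 := rz_bound _ (th_abs m _) l (by simpa using hl2.le)
  have mth := fun I => measurable_th m (1/8) I
  have mth0 := fun I => measurable_th m 0 I
  have mK := measurable_Kb m
  set N : ℝ := (m:ℝ)+m+1 with hN
  have hN0 : 0 ≤ N := by positivity
  -- first step
  have s1 : ∀ A, ∫ B, Kb m A B * R' B ∂(muM m)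
      = l * ∑ J, ∫ B, (∑ i, kk (A i) (B (lc m J)) + ∑ i, kk (A i) (B (uc m J))) * th m (1/8) J B ∂(muM m) := by
    intro A
    have := rz_dice m (by omega) (1/8) (by norm_num) le_rfl l hl2.le (fun y => ∑ i, kk (A i) y) (by fun_prop)
      N (sumkk_abs m A)
    rw [← this]
    congr 1
    funext B
    unfold Kb
    rw [Finset.sum_comm]
  have s2 : ∀ (B : Die m) J, ∫ A, (∑ i, kk (A i) (B (lc m J)) + ∑ i, kk (A i) (B (uc m J))) * R A ∂(muM m)
      = l * ∑ I, ∫ A, K4 (A (lc m I)) (A (uc m I)) (B (lc m J)) (B (uc m J)) * th m 0 I A ∂(muM m) := by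
    intro B J
    have := rz_dice m (by omega) 0 le_rfl (by norm_num) l hl2.le (fun x => kk x (B (lc m J)) + kk x (B (uc m J))) (by fun_prop)
      2 (fun x => by
        have := (abs_add_le (kk x (B (lc m J))) (kk x (B (uc m J)))).trans (add_le_add (kk_abs _ _) (kk_abs _ _))
        linarith)
    simp only [← Finset.sum_add_distrib]
    rw [this]
    congr 1
    refine Finset.sum_congr rfl (fun I _ => ?_)
    congr 1
    funext A
    unfold K4
    ring
  have bsum : ∀ (A B : Die m) J, |∑ i, kk (A i) (B (lc m J)) + ∑ i, kk (A i) (B (uc m J))| ≤ N + N := by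
    intro A B J
    exact (abs_add_le _ _).trans (add_le_add (sumkk_abs m A _) (sumkk_abs m A _))
  -- the double integral
  have e1 : ∫ q, Kb m q.1 q.2 * R' q.2 * R q.1 ∂((muM m).prod (muM m))
      = ∫ A, (∫ B, Kb m A B * R' B ∂(muM m)) * R A ∂(muM m) := by
    rw [integral_prod]
    · simp only [integral_mul_const]
    · refine integrable_of_bdd (C := N^2 * 2 * 2) (by fun_prop) (fun q => ?_)
      rw [abs_mul, abs_mul]
      exact mul_le_mul (mul_le_mul (Kb_abs m _ _) (bR' _) (abs_nonneg _) (by positivity)) (bR _) (abs_nonneg _) (by positivity)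
  have intJ : ∀ J, Integrable (fun q : Die m × Die m =>
      (∑ i, kk (q.1 i) (q.2 (lc m J)) + ∑ i, kk (q.1 i) (q.2 (uc m J))) * th m (1/8) J q.2 * R q.1) ((muM m).prod (muM m)) := by
    intro J
    refine integrable_of_bdd (C := (N+N) * 1 * 2) (by fun_prop) (fun q => ?_)
    rw [abs_mul, abs_mul]
    exact mul_le_mul (mul_le_mul (bsum _ _ _) (th_abs _ _ _ _) (abs_nonneg _) (by positivity)) (bR _) (abs_nonneg _) (by positivity)
  have intIJ : ∀ I J, Integrable (fun q : Die m × Die m =>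
      K4 (q.1 (lc m I)) (q.1 (uc m I)) (q.2 (lc m J)) (q.2 (uc m J)) * (th m 0 I q.1 * th m (1/8) J q.2)) ((muM m).prod (muM m)) := by
    intro I J
    refine integrable_of_bdd (C := 4) (by unfold K4; fun_prop) (fun q => ?_)
    have hK : |K4 (q.1 (lc m I)) (q.1 (uc m I)) (q.2 (lc m J)) (q.2 (uc m J))| ≤ 4 := by
      unfold K4
      refine (abs_add_le _ _).trans ?_
      have h1 := (abs_add_le (kk (q.1 (lc m I)) (q.2 (lc m J))) (kk (q.1 (uc m I)) (q.2 (lc m J)))).trans (add_le_add (kk_abs _ _) (kk_abs _ _))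
      have h2 := (abs_add_le (kk (q.1 (lc m I)) (q.2 (uc m J))) (kk (q.1 (uc m I)) (q.2 (uc m J)))).trans (add_le_add (kk_abs _ _) (kk_abs _ _))
      linarith
    rw [abs_mul, abs_mul]
    have h11 : |th m 0 I q.1| * |th m (1/8) J q.2| ≤ 1 * 1 :=
      mul_le_mul (th_abs _ _ _ _) (th_abs _ _ _ _) (abs_nonneg _) (by norm_num)
    have := mul_le_mul hK h11 (by positivity) (by norm_num)
    linarith
  have e2 : ∫ A, (∫ B, Kb m A B * R' B ∂(muM m)) * R A ∂(muM m)
      = l * ∑ J, ∫ B, ∫ A, (∑ i, kk (A i) (B (lc m J)) + ∑ i, kk (A i) (B (uc m J))) * th m (1/8) J B * R A ∂(muM m) ∂(muM m) := by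
    have : ∀ A, (∫ B, Kb m A B * R' B ∂(muM m)) * R A = l * ∑ J, ∫ B, (∑ i, kk (A i) (B (lc m J)) + ∑ i, kk (A i) (B (uc m J))) * th m (1/8) J B * R A ∂(muM m) := by
      intro A
      rw [s1, mul_assoc, Finset.sum_mul]
      simp only [integral_mul_const]
    simp only [this]
    rw [integral_const_mul, integral_finsetSum]
    · congr 1
      refine Finset.sum_congr rfl (fun J _ => ?_)
      exact integral_integral_swap (intJ J)
    · intro J _
      exact (intJ J).integral_prod_left
  have e3 : ∀ J, ∫ B, ∫ A, (∑ i, kk (A i) (B (lc m J)) + ∑ i, kk (A i) (B (uc m J))) * th m (1/8) J B * R A ∂(muM m) ∂(muM m)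
      = l * ∑ I, - (th2 m 0 I * th2 m (1/8) J) := by
    intro J
    have : ∀ B : Die m, ∫ A, (∑ i, kk (A i) (B (lc m J)) + ∑ i, kk (A i) (B (uc m J))) * th m (1/8) J B * R A ∂(muM m)
      = l * ∑ I, ∫ A, K4 (A (lc m I)) (A (uc m I)) (B (lc m J)) (B (uc m J)) * (th m 0 I A * th m (1/8) J B) ∂(muM m) := by
      intro B
      have h1 : ∀ A : Die m, (∑ i, kk (A i) (B (lc m J)) + ∑ i, kk (A i) (B (uc m J))) * th m (1/8) J B * R A
        = th m (1/8) J B * ((∑ i, kk (A i) (B (lc m J)) + ∑ i, kk (A i) (B (uc m J))) * R A) := fun A => by ring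
      simp only [h1]
      rw [integral_const_mul, s2]
      have h2 : ∀ I (A : Die m), K4 (A (lc m I)) (A (uc m I)) (B (lc m J)) (B (uc m J)) * (th m 0 I A * th m (1/8) J B)
        = th m (1/8) J B * (K4 (A (lc m I)) (A (uc m I)) (B (lc m J)) (B (uc m J)) * th m 0 I A) := fun I A => by ring
      simp only [h2, integral_const_mul, ← Finset.mul_sum]
      ring
    simp only [this]
    rw [integral_const_mul, integral_finsetSum]
    · congr 1
      refine Finset.sum_congr rfl (fun I _ => ?_)
      rw [← pair_exact m (by omega) I J, integral_prod_symm _ (intIJ I J)]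
    · intro I _
      exact (intIJ I J).integral_prod_right
  have e4 : ∫ q, Kb m q.1 q.2 * R' q.2 * R q.1 ∂((muM m).prod (muM m)) = - (l^2 * ∑ J, ∑ I, th2 m 0 I * th2 m (1/8) J) := by
    rw [e1, e2]
    simp only [e3, Finset.sum_neg_distrib, ← Finset.mul_sum]
    ring
  have low : (1/8448)^2 * m ≤ l^2 * ∑ J, ∑ I, th2 m 0 I * th2 m (1/8) J := by
    have : ∑ J : Fin m, ∑ I : Fin m, ((1:ℝ)/8448)^2 ≤ ∑ J, ∑ I, th2 m 0 I * th2 m (1/8) J := by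
      refine Finset.sum_le_sum (fun J _ => Finset.sum_le_sum (fun I _ => ?_))
      rw [sq]
      exact mul_le_mul (th2_lower m hm 0 le_rfl (by norm_num) I) (th2_lower m hm _ (by norm_num) le_rfl J) (by norm_num)
        ((by norm_num : (0:ℝ) ≤ 1/8448).trans (th2_lower m hm 0 le_rfl (by norm_num) I))
    calc _ = l^2 * ∑ J : Fin m, ∑ I : Fin m, ((1:ℝ)/8448)^2 := by
          simp only [Finset.sum_const, Finset.card_univ, Fintype.card_fin, nsmul_eq_mul]
          linear_combination (-(1/8448)^2 * (m:ℝ)) * hl2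
      _ ≤ _ := mul_le_mul_of_nonneg_left this (sq_nonneg _)
  have upb : |∫ q, Kb m q.1 q.2 * R' q.2 * R q.1 ∂((muM m).prod (muM m))| ≤ 4 * ∫ q, |Kb m q.1 q.2| ∂((muM m).prod (muM m)) := by
    refine (abs_integral_le_integral_abs).trans ?_
    rw [← integral_const_mul]
    apply integral_mono_of_nonneg (Filter.Eventually.of_forall (fun _ => abs_nonneg _))
    · refine (integrable_of_bdd (C := N^2) (by fun_prop) (fun q => ?_)).const_mul _
      rw [abs_abs]; exact Kb_abs m _ _
    · refine Filter.Eventually.of_forall (fun q => ?_)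
      simp only [abs_mul]
      have := mul_le_mul (mul_le_mul (le_refl |Kb m q.1 q.2|) (bR' q.2) (abs_nonneg _) (abs_nonneg _)) (bR q.1) (abs_nonneg _) (by positivity)
      linarith
  rw [e4, abs_neg] at upb
  have := le_abs_self (l^2 * ∑ J, ∑ I, th2 m 0 I * th2 m (1/8) J)
  linarith


/-! ## Part A : the abstract quasirandomness lemma -/

theorem cs_int {Ω : Type*} [MeasurableSpace Ω] {μ : Measure Ω} {f g : Ω → ℝ}
    (hff : Integrable (fun x => f x ^ 2) μ) (hgg : Integrable (fun x => g x ^ 2) μ)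
    (hfg : Integrable (fun x => f x * g x) μ) :
    (∫ x, f x * g x ∂μ) ^ 2 ≤ (∫ x, f x ^ 2 ∂μ) * ∫ x, g x ^ 2 ∂μ := by
  have h : ∀ t : ℝ, 0 ≤ (∫ x, f x ^ 2 ∂μ) * (t * t) + (2 * ∫ x, f x * g x ∂μ) * t + ∫ x, g x ^ 2 ∂μ := by
    intro t
    have h0 : 0 ≤ ∫ x, (t * f x + g x) ^ 2 ∂μ := integral_nonneg (fun x => sq_nonneg _)
    have e : ∀ x, (t * f x + g x) ^ 2 = (t * t * f x ^ 2 + 2 * t * (f x * g x)) + g x ^ 2 := fun x => by ring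
    simp only [e] at h0
    have i1 : Integrable (fun x => t * t * f x ^ 2 + 2 * t * (f x * g x)) μ := (hff.const_mul _).add (hfg.const_mul _)
    rw [integral_add i1 hgg, integral_add (hff.const_mul _) (hfg.const_mul _), integral_const_mul, integral_const_mul] at h0
    linarith
  have := discrim_le_zero h
  unfold discrim at this
  linarith

theorem cs_bdd {Ω : Type*} [MeasurableSpace Ω] {μ : Measure Ω} [IsFiniteMeasure μ] {f g : Ω → ℝ}
    (hf : Measurable f) (hg : Measurable g) {C C' : ℝ} (hC : ∀ x, |f x| ≤ C) (hC' : ∀ x, |g x| ≤ C') :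
    (∫ x, f x * g x ∂μ) ^ 2 ≤ (∫ x, f x ^ 2 ∂μ) * ∫ x, g x ^ 2 ∂μ := by
  apply cs_int
  · refine integrable_of_bdd (C := C^2) (by fun_prop) (fun x => ?_)
    rw [abs_pow]; exact pow_le_pow_left₀ (abs_nonneg _) (hC x) 2
  · refine integrable_of_bdd (C := C'^2) (by fun_prop) (fun x => ?_)
    rw [abs_pow]; exact pow_le_pow_left₀ (abs_nonneg _) (hC' x) 2
  · refine integrable_of_bdd (C := C * C') (by fun_prop) (fun x => ?_)
    rw [abs_mul]; exact mul_le_mul (hC x) (hC' x) (abs_nonneg _) ((abs_nonneg _).trans (hC x))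

section Abs
variable {Ω : Type*} [MeasurableSpace Ω] (μ : Measure Ω) [IsProbabilityMeasure μ] (p : Ω → Ω → ℝ)

/-- The correlation defect. -/
noncomputable def DD (q : Ω × Ω) : ℝ := ∫ a, p a q.1 * p a q.2 ∂μ - 1/4

noncomputable def ee : ℝ := ∫ q, DD μ p q ^ 2 ∂(μ.prod μ)

theorem measurable_DD (hp : Measurable (fun q : Ω × Ω => p q.1 q.2)) : Measurable (DD μ p) := by
  unfold DD
  apply Measurable.sub_const
  have : Measurable (fun r : (Ω × Ω) × Ω => p r.2 r.1.1 * p r.2 r.1.2) :=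
    (hp.comp (measurable_snd.prodMk (measurable_fst.comp measurable_fst))).mul
      (hp.comp (measurable_snd.prodMk (measurable_snd.comp measurable_fst)))
  exact this.stronglyMeasurable.integral_prod_right.measurable

theorem DD_abs (hp : Measurable (fun q : Ω × Ω => p q.1 q.2)) (h0 : ∀ x y, 0 ≤ p x y) (h1 : ∀ x y, p x y ≤ 1)
    (q : Ω × Ω) : |DD μ p q| ≤ 1 := by
  unfold DD
  have m1 : ∀ y, Measurable (fun x => p x y) := fun y => hp.comp (measurable_id.prodMk measurable_const)
  have a0 : 0 ≤ ∫ a, p a q.1 * p a q.2 ∂μ := integral_nonneg (fun a => mul_nonneg (h0 _ _) (h0 _ _))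
  have a1 : ∫ a, p a q.1 * p a q.2 ∂μ ≤ ∫ _a, (1:ℝ) ∂μ := by
    apply integral_mono_of_nonneg (Filter.Eventually.of_forall (fun a => mul_nonneg (h0 _ _) (h0 _ _))) (integrable_const _)
    exact Filter.Eventually.of_forall (fun a => mul_le_one₀ (h1 _ _) (h0 _ _) (h1 _ _))
  simp at a1
  rw [abs_le]; constructor <;> linarith

theorem ee_le_one (hp : Measurable (fun q : Ω × Ω => p q.1 q.2)) (h0 : ∀ x y, 0 ≤ p x y) (h1 : ∀ x y, p x y ≤ 1)
    : ee μ p ≤ 1 := by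
  unfold ee
  have : ∫ q, DD μ p q ^ 2 ∂(μ.prod μ) ≤ ∫ _q, (1:ℝ) ∂(μ.prod μ) := by
    apply integral_mono_of_nonneg (Filter.Eventually.of_forall (fun a => sq_nonneg _)) (integrable_const _)
    refine Filter.Eventually.of_forall (fun q => ?_)
    have := pow_le_pow_left₀ (abs_nonneg _) (DD_abs μ p hp h0 h1 q) 2
    simpa using this
  simpa using this

theorem sq_op (hp : Measurable (fun q : Ω × Ω => p q.1 q.2)) (h0 : ∀ x y, 0 ≤ p x y) (h1 : ∀ x y, p x y ≤ 1)
    (ψ : Ω → ℝ) (hψ : Measurable ψ) (C : ℝ) (hC : ∀ x, |ψ x| ≤ C) :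
    ∫ a, (∫ b, p a b * ψ b ∂μ) ^ 2 ∂μ = ∫ q, (ψ q.1 * ψ q.2) * DD μ p q ∂(μ.prod μ) + (∫ b, ψ b ∂μ)^2 / 4 := by
  have pab : ∀ x y, |p x y| ≤ 1 := fun x y => by rw [abs_of_nonneg (h0 x y)]; exact h1 x y
  have hC0 : ∀ x : Ω, 0 ≤ C := fun x => (abs_nonneg _).trans (hC x)
  have e1 : ∀ a, (∫ b, p a b * ψ b ∂μ) ^ 2 = ∫ q, (p a q.1 * ψ q.1) * (p a q.2 * ψ q.2) ∂(μ.prod μ) := by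
    intro a
    rw [integral_prod_mul (fun b => p a b * ψ b) (fun b => p a b * ψ b), sq]
  simp only [e1]
  have mpp : Measurable (fun r : Ω × Ω × Ω => (p r.1 r.2.1 * ψ r.2.1) * (p r.1 r.2.2 * ψ r.2.2)) :=
    ((hp.comp (measurable_fst.prodMk (measurable_fst.comp measurable_snd))).mul (by fun_prop)).mul
      ((hp.comp (measurable_fst.prodMk (measurable_snd.comp measurable_snd))).mul (by fun_prop))
  have ippp : Integrable (fun r : Ω × Ω × Ω => (p r.1 r.2.1 * ψ r.2.1) * (p r.1 r.2.2 * ψ r.2.2)) (μ.prod (μ.prod μ)) := by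
    refine integrable_of_bdd (C := (1 * C) * (1 * C)) mpp (fun r => ?_)
    simp only [abs_mul]
    have := hC0 r.1
    exact mul_le_mul (mul_le_mul (pab _ _) (hC _) (abs_nonneg _) (by norm_num))
      (mul_le_mul (pab _ _) (hC _) (abs_nonneg _) (by norm_num)) (by positivity) (by positivity)
  rw [integral_integral_swap ippp]
  have e2 : ∀ q : Ω × Ω, ∫ a, (p a q.1 * ψ q.1) * (p a q.2 * ψ q.2) ∂μ = (ψ q.1 * ψ q.2) * DD μ p q + (ψ q.1 * ψ q.2) * (1/4) := by
    intro q
    have : ∀ a, (p a q.1 * ψ q.1) * (p a q.2 * ψ q.2) = (ψ q.1 * ψ q.2) * (p a q.1 * p a q.2) := fun a => by ring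
    simp only [this]
    rw [integral_const_mul]; unfold DD; ring
  simp only [e2]
  have mD := measurable_DD μ p hp
  rw [integral_add, integral_mul_const, integral_prod_mul]
  · ring
  · refine integrable_of_bdd (C := (C * C) * 1) (by fun_prop) (fun q => ?_)
    rw [abs_mul, abs_mul]
    have := hC0 q.1
    exact mul_le_mul (mul_le_mul (hC _) (hC _) (abs_nonneg _) (by positivity)) (DD_abs μ p hp h0 h1 q) (abs_nonneg _) (by positivity)
  · refine Integrable.mul_const (integrable_of_bdd (C := C * C) (by fun_prop) (fun q => ?_)) _
    rw [abs_mul]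
    exact mul_le_mul (hC _) (hC _) (abs_nonneg _) (hC0 q.1)

theorem absA (hp : Measurable (fun q : Ω × Ω => p q.1 q.2)) (h0 : ∀ x y, 0 ≤ p x y) (h1 : ∀ x y, p x y ≤ 1)
    (hs : ∀ᵐ q ∂(μ.prod μ), p q.1 q.2 + p q.2 q.1 = 1)
    (φ ψ : Ω → ℝ) (hφ : Measurable φ) (hψ : Measurable ψ) (C : ℝ) (hCφ : ∀ x, |φ x| ≤ C) (hC : ∀ x, |ψ x| ≤ C) :
    (∫ q, φ q.1 * ψ q.2 * (2 * p q.1 q.2 - 1) ∂(μ.prod μ)) ^ 2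
      ≤ 8 * (∫ x, φ x ^ 2 ∂μ) * (∫ x, ψ x ^ 2 ∂μ) * √(√(ee μ p)) := by
  have pab : ∀ x y, |p x y| ≤ 1 := fun x y => by rw [abs_of_nonneg (h0 x y)]; exact h1 x y
  have hC0 : ∀ x : Ω, 0 ≤ C := fun x => (abs_nonneg _).trans (hC x)
  have mD := measurable_DD μ p hp
  have bD := DD_abs μ p hp h0 h1
  have m1 : ∀ y, Measurable (fun x => p x y) := fun y => hp.comp (measurable_id.prodMk measurable_const)
  have m2 : ∀ x, Measurable (fun y => p x y) := fun x => hp.comp (measurable_const.prodMk measurable_id)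
  set e := ee μ p with he
  have he0 : 0 ≤ e := integral_nonneg (fun q => sq_nonneg _)
  have he1 : e ≤ 1 := ee_le_one μ p hp h0 h1
  set η := √(√e) with hη
  have hη0 : 0 ≤ η := Real.sqrt_nonneg _
  have hη2 : η ^ 2 = √e := Real.sq_sqrt (Real.sqrt_nonneg _)
  have hη1 : η ≤ 1 := Real.sqrt_le_one.2 (Real.sqrt_le_one.2 he1)
  have hse : √e ≤ η := by rw [← hη2]; nlinarith
  have hs2 : √e ^ 2 = e := Real.sq_sqrt he0
  -- bounds with D
  have ipp : Integrable (fun q : Ω × Ω => p q.1 q.2) (μ.prod μ) := integrable_of_bdd hp (fun q => pab _ _)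
  have ipp' : Integrable (fun q : Ω × Ω => p q.2 q.1) (μ.prod μ) :=
    integrable_of_bdd (hp.comp measurable_swap) (fun q => pab _ _)
  have Ep : ∫ q, p q.1 q.2 ∂(μ.prod μ) = 1/2 := by
    have a1 : ∫ q, (p q.1 q.2 + p q.2 q.1) ∂(μ.prod μ) = ∫ _q, (1:ℝ) ∂(μ.prod μ) := integral_congr_ae hs
    rw [integral_add ipp ipp'] at a1
    have a2 : ∫ q, p q.2 q.1 ∂(μ.prod μ) = ∫ q, p q.1 q.2 ∂(μ.prod μ) :=
      integral_prod_swap (μ := μ) (ν := μ) (fun q : Ω × Ω => p q.1 q.2)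
    simp at a1
    linarith
  set r : Ω → ℝ := fun a => ∫ b, p a b ∂μ with hr
  have mr : Measurable r := hp.stronglyMeasurable.integral_prod_right.measurable
  have rb : ∀ (f : Ω → ℝ), Measurable f → (∀ x, 0 ≤ f x) → (∀ x, f x ≤ 1) → |∫ x, f x ∂μ| ≤ 1 := by
    intro f hf f0 f1
    rw [abs_of_nonneg (integral_nonneg f0)]
    have : ∫ x, f x ∂μ ≤ ∫ _x, (1:ℝ) ∂μ := integral_mono_of_nonneg (Filter.Eventually.of_forall f0) (integrable_const _)
      (Filter.Eventually.of_forall f1)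
    simpa using this
  have br : ∀ a, |r a| ≤ 1 := fun a => rb _ (m2 a) (h0 a) (h1 a)
  have Er : ∫ a, r a ∂μ = 1/2 := by rw [← Ep, integral_prod _ ipp]
  have Er2 : ∫ a, r a ^ 2 ∂μ = ∫ q, DD μ p q ∂(μ.prod μ) + 1/4 := by
    have := sq_op μ p hp h0 h1 (fun _ => 1) measurable_const 1 (fun _ => by simp)
    simpa using this
  have ED : ∫ q, DD μ p q ∂(μ.prod μ) ≤ √e := by
    have := cs_bdd (μ := μ.prod μ) (f := fun _ => (1:ℝ)) (g := DD μ p) measurable_const mD (C := 1) (C' := 1) (fun _ => by simp) bD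
    simp only [one_mul, one_pow, integral_const, probReal_univ, smul_eq_mul, mul_one] at this
    exact Real.le_sqrt_of_sq_le this
  set v : Ω → ℝ := fun b => 1/2 - r b with hv
  have mv : Measurable v := by fun_prop
  have bv : ∀ b, |v b| ≤ 2 := by
    intro b
    have := abs_le.1 (br b)
    rw [abs_le]; constructor <;> simp only [hv] <;> linarith
  have ir2 : Integrable (fun a => r a ^ 2) μ := integrable_of_bdd (C := 1) (by fun_prop) (fun a => by
    rw [abs_pow]; exact pow_le_one₀ (abs_nonneg _) (br a))
  have ir : Integrable r μ := integrable_of_bdd mr br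
  have Ev2 : ∫ b, v b ^ 2 ∂μ ≤ √e := by
    have h : ∀ b, v b ^ 2 = (r b ^ 2 - r b) + 1/4 := fun b => by simp only [hv]; ring
    simp only [h]
    have i1 : Integrable (fun b => r b ^ 2 - r b) μ := ir2.sub ir
    rw [integral_add i1 (integrable_const _), integral_sub ir2 ir, Er, Er2]
    simp
    linarith
  -- column averages
  have hu : ∀ᵐ b ∂μ, ∫ a, p a b ∂μ = 1/2 + v b := by
    filter_upwards [Measure.ae_ae_of_ae_prod hs] with b hb
    have : ∫ a, p a b ∂μ = ∫ a, (1 - p b a) ∂μ := by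
      apply integral_congr_ae
      filter_upwards [hb] with a ha
      have ha : p b a + p a b = 1 := ha
      linarith
    rw [this, integral_sub (integrable_const _) (integrable_of_bdd (m2 b) (pab b))]
    simp only [hv, hr, integral_const, probReal_univ, smul_eq_mul]; ring
  set P2 := ∫ x, ψ x ^ 2 ∂μ with hP2
  have hP20 : 0 ≤ P2 := integral_nonneg (fun _ => sq_nonneg _)
  have sP : √P2 ^ 2 = P2 := Real.sq_sqrt hP20
  have Eψ : |∫ x, ψ x ∂μ| ≤ √P2 := by
    apply Real.abs_le_sqrt
    have := cs_bdd (μ := μ) (f := fun _ => (1:ℝ)) (g := ψ) measurable_const hψ (C := 1) (fun _ => by simp) hC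
    simpa using this
  have Eψv : |∫ x, ψ x * v x ∂μ| ≤ √P2 * η := by
    apply abs_le_of_sq_le_sq _ (by positivity)
    have := cs_bdd (μ := μ) hψ mv hC bv
    calc _ ≤ P2 * ∫ x, v x ^ 2 ∂μ := this
      _ ≤ P2 * √e := mul_le_mul_of_nonneg_left Ev2 hP20
      _ = _ := by rw [mul_pow, sP, hη2]
  have EψψD : ∫ q, (ψ q.1 * ψ q.2) * DD μ p q ∂(μ.prod μ) ≤ P2 * √e := by
    apply le_of_sq_le_sq _ (by positivity)
    have := cs_bdd (μ := μ.prod μ) (f := fun q : Ω × Ω => ψ q.1 * ψ q.2) (g := DD μ p) (by fun_prop) mD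
      (C := C * C) (fun q => by
        rw [abs_mul]; exact mul_le_mul (hC _) (hC _) (abs_nonneg _) (hC0 q.1)) bD
    simp only [mul_pow] at this
    rw [integral_prod_mul (fun x => ψ x ^ 2) (fun x => ψ x ^ 2)] at this
    rw [mul_pow, hs2, sq P2]
    exact this
  -- the operator
  set G : Ω → ℝ := fun a => ∫ b, p a b * ψ b ∂μ with hG
  have mpψ : Measurable (fun q : Ω × Ω => p q.1 q.2 * ψ q.2) := hp.mul (hψ.comp measurable_snd)
  have mG : Measurable G := mpψ.stronglyMeasurable.integral_prod_right.measurable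
  have bpψ : ∀ a b, |p a b * ψ b| ≤ C := by
    intro a b; rw [abs_mul]
    calc _ ≤ 1 * C := mul_le_mul (pab _ _) (hC _) (abs_nonneg _) (by norm_num)
      _ = C := one_mul C
  have bG : ∀ a, |G a| ≤ C := by
    intro a
    refine (abs_integral_le_integral_abs).trans ?_
    have : ∫ b, |p a b * ψ b| ∂μ ≤ ∫ _b, C ∂μ :=
      integral_mono_of_nonneg (Filter.Eventually.of_forall (fun _ => abs_nonneg _)) (integrable_const _)
        (Filter.Eventually.of_forall (fun b => bpψ a b))
    simpa using this
  have ipψ : Integrable (fun q : Ω × Ω => p q.1 q.2 * ψ q.2) (μ.prod μ) := integrable_of_bdd mpψ (fun q => bpψ _ _)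
  have EG : ∫ a, G a ∂μ = (∫ b, ψ b ∂μ) / 2 + ∫ b, ψ b * v b ∂μ := by
    have iψ : Integrable ψ μ := integrable_of_bdd hψ hC
    have iψv : Integrable (fun b => ψ b * v b) μ := integrable_of_bdd (C := C * 2) (by fun_prop) (fun b => by
      rw [abs_mul]; exact mul_le_mul (hC b) (bv b) (abs_nonneg _) (hC0 b))
    calc ∫ a, G a ∂μ = ∫ b, ∫ a, p a b * ψ b ∂μ ∂μ := integral_integral_swap ipψ
      _ = ∫ b, (ψ b * (1/2) + ψ b * v b) ∂μ := by
          apply integral_congr_ae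
          filter_upwards [hu] with b hb
          rw [integral_mul_const, hb]; ring
      _ = _ := by rw [integral_add (iψ.mul_const _) iψv, integral_mul_const]; ring
  have EG2 : ∫ a, G a ^ 2 ∂μ = ∫ q, (ψ q.1 * ψ q.2) * DD μ p q ∂(μ.prod μ) + (∫ b, ψ b ∂μ)^2 / 4 :=
    sq_op μ p hp h0 h1 ψ hψ C hC
  set c := ∫ b, ψ b ∂μ with hc
  have iG2 : Integrable (fun a => G a ^ 2) μ := integrable_of_bdd (C := C^2) (by fun_prop) (fun a => by
    rw [abs_pow]; exact pow_le_pow_left₀ (abs_nonneg _) (bG a) 2)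
  have iG : Integrable G μ := integrable_of_bdd mG bG
  have EH : ∫ a, (2 * G a - c) ^ 2 ∂μ ≤ 8 * P2 * η := by
    have h : ∀ a, (2 * G a - c) ^ 2 = (4 * G a ^ 2 - 4 * c * G a) + c ^ 2 := fun a => by ring
    simp only [h]
    have i1 : Integrable (fun a => 4 * G a ^ 2 - 4 * c * G a) μ := (iG2.const_mul _).sub (iG.const_mul _)
    rw [integral_add i1 (integrable_const _), integral_sub (iG2.const_mul _) (iG.const_mul _), integral_const_mul,
      integral_const_mul, EG, EG2]
    simp only [integral_const, probReal_univ, smul_eq_mul, one_mul]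
    have hcv : |c * ∫ b, ψ b * v b ∂μ| ≤ √P2 * (√P2 * η) := by
      rw [abs_mul]; exact mul_le_mul Eψ Eψv (abs_nonneg _) (Real.sqrt_nonneg _)
    have hcv' : √P2 * (√P2 * η) = P2 * η := by rw [← mul_assoc, ← sq, sP]
    rw [hcv'] at hcv
    have := (abs_le.1 hcv).1
    have h3 : P2 * √e ≤ P2 * η := mul_le_mul_of_nonneg_left hse hP20
    nlinarith
  have bH : ∀ a, |2 * G a - c| ≤ 2 * C + |c| := by
    intro a
    refine (abs_sub _ _).trans ?_
    rw [abs_mul, abs_two]; linarith [bG a]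
  have fin : ∫ q, φ q.1 * ψ q.2 * (2 * p q.1 q.2 - 1) ∂(μ.prod μ) = ∫ a, φ a * (2 * G a - c) ∂μ := by
    rw [integral_prod]
    · congr 1
      funext a
      have : ∀ b, φ a * ψ b * (2 * p a b - 1) = φ a * (2 * (p a b * ψ b) - ψ b) := fun b => by ring
      simp only [this]
      rw [integral_const_mul, integral_sub, integral_const_mul]
      · exact (integrable_of_bdd ((m2 a).mul hψ) (bpψ a)).const_mul _
      · exact integrable_of_bdd hψ hC
    · refine integrable_of_bdd (C := C * C * 3) (by fun_prop) (fun q => ?_)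
      rw [abs_mul, abs_mul]
      have := hC0 q.1
      refine mul_le_mul (mul_le_mul (hCφ _) (hC _) (abs_nonneg _) this) ?_ (abs_nonneg _) (by positivity)
      rw [abs_le]; constructor <;> linarith [h0 q.1 q.2, h1 q.1 q.2]
  rw [fin]
  have hF0 : 0 ≤ ∫ x, φ x ^ 2 ∂μ := integral_nonneg (fun _ => sq_nonneg _)
  calc _ ≤ (∫ x, φ x ^ 2 ∂μ) * ∫ a, (2 * G a - c) ^ 2 ∂μ := cs_bdd hφ (by fun_prop) hCφ bH
    _ ≤ (∫ x, φ x ^ 2 ∂μ) * (8 * P2 * η) := mul_le_mul_of_nonneg_left EH hF0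
    _ = _ := by ring

end Abs


noncomputable def sw (x : ℝ) : ℝ := 1 - 2 * Int.fract x
noncomputable def ck (k : ℕ) : ℝ := 2 / (Real.pi * (k + 1))
noncomputable def wk (k : ℕ) : ℝ := 2 * Real.pi * (k + 1)
noncomputable def rho (M : ℕ) (x : ℝ) : ℝ := sw x - ∑ k ∈ Finset.range M, ck k * Real.sin (wk k * x)

theorem measurable_sw : Measurable sw := by unfold sw; fun_prop

theorem measurable_rho (M : ℕ) : Measurable (rho M) := by
  have := measurable_sw
  unfold rho; fun_prop

theorem sw_abs (x : ℝ) : |sw x| ≤ 1 := by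
  unfold sw
  have := Int.fract_nonneg x
  have := Int.fract_lt_one x
  rw [abs_le]; constructor <;> linarith

theorem ck_nonneg (k : ℕ) : 0 ≤ ck k := by unfold ck; positivity

theorem ck_le (k : ℕ) : ck k ≤ 1 := by
  unfold ck
  rw [div_le_one (by positivity)]
  have := Real.pi_gt_three
  have : (0:ℝ) ≤ k := by positivity
  nlinarith

theorem rho_abs (M : ℕ) (x : ℝ) : |rho M x| ≤ 1 + M := by
  unfold rho
  refine (abs_sub _ _).trans (add_le_add (sw_abs x) ?_)
  refine (Finset.abs_sum_le_sum_abs _ _).trans ?_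
  calc ∑ k ∈ Finset.range M, |ck k * Real.sin (wk k * x)| ≤ ∑ k ∈ Finset.range M, (1:ℝ) := by
        refine Finset.sum_le_sum fun k _ => ?_
        rw [abs_mul, abs_of_nonneg (ck_nonneg k)]
        have := ck_le k
        have := ck_nonneg k
        have := Real.abs_sin_le_one (wk k * x)
        have := abs_nonneg (Real.sin (wk k * x))
        nlinarith
    _ = M := by simp

theorem sw_periodic : Function.Periodic sw 1 := by
  intro x; simp [sw]

theorem sin_wk_periodic (k : ℕ) : Function.Periodic (fun x => Real.sin (wk k * x)) 1 := by
  intro x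
  have : wk k * (x + 1) = wk k * x + ((k + 1 : ℕ) : ℝ) * (2 * Real.pi) := by
    unfold wk; push_cast; ring
  simp only [this]
  exact Real.sin_add_nat_mul_two_pi _ _

theorem cos_wk_periodic (k : ℕ) : Function.Periodic (fun x => Real.cos (wk k * x)) 1 := by
  intro x
  have : wk k * (x + 1) = wk k * x + ((k + 1 : ℕ) : ℝ) * (2 * Real.pi) := by
    unfold wk; push_cast; ring
  simp only [this]
  exact Real.cos_add_nat_mul_two_pi _ _

theorem rho_periodic (M : ℕ) : Function.Periodic (rho M) 1 := by
  intro x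
  unfold rho
  rw [sw_periodic x]
  congr 1
  exact Finset.sum_congr rfl fun k _ => by rw [show Real.sin (wk k * (x+1)) = Real.sin (wk k * x) from sin_wk_periodic k x]

theorem int_shift_r {g : ℝ → ℝ} (hg : Function.Periodic g 1) (b : ℝ) :
    ∫ x, g (x - b) ∂U01 = ∫ x, g x ∂U01 := by
  rw [integral_U01, integral_U01, intervalIntegral.integral_comp_sub_right (fun x => g x) b]
  have := hg.intervalIntegral_add_eq (0 - b) 0
  rw [zero_add] at this
  rw [← this]; congr 1; ring

theorem int_shift_l {g : ℝ → ℝ} (hg : Function.Periodic g 1) (b : ℝ) :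
    ∫ x, g (b - x) ∂U01 = ∫ x, g x ∂U01 := by
  rw [integral_U01, integral_U01, intervalIntegral.integral_comp_sub_left (fun x => g x) b]
  have := hg.intervalIntegral_add_eq (b - 1) 0
  rw [zero_add] at this
  rw [← this]; congr 1; ring

theorem int_cos_z (z : ℤ) (hz : z ≠ 0) : ∫ x in (0:ℝ)..1, Real.cos (2 * Real.pi * z * x) = 0 := by
  have h : (2 * Real.pi * z : ℝ) ≠ 0 := by
    have : (z:ℝ) ≠ 0 := by exact_mod_cast hz
    have := Real.pi_pos
    positivity
  rw [intervalIntegral.integral_comp_mul_left (fun x => Real.cos x) h, integral_cos]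
  have : (2 * Real.pi * z * 1 : ℝ) = z * (2 * Real.pi) - 0 := by ring
  rw [this, Real.sin_int_mul_two_pi_sub]; simp

theorem int_sin_z (z : ℤ) (hz : z ≠ 0) : ∫ x in (0:ℝ)..1, Real.sin (2 * Real.pi * z * x) = 0 := by
  have h : (2 * Real.pi * z : ℝ) ≠ 0 := by
    have : (z:ℝ) ≠ 0 := by exact_mod_cast hz
    have := Real.pi_pos
    positivity
  rw [intervalIntegral.integral_comp_mul_left (fun x => Real.sin x) h, integral_sin]
  have : (2 * Real.pi * z * 1 : ℝ) = z * (2 * Real.pi) := by ring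
  rw [this, Real.cos_int_mul_two_pi]; simp

theorem wk_cast (k : ℕ) : wk k = 2 * Real.pi * (((k : ℤ) + 1 : ℤ) : ℝ) := by unfold wk; push_cast; ring

theorem int_cos_wk (k : ℕ) : ∫ x in (0:ℝ)..1, Real.cos (wk k * x) = 0 := by
  rw [wk_cast]; exact int_cos_z _ (by omega)
theorem int_sin_wk (k : ℕ) : ∫ x in (0:ℝ)..1, Real.sin (wk k * x) = 0 := by
  rw [wk_cast]; exact int_sin_z _ (by omega)

theorem int_sin_sin (k l : ℕ) : ∫ x in (0:ℝ)..1, Real.sin (wk k * x) * Real.sin (wk l * x) = if k = l then 1/2 else 0 := by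
  have h : ∀ x : ℝ, Real.sin (wk k * x) * Real.sin (wk l * x) =
      (1/2) * Real.cos (2 * Real.pi * ((k - l : ℤ):ℝ) * x) - (1/2) * Real.cos (2 * Real.pi * ((k + l + 2 : ℤ):ℝ) * x) := by
    intro x
    have e1 : 2 * Real.pi * ((k - l : ℤ):ℝ) * x = wk k * x - wk l * x := by unfold wk; push_cast; ring
    have e2 : 2 * Real.pi * ((k + l + 2 : ℤ):ℝ) * x = wk k * x + wk l * x := by unfold wk; push_cast; ring
    rw [e1, e2, Real.cos_sub, Real.cos_add]; ring
  simp only [h]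
  rw [intervalIntegral.integral_sub, intervalIntegral.integral_const_mul, intervalIntegral.integral_const_mul,
    int_cos_z (k + l + 2) (by omega)]
  · split_ifs with hkl
    · subst hkl; simp
    · rw [int_cos_z _ (by omega)]; simp
  · apply Continuous.intervalIntegrable; fun_prop
  · apply Continuous.intervalIntegrable; fun_prop

theorem int_lin_sin (k : ℕ) : ∫ x in (0:ℝ)..1, (1 - 2 * x) * Real.sin (wk k * x) = ck k / 2 := by
  have hw : wk k ≠ 0 := by unfold wk; positivity
  have hd : ∀ x ∈ uIcc (0:ℝ) 1, HasDerivAt (fun x => -(1 - 2 * x) * Real.cos (wk k * x) / wk k - 2 * Real.sin (wk k * x) / wk k ^ 2)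
      ((1 - 2 * x) * Real.sin (wk k * x)) x := by
    intro x _
    have h1 : HasDerivAt (fun x : ℝ => wk k * x) (wk k) x := by simpa using (hasDerivAt_id x).const_mul (wk k)
    have h2 : HasDerivAt (fun x : ℝ => -(1 - 2 * x)) 2 x := by
      have := ((hasDerivAt_id x).const_mul 2).sub_const 1
      refine (this.congr_deriv (by simp)).congr_of_eventuallyEq (Filter.Eventually.of_forall fun y => ?_)
      simp
    have := (((h2.mul h1.cos).div_const (wk k))).sub ((h1.sin.const_mul 2).div_const (wk k ^ 2))
    refine this.congr_deriv ?_
    field_simp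
    ring
  rw [intervalIntegral.integral_eq_sub_of_hasDerivAt hd (by apply Continuous.intervalIntegrable; fun_prop)]
  have c1 : Real.cos (wk k * 1) = 1 := by
    have := cos_wk_periodic k 0; simpa using this
  have s1 : Real.sin (wk k * 1) = 0 := by
    have := sin_wk_periodic k 0; simpa using this
  rw [c1, s1]; simp
  unfold ck wk
  field_simp; ring

theorem integrable_mul_of (f g : ℝ → ℝ) (hf : Measurable f) (hg : Measurable g) {C D : ℝ}
    (h1 : ∀ x, |f x| ≤ C) (h2 : ∀ x, |g x| ≤ D) : Integrable (fun x => f x * g x) U01 :=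
  integrable_of_bdd (hf.mul hg) (C := C * D) (fun x => by
    rw [abs_mul]; exact mul_le_mul (h1 x) (h2 x) (abs_nonneg _) ((abs_nonneg _).trans (h1 x)))

theorem int_sw (g : ℝ → ℝ) : ∫ x, sw x * g x ∂U01 = ∫ x in (0:ℝ)..1, (1 - 2 * x) * g x := by
  rw [integral_U01, intervalIntegral.integral_of_le zero_le_one, intervalIntegral.integral_of_le zero_le_one,
    integral_Ioc_eq_integral_Ioo, integral_Ioc_eq_integral_Ioo]
  refine setIntegral_congr_fun measurableSet_Ioo fun x hx => ?_
  simp only [sw, Int.fract_eq_self.2 ⟨hx.1.le, hx.2⟩]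

theorem sin_meas (k : ℕ) : Measurable (fun x => Real.sin (wk k * x)) := by fun_prop

theorem int_rho (M : ℕ) : ∫ x, rho M x ∂U01 = 0 := by
  unfold rho
  rw [integral_sub, integral_finsetSum]
  · have : ∫ x, sw x ∂U01 = 0 := by
      have := int_sw (fun _ => 1)
      simp only [mul_one] at this
      rw [this, intervalIntegral.integral_sub (by simp) (by apply Continuous.intervalIntegrable; fun_prop), intervalIntegral.integral_const_mul]
      simp
    rw [this]
    simp only [integral_const_mul, integral_U01, int_sin_wk]; simp
  · intro k _
    exact (integrable_of_bdd (sin_meas k) (fun x => Real.abs_sin_le_one _)).const_mul _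
  · exact integrable_of_bdd measurable_sw sw_abs
  · refine integrable_finsetSum _ fun k _ => ?_
    exact (integrable_of_bdd (sin_meas k) (fun x => Real.abs_sin_le_one _)).const_mul _

theorem int_sw_sin (k : ℕ) : ∫ x, sw x * Real.sin (wk k * x) ∂U01 = ck k / 2 := by
  rw [int_sw (fun x => Real.sin (wk k * x)), int_lin_sin]

theorem int_rho_sin (M k : ℕ) : ∫ x, rho M x * Real.sin (wk k * x) ∂U01 = ck k / 2 - if k < M then ck k / 2 else 0 := by
  have h : ∀ x, rho M x * Real.sin (wk k * x) = sw x * Real.sin (wk k * x) -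
      ∑ l ∈ Finset.range M, ck l * (Real.sin (wk l * x) * Real.sin (wk k * x)) := by
    intro x; unfold rho; rw [sub_mul, Finset.sum_mul]
    simp only [mul_assoc]
  have hi : ∀ l ∈ Finset.range M, Integrable (fun x => ck l * (Real.sin (wk l * x) * Real.sin (wk k * x))) U01 := fun l _ =>
    (integrable_mul_of _ _ (sin_meas l) (sin_meas k) (fun x => Real.abs_sin_le_one _) (fun x => Real.abs_sin_le_one _)).const_mul _
  simp only [h]
  rw [integral_sub (integrable_mul_of _ _ measurable_sw (sin_meas k) sw_abs (fun x => Real.abs_sin_le_one _)) (integrable_finsetSum _ hi),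
    integral_finsetSum _ hi, int_sw_sin]
  simp only [integral_const_mul, integral_U01, int_sin_sin]
  congr 1
  simp only [mul_ite, mul_zero, Finset.sum_ite_eq', Finset.mem_range]
  split_ifs <;> ring

theorem int_rho_sq (M : ℕ) : ∫ x, rho M x ^ 2 ∂U01 = 1/3 - ∑ k ∈ Finset.range M, ck k ^ 2 / 2 := by
  induction M with
  | zero =>
    have : ∫ x, rho 0 x ^ 2 ∂U01 = ∫ x, sw x * sw x ∂U01 := by
      congr 1; funext x; simp [rho, sq]
    rw [this, int_sw]
    have h2 : ∫ x in (0:ℝ)..1, (1 - 2 * x) * sw x = ∫ x, sw x * (1 - 2 * x) ∂U01 := by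
      rw [integral_U01]; congr 1; funext x; ring
    rw [h2, int_sw (fun x => 1 - 2 * x)]
    have hd : ∀ x ∈ uIcc (0:ℝ) 1, HasDerivAt (fun x : ℝ => x - 2 * x^2 + 4/3 * x^3) ((1 - 2 * x) * (1 - 2 * x)) x := by
      intro x _
      have := ((hasDerivAt_id x).sub ((hasDerivAt_pow 2 x).const_mul 2)).add ((hasDerivAt_pow 3 x).const_mul (4/3))
      refine this.congr_deriv ?_
      simp; ring
    rw [intervalIntegral.integral_eq_sub_of_hasDerivAt hd (by apply Continuous.intervalIntegrable; fun_prop)]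
    norm_num
  | succ M ih =>
    have hr : ∀ x, rho (M+1) x ^ 2 = rho M x ^ 2 + (-(2 * ck M)) * (rho M x * Real.sin (wk M * x))
        + ck M ^ 2 * (Real.sin (wk M * x) * Real.sin (wk M * x)) := by
      intro x
      have : rho (M+1) x = rho M x - ck M * Real.sin (wk M * x) := by
        unfold rho; rw [Finset.sum_range_succ]; ring
      rw [this]; ring
    have i1 : Integrable (fun x => rho M x ^ 2) U01 := by
      simpa only [sq] using integrable_mul_of _ _ (measurable_rho M) (measurable_rho M) (rho_abs M) (rho_abs M)
    have i2 : Integrable (fun x => (-(2 * ck M)) * (rho M x * Real.sin (wk M * x))) U01 :=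
      (integrable_mul_of _ _ (measurable_rho M) (sin_meas M) (rho_abs M) (fun x => Real.abs_sin_le_one _)).const_mul _
    have i3 : Integrable (fun x => ck M ^ 2 * (Real.sin (wk M * x) * Real.sin (wk M * x))) U01 :=
      (integrable_mul_of _ _ (sin_meas M) (sin_meas M) (fun x => Real.abs_sin_le_one _) (fun x => Real.abs_sin_le_one _)).const_mul _
    have i12 : Integrable (fun x => rho M x ^ 2 + (-(2 * ck M)) * (rho M x * Real.sin (wk M * x))) U01 := i1.add i2
    simp only [hr]
    rw [integral_add i12 i3, integral_add i1 i2, integral_const_mul, integral_const_mul, ih, int_rho_sin, Finset.sum_range_succ]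
    simp only [lt_irrefl, if_false, integral_U01, int_sin_sin, if_true]
    ring

theorem rho_small (δ : ℝ) (hδ : 0 < δ) : ∃ M, ∫ x, rho M x ^ 2 ∂U01 < δ := by
  have h := hasSum_zeta_two
  have h1 : HasSum (fun k : ℕ => ck k ^ 2 / 2) (1/3) := by
    have h2 := (hasSum_nat_add_iff' 1).2 h
    have h3 := h2.mul_left (2 / Real.pi^2)
    have hp := Real.pi_pos.ne'
    have e1 : (fun k : ℕ => ck k ^ 2 / 2) = (fun i : ℕ => 2 / Real.pi ^ 2 * (1 / ((i + 1 : ℕ) : ℝ) ^ 2)) := by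
      funext k; unfold ck; push_cast; field_simp
    have e2 : 2 / Real.pi ^ 2 * (Real.pi ^ 2 / 6 - ∑ i ∈ Finset.range 1, 1 / (i : ℝ) ^ 2) = 1/3 := by
      simp; field_simp; norm_num
    rw [e1, ← e2]
    exact h3
  have h4 := h1.tendsto_sum_nat
  have h5 := (h4.eventually (lt_mem_nhds (show (1/3:ℝ) - δ < 1/3 by linarith))).exists
  obtain ⟨M, hM⟩ := h5
  exact ⟨M, by rw [int_rho_sq]; linarith⟩


noncomputable def trigS (m k : ℕ) (a : Die m) : ℝ := ∑ i, Real.sin (wk k * a i)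
noncomputable def trigC (m k : ℕ) (a : Die m) : ℝ := ∑ i, Real.cos (wk k * a i)

theorem mu_var_one (m : ℕ) (hm : 1 ≤ m) {h : ℝ → ℝ} (hh : Measurable h) (hC : ∀ x, |h x| ≤ 1)
    (h0 : ∫ x, h x ∂U01 = 0) : ∫ a, (∑ i, h (a i)) ^ 2 ∂(muM m) ≤ 792 * m + 3 := by
  have := prob_muM m hm
  have key : ∀ x, h x ^ 2 ≤ 1 := fun x => by
    rw [sq_le_one_iff_abs_le_one]; exact hC x
  have b1 : ∫ x, h x ^ 2 ∂U01 ≤ 1 := by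
    have := integral_mono (μ := U01) (integrable_of_bdd (f := fun x => h x ^ 2) (by fun_prop) (C := 1) (fun x => by rw [abs_of_nonneg (sq_nonneg _)]; exact key x))
      (integrable_const 1) key
    simpa using this
  have b2 : ∫ a, h (a (Fin.last _)) ^ 2 ∂(muM m) ≤ 1 := by
    have := integral_mono (μ := muM m) (integrable_of_bdd (f := fun a => h (a (Fin.last _)) ^ 2) (by fun_prop) (C := 1) (fun x => by rw [abs_of_nonneg (sq_nonneg _)]; exact key _))
      (integrable_const 1) (fun a => key _)
    simpa using this
  refine (mu_var m hm hh hC h0).trans ?_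
  have : (0:ℝ) ≤ 792 * m := by positivity
  nlinarith

theorem trigS_sq (m k : ℕ) (hm : 1 ≤ m) : ∫ a, trigS m k a ^ 2 ∂(muM m) ≤ 792 * m + 3 :=
  mu_var_one m hm (h := fun x => Real.sin (wk k * x)) (by fun_prop) (fun x => Real.abs_sin_le_one _)
    (by rw [integral_U01]; exact int_sin_wk k)

theorem trigC_sq (m k : ℕ) (hm : 1 ≤ m) : ∫ a, trigC m k a ^ 2 ∂(muM m) ≤ 792 * m + 3 :=
  mu_var_one m hm (h := fun x => Real.cos (wk k * x)) (by fun_prop) (fun x => Real.abs_cos_le_one _)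
    (by rw [integral_U01]; exact int_cos_wk k)

noncomputable def RR (M m : ℕ) (a b : Die m) : ℝ := ∑ i, ∑ j, rho M (a i - b j)

theorem measurable_RR (M m : ℕ) : Measurable (fun q : Die m × Die m => RR M m q.1 q.2) := by
  have := measurable_rho M
  unfold RR; fun_prop

theorem rsum_abs (M m : ℕ) (x : ℝ) (b : Die m) : |∑ j, rho M (x - b j)| ≤ (m+m+1) * (1 + M) := by
  refine (Finset.abs_sum_le_sum_abs _ _).trans ?_
  refine (Finset.sum_le_sum (fun j _ => rho_abs M _)).trans (le_of_eq ?_)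
  rw [Finset.sum_const, Finset.card_univ, Fintype.card_fin, nsmul_eq_mul]; push_cast; ring

theorem RR_abs (M m : ℕ) (a b : Die m) : |RR M m a b| ≤ (m+m+1) * ((m+m+1) * (1 + M)) := by
  unfold RR
  refine (Finset.abs_sum_le_sum_abs _ _).trans ?_
  refine (Finset.sum_le_sum (fun j _ => rsum_abs M m _ b)).trans (le_of_eq ?_)
  rw [Finset.sum_const, Finset.card_univ, Fintype.card_fin, nsmul_eq_mul]; push_cast; ring

theorem rsum_var (M m : ℕ) (hm : 1 ≤ m) (x : ℝ) : ∫ b, (∑ j, rho M (x - b j)) ^ 2 ∂(muM m) ≤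
    792 * m * ∫ x, rho M x ^ 2 ∂U01 + 3 * (1 + M) ^ 2 := by
  have := prob_muM m hm
  have hr := measurable_rho M
  have h1 := mu_var m hm (h := fun y => rho M (x - y)) (by fun_prop) (fun y => rho_abs M _)
    (by rw [int_shift_l (rho_periodic M), int_rho])
  have hper : Function.Periodic (fun x => rho M x ^ 2) 1 := fun x => by simp only [rho_periodic M x]
  have e := int_shift_l hper x
  rw [e] at h1
  have key : ∀ y, rho M y ^ 2 ≤ (1 + M) ^ 2 := fun y => by
    rw [← sq_abs]; exact pow_le_pow_left₀ (abs_nonneg _) (rho_abs M y) 2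
  have b2 : ∫ a, rho M (x - a (Fin.last _)) ^ 2 ∂(muM m) ≤ (1 + M) ^ 2 := by
    have := integral_mono (μ := muM m) (integrable_of_bdd (f := fun a => rho M (x - a (Fin.last _)) ^ 2) (by fun_prop) (C := (1 + M) ^ 2)
      (fun x => by rw [abs_of_nonneg (sq_nonneg _)]; exact key _))
      (integrable_const ((1 + (M:ℝ)) ^ 2)) (fun a => key _)
    simpa using this
  linarith

theorem swap_bd {X Y : Type*} [MeasurableSpace X] [MeasurableSpace Y] (μ : Measure X) (ν : Measure Y)
    [IsProbabilityMeasure μ] [IsProbabilityMeasure ν] {G : X × Y → ℝ} (hG : Measurable G) {C V : ℝ}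
    (hC : ∀ q, |G q| ≤ C) (hV : ∀ x, ∫ y, G (x, y) ∂ν ≤ V) : ∫ y, ∫ x, G (x, y) ∂μ ∂ν ≤ V := by
  have hi : Integrable G (μ.prod ν) := integrable_of_bdd hG hC
  rw [← integral_prod_symm _ hi, integral_prod _ hi]
  have := integral_mono hi.integral_prod_left (integrable_const V) hV
  simpa using this

theorem ER_sq (M m : ℕ) (hm : 1 ≤ m) : ∫ q, RR M m q.1 q.2 ^ 2 ∂((muM m).prod (muM m)) ≤
    (792 * m + 3) * (792 * m * ∫ x, rho M x ^ 2 ∂U01 + 3 * (1 + M) ^ 2) := by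
  have := prob_muM m hm
  have hr := measurable_rho M
  have hRm := measurable_RR M m
  set V := 792 * m * ∫ x, rho M x ^ 2 ∂U01 + 3 * (1 + (M:ℝ)) ^ 2
  have sqb : ∀ {t c : ℝ}, |t| ≤ c → |t ^ 2| ≤ c ^ 2 := fun h => by
    rw [abs_pow]; exact pow_le_pow_left₀ (abs_nonneg _) h 2
  have hi : Integrable (fun q : Die m × Die m => RR M m q.1 q.2 ^ 2) ((muM m).prod (muM m)) :=
    integrable_of_bdd (by fun_prop) (fun q => sqb (RR_abs M m q.1 q.2))
  rw [integral_prod_symm _ hi]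
  -- the two error terms
  let G1 : ℝ × Die m → ℝ := fun q => (∑ j, rho M (q.1 - q.2 j)) ^ 2
  let G2 : Die m × Die m → ℝ := fun q => (∑ j, rho M (q.1 (Fin.last _) - q.2 j)) ^ 2
  have mG1 : Measurable G1 := by fun_prop
  have mG2 : Measurable G2 := by fun_prop
  have bG1 : ∀ q, |G1 q| ≤ _ := fun q => sqb (rsum_abs M m q.1 q.2)
  have bG2 : ∀ q, |G2 q| ≤ _ := fun q => sqb (rsum_abs M m (q.1 (Fin.last _)) q.2)
  have e1 : ∫ b, ∫ x, G1 (x, b) ∂U01 ∂(muM m) ≤ V := swap_bd U01 (muM m) mG1 bG1 (fun x => rsum_var M m hm x)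
  have e2 : ∫ b, ∫ a, G2 (a, b) ∂(muM m) ∂(muM m) ≤ V := swap_bd (muM m) (muM m) mG2 bG2 (fun a => rsum_var M m hm _)
  have i1 : Integrable (fun b => ∫ x, G1 (x, b) ∂U01) (muM m) :=
    (integrable_of_bdd (μ := U01.prod (muM m)) mG1 bG1).integral_prod_right
  have i2 : Integrable (fun b => ∫ a, G2 (a, b) ∂(muM m)) (muM m) :=
    (integrable_of_bdd (μ := (muM m).prod (muM m)) mG2 bG2).integral_prod_right
  have hpt : ∀ b, ∫ a, RR M m a b ^ 2 ∂(muM m) ≤ 792 * m * (∫ x, G1 (x, b) ∂U01) + 3 * ∫ a, G2 (a, b) ∂(muM m) := by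
    intro b
    refine mu_var m hm (h := fun x => ∑ j, rho M (x - b j)) (by fun_prop) (fun x => rsum_abs M m x b) ?_
    rw [integral_finsetSum _ (fun j _ => integrable_of_bdd (by fun_prop) (fun x => rho_abs M _))]
    refine Finset.sum_eq_zero fun j _ => ?_
    rw [int_shift_r (rho_periodic M), int_rho]
  calc _ ≤ ∫ b, (792 * m * (∫ x, G1 (x, b) ∂U01) + 3 * ∫ a, G2 (a, b) ∂(muM m)) ∂(muM m) :=
        integral_mono hi.integral_prod_right ((i1.const_mul _).add (i2.const_mul _)) hpt
    _ = 792 * m * (∫ b, ∫ x, G1 (x, b) ∂U01 ∂(muM m)) + 3 * ∫ b, ∫ a, G2 (a, b) ∂(muM m) ∂(muM m) := by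
        rw [integral_add (i1.const_mul _) (i2.const_mul _), integral_const_mul, integral_const_mul]
    _ ≤ _ := by
        have : (0:ℝ) ≤ 792 * m := by positivity
        nlinarith


theorem kk_sw {a b : ℝ} (ha : a ∈ Icc (0:ℝ) 1) (hb : b ∈ Icc (0:ℝ) 1) (h : ∀ z : ℤ, b ≠ a + z) :
    kk a b = sw (a - b) + 2 * (a - b) := by
  have h0 := h 0
  have h1 := h 1
  have h2 := h (-1)
  push_cast at h0 h1 h2
  unfold kk sw
  rcases lt_or_gt_of_ne h0 with hl | hl
  · have hu : a - b < 1 := lt_of_le_of_ne (by linarith [ha.2, hb.1]) (fun e => h2 (by linarith))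
    rw [Int.fract_eq_self.2 ⟨by linarith, hu⟩, if_pos (by linarith), if_neg (by linarith)]; ring
  · have hu : -1 < a - b := lt_of_le_of_ne (by linarith [ha.1, hb.2]) (fun e => h1 (by linarith))
    have e : Int.fract (a - b) = a - b + 1 := by
      rw [← Int.fract_add_one, Int.fract_eq_self]; constructor <;> linarith
    rw [e, if_neg (by linarith), if_pos (by linarith)]; ring

theorem Kb_sw (m : ℕ) (a b : Die m) (ha : ∀ i, a i ∈ Icc (0:ℝ) 1) (hb : ∀ i, b i ∈ Icc (0:ℝ) 1)
    (hs : ∑ i, a i = ∑ i, b i) (h : ∀ i j, ∀ z : ℤ, b j ≠ a i + z) :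
    Kb m a b = ∑ i, ∑ j, sw (a i - b j) := by
  unfold Kb
  have : ∀ i, ∑ j, kk (a i) (b j) = ∑ j, sw (a i - b j) + (2 * ((m+m+1) * a i) - 2 * ∑ j, b j) := by
    intro i
    rw [Finset.sum_congr rfl (fun j _ => kk_sw (ha i) (hb j) (h i j)), Finset.sum_add_distrib, ← Finset.mul_sum,
      Finset.sum_sub_distrib]
    simp; ring
  rw [Finset.sum_congr rfl (fun i _ => this i), Finset.sum_add_distrib, Finset.sum_sub_distrib, ← Finset.mul_sum, ← Finset.mul_sum, hs]
  simp; ring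

theorem Kb_ne (m : ℕ) (a b : Die m) (h : ∀ i j, b j ≠ a i) : Kb m a b ≠ 0 := by
  have e : Kb m a b = 2 * ((∑ i, ∑ j, (if b j < a i then 1 else 0) : ℕ) : ℝ) - ((m+m+1 : ℕ):ℝ) * ((m+m+1 : ℕ):ℝ) := by
    have : ∀ i j, kk (a i) (b j) = 2 * (((if b j < a i then 1 else 0 : ℕ)) : ℝ) - 1 := by
      intro i j
      unfold kk
      rcases lt_or_gt_of_ne (h i j) with hl | hl
      · rw [if_pos hl, if_neg (by linarith), if_pos hl]; norm_num
      · rw [if_neg (by linarith), if_pos hl, if_neg (by linarith)]; norm_num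
    unfold Kb
    simp only [this, Finset.sum_sub_distrib, ← Finset.mul_sum]
    simp only [Finset.sum_const, Finset.card_univ, Fintype.card_fin, nsmul_eq_mul, mul_one]
    push_cast; ring
  intro h0
  rw [e] at h0
  have h1 : 2 * (∑ i, ∑ j, (if b j < a i then 1 else 0) : ℕ) = (m+m+1) * (m+m+1) := by
    have : (2:ℝ) * ((∑ i, ∑ j, (if b j < a i then 1 else 0) : ℕ) : ℝ) = ((m+m+1 : ℕ):ℝ) * ((m+m+1 : ℕ):ℝ) := by linarith
    exact_mod_cast this
  have h2 : Odd ((m+m+1) * (m+m+1)) := (show Odd (m+m+1) from ⟨m, by ring⟩).mul ⟨m, by ring⟩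
  rw [← h1] at h2
  exact (Nat.not_even_iff_odd.2 h2) (even_two_mul _)

theorem Kb_anti (m : ℕ) (a b : Die m) : Kb m b a = - Kb m a b := by
  unfold Kb
  rw [Finset.sum_comm, ← Finset.sum_neg_distrib]
  refine Finset.sum_congr rfl fun i _ => ?_
  rw [← Finset.sum_neg_distrib]
  refine Finset.sum_congr rfl fun j _ => ?_
  unfold kk; ring

theorem sw_decomp (M m : ℕ) (a b : Die m) : ∑ i, ∑ j, sw (a i - b j) = RR M m a b +
    ∑ k ∈ Finset.range M, ck k * (trigS m k a * trigC m k b - trigC m k a * trigS m k b) := by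
  have h : ∀ x, sw x = rho M x + ∑ k ∈ Finset.range M, ck k * Real.sin (wk k * x) := fun x => by unfold rho; ring
  simp only [h, Finset.sum_add_distrib]
  congr 1
  calc _ = ∑ i, ∑ k ∈ Finset.range M, ∑ j, ck k * Real.sin (wk k * (a i - b j)) :=
        Finset.sum_congr rfl fun i _ => Finset.sum_comm
    _ = ∑ k ∈ Finset.range M, ∑ i, ∑ j, ck k * Real.sin (wk k * (a i - b j)) := Finset.sum_comm
    _ = _ := by
      refine Finset.sum_congr rfl fun k _ => ?_
      unfold trigS trigC
      rw [Finset.sum_mul_sum, Finset.sum_mul_sum, ← Finset.sum_sub_distrib, Finset.mul_sum]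
      refine Finset.sum_congr rfl fun i _ => ?_
      rw [← Finset.sum_sub_distrib, Finset.mul_sum]
      refine Finset.sum_congr rfl fun j _ => ?_
      rw [mul_sub, Real.sin_sub]

noncomputable def pp (m : ℕ) (a b : Die m) : ℝ := if 0 < Kb m a b then 1 else 0

theorem measurable_pp (m : ℕ) : Measurable (fun q : Die m × Die m => pp m q.1 q.2) := by
  unfold pp
  exact Measurable.ite (measurableSet_lt measurable_const (measurable_Kb m)) measurable_const measurable_const

theorem pp_nonneg (m : ℕ) (a b : Die m) : 0 ≤ pp m a b := by unfold pp; split_ifs <;> norm_num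
theorem pp_le (m : ℕ) (a b : Die m) : pp m a b ≤ 1 := by unfold pp; split_ifs <;> norm_num

theorem good_ae (m : ℕ) (hm : 1 ≤ m) : ∀ᵐ q ∂((muM m).prod (muM m)),
    Kb m q.1 q.2 ≠ 0 ∧ Kb m q.1 q.2 = ∑ i, ∑ j, sw (q.1 i - q.2 j) := by
  have := prob_muM m hm
  have q1 : ∀ᵐ q ∂((muM m).prod (muM m)), (∀ i, q.1 i ∈ Icc (0:ℝ) 1) ∧ ∑ i, q.1 i = (m:ℝ)+1/2 :=
    Measure.quasiMeasurePreserving_fst.ae (mu_mem m)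
  have q2 : ∀ᵐ q ∂((muM m).prod (muM m)), (∀ i, q.2 i ∈ Icc (0:ℝ) 1) ∧ ∑ i, q.2 i = (m:ℝ)+1/2 :=
    Measure.quasiMeasurePreserving_snd.ae (mu_mem m)
  filter_upwards [q1, q2, no_ties m hm] with q h1 h2 h3
  refine ⟨Kb_ne m _ _ (fun i j => ?_), Kb_sw m _ _ h1.1 h2.1 (h1.2.trans h2.2.symm) h3⟩
  have := h3 i j 0
  simpa using this

theorem pp_symm_ae (m : ℕ) (hm : 1 ≤ m) : ∀ᵐ q ∂((muM m).prod (muM m)), pp m q.1 q.2 + pp m q.2 q.1 = 1 := by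
  filter_upwards [good_ae m hm] with q h
  unfold pp
  rw [Kb_anti m q.1 q.2]
  rcases lt_or_gt_of_ne h.1 with hl | hl
  · rw [if_neg (by linarith), if_pos (by linarith)]; norm_num
  · rw [if_pos (by linarith), if_neg (by linarith)]; norm_num

theorem pp_mul (m : ℕ) (a b : Die m) : (2 * pp m a b - 1) * Kb m a b = |Kb m a b| := by
  unfold pp
  split_ifs with h
  · rw [abs_of_pos h]; ring
  · rw [abs_of_nonpos (by linarith)]; ring

theorem two_pp_abs (m : ℕ) (a b : Die m) : |2 * pp m a b - 1| = 1 := by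
  unfold pp; split_ifs <;> norm_num


theorem trigS_abs (m k : ℕ) (a : Die m) : |trigS m k a| ≤ (m + m + 1 : ℝ) := by
  unfold trigS
  refine (Finset.abs_sum_le_sum_abs _ _).trans ?_
  refine (Finset.sum_le_sum (fun j _ => Real.abs_sin_le_one _)).trans ?_
  simp

theorem trigC_abs (m k : ℕ) (a : Die m) : |trigC m k a| ≤ (m + m + 1 : ℝ) := by
  unfold trigC
  refine (Finset.abs_sum_le_sum_abs _ _).trans ?_
  refine (Finset.sum_le_sum (fun j _ => Real.abs_cos_le_one _)).trans ?_
  simp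

theorem trigS_meas (m k : ℕ) : Measurable (trigS m k) := by unfold trigS; fun_prop
theorem trigC_meas (m k : ℕ) : Measurable (trigC m k) := by unfold trigC; fun_prop

theorem corr_bd (m : ℕ) (hm : 1 ≤ m) (φ ψ : Die m → ℝ) (hφ : Measurable φ) (hψ : Measurable ψ) (C : ℝ)
    (hCφ : ∀ x, |φ x| ≤ C) (hC : ∀ x, |ψ x| ≤ C) (L : ℝ) (hL : 0 ≤ L)
    (h1 : ∫ a, φ a ^ 2 ∂(muM m) ≤ L) (h2 : ∫ a, ψ a ^ 2 ∂(muM m) ≤ L) :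
    |∫ q, φ q.1 * ψ q.2 * (2 * pp m q.1 q.2 - 1) ∂((muM m).prod (muM m))| ≤ √(8 * √(√(ee (muM m) (pp m)))) * L := by
  have := prob_muM m hm
  have h := absA (muM m) (pp m) (measurable_pp m) (pp_nonneg m) (pp_le m) (pp_symm_ae m hm) φ ψ hφ hψ C hCφ hC
  set η := √(√(ee (muM m) (pp m)))
  have hη : 0 ≤ η := Real.sqrt_nonneg _
  apply abs_le_of_sq_le_sq _ (by positivity)
  refine h.trans ?_
  rw [mul_pow, Real.sq_sqrt (by positivity)]
  have : (∫ x, φ x ^ 2 ∂(muM m)) * (∫ x, ψ x ^ 2 ∂(muM m)) ≤ L * L :=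
    mul_le_mul h1 h2 (integral_nonneg fun _ => sq_nonneg _) hL
  nlinarith

theorem main_ineq (M m : ℕ) (hm : 2 ≤ m) :
    (1/8448)^2 / 4 * m ≤ √((792 * m + 3) * (792 * m * (∫ x, rho M x ^ 2 ∂U01) + 3 * (1 + M) ^ 2))
      + M * (2 * (√(8 * √(√(ee (muM m) (pp m)))) * (792 * m + 3))) := by
  have hm1 : 1 ≤ m := by omega
  have := prob_muM m hm1
  refine (EK_lower m hm).trans ?_
  set P := (muM m).prod (muM m) with hP
  have mp := measurable_pp m
  have mR := measurable_RR M m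
  have mS := trigS_meas m
  have mC := trigC_meas m
  have b3 : ∀ {x y z c d : ℝ}, |x| ≤ c → |y| ≤ d → |z| = 1 → |x * y * z| ≤ c * d := by
    intro x y z c d hx hy hz
    rw [abs_mul, abs_mul, hz, mul_one]
    exact mul_le_mul hx hy (abs_nonneg _) ((abs_nonneg _).trans hx)
  have iR : Integrable (fun q : Die m × Die m => RR M m q.1 q.2 * (2 * pp m q.1 q.2 - 1)) P :=
    integrable_of_bdd (by fun_prop) (fun q => by
      rw [abs_mul, two_pp_abs, mul_one]; exact RR_abs M m q.1 q.2)
  have i1 : ∀ k, Integrable (fun q : Die m × Die m => trigS m k q.1 * trigC m k q.2 * (2 * pp m q.1 q.2 - 1)) P := fun k =>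
    integrable_of_bdd (by fun_prop) (fun q => b3 (trigS_abs m k q.1) (trigC_abs m k q.2) (two_pp_abs m _ _))
  have i2 : ∀ k, Integrable (fun q : Die m × Die m => trigC m k q.1 * trigS m k q.2 * (2 * pp m q.1 q.2 - 1)) P := fun k =>
    integrable_of_bdd (by fun_prop) (fun q => b3 (trigC_abs m k q.1) (trigS_abs m k q.2) (two_pp_abs m _ _))
  have i3 : ∀ k, Integrable (fun q : Die m × Die m => ck k * (trigS m k q.1 * trigC m k q.2 * (2 * pp m q.1 q.2 - 1)
      - trigC m k q.1 * trigS m k q.2 * (2 * pp m q.1 q.2 - 1))) P := fun k => ((i1 k).sub (i2 k)).const_mul _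
  have e : ∫ q, |Kb m q.1 q.2| ∂P = ∫ q, (RR M m q.1 q.2 * (2 * pp m q.1 q.2 - 1) +
      ∑ k ∈ Finset.range M, ck k * (trigS m k q.1 * trigC m k q.2 * (2 * pp m q.1 q.2 - 1)
      - trigC m k q.1 * trigS m k q.2 * (2 * pp m q.1 q.2 - 1))) ∂P := by
    refine integral_congr_ae ?_
    filter_upwards [good_ae m hm1] with q hq
    rw [← pp_mul]
    conv_lhs => rw [hq.2, sw_decomp M, mul_add, Finset.mul_sum]
    rw [mul_comm]
    congr 1
    refine Finset.sum_congr rfl fun k _ => by ring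
  rw [e, integral_add iR (integrable_finsetSum _ (fun k _ => i3 k)), integral_finsetSum _ (fun k _ => i3 k)]
  refine add_le_add ?_ ?_
  · refine Real.le_sqrt_of_sq_le ?_
    have h := cs_bdd (μ := P) (f := fun q : Die m × Die m => RR M m q.1 q.2) (g := fun q => 2 * pp m q.1 q.2 - 1) mR (by fun_prop)
      (fun q => RR_abs M m q.1 q.2) (fun q => (two_pp_abs m q.1 q.2).le)
    refine h.trans ?_
    have e1 : ∀ q : Die m × Die m, (2 * pp m q.1 q.2 - 1) ^ 2 = 1 := fun q => by rw [← sq_abs, two_pp_abs]; norm_num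
    simp only [e1]
    have e2 : ∫ _q : Die m × Die m, (1:ℝ) ∂P = 1 := by simp [hP]
    rw [e2, mul_one]
    exact ER_sq M m hm1
  · set Z := √(8 * √(√(ee (muM m) (pp m)))) * (792 * m + 3) with hZ
    have hL : (0:ℝ) ≤ 792 * m + 3 := by positivity
    have hZ0 : 0 ≤ Z := by positivity
    have : ∀ k ∈ Finset.range M, ∫ q, ck k * (trigS m k q.1 * trigC m k q.2 * (2 * pp m q.1 q.2 - 1)
      - trigC m k q.1 * trigS m k q.2 * (2 * pp m q.1 q.2 - 1)) ∂P ≤ 2 * Z := by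
      intro k _
      rw [integral_const_mul, integral_sub (i1 k) (i2 k)]
      have a1 := corr_bd m hm1 _ _ (mS k) (mC k) _ (trigS_abs m k) (trigC_abs m k) _ hL (trigS_sq m k hm1) (trigC_sq m k hm1)
      have a2 := corr_bd m hm1 _ _ (mC k) (mS k) _ (trigC_abs m k) (trigS_abs m k) _ hL (trigC_sq m k hm1) (trigS_sq m k hm1)
      rw [← hZ, ← hP] at a1 a2
      have c0 := ck_nonneg k
      have c1 := ck_le k
      set x := ∫ q, trigS m k q.1 * trigC m k q.2 * (2 * pp m q.1 q.2 - 1) ∂P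
      set y := ∫ q, trigC m k q.1 * trigS m k q.2 * (2 * pp m q.1 q.2 - 1) ∂P
      have hx := abs_le.1 a1
      have hy := abs_le.1 a2
      calc ck k * (x - y) ≤ ck k * (2 * Z) := mul_le_mul_of_nonneg_left (by linarith [hx.2, hy.1]) c0
        _ ≤ 2 * Z := by nlinarith
    refine (Finset.sum_le_sum this).trans (le_of_eq ?_)
    simp

theorem main_e : ∃ c0 > (0:ℝ), ∃ N : ℕ, ∀ m, N ≤ m → c0 ≤ ee (muM m) (pp m) := by
  obtain ⟨c, hc⟩ : ∃ c : ℝ, c = (1/8448)^2 / 4 := ⟨_, rfl⟩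
  have hc0 : 0 < c := by rw [hc]; positivity
  obtain ⟨M, hM⟩ := rho_small (c ^ 2 / (8 * 795 * 792)) (by positivity)
  obtain ⟨N, hN⟩ := exists_nat_gt (795 * (3 * (1 + (M:ℝ)) ^ 2) * 8 / c ^ 2)
  obtain ⟨t, ht⟩ : ∃ t : ℝ, t = c / (2 * (M + 1) * 2 * 795) := ⟨_, rfl⟩
  have ht0 : 0 < t := by rw [ht]; positivity
  refine ⟨((t ^ 2 / 8) ^ 2) ^ 2, by positivity, N + 2, fun m hm => ?_⟩
  have h := main_ineq M m (by omega)
  rw [← hc] at h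
  set I := ∫ x, rho M x ^ 2 ∂U01
  have hI : 0 ≤ I := integral_nonneg fun _ => sq_nonneg _
  have hm1 : (1:ℝ) ≤ m := by exact_mod_cast (by omega : 1 ≤ m)
  have hmN : (N:ℝ) ≤ m := by exact_mod_cast (by omega : N ≤ m)
  have hL : 792 * (m:ℝ) + 3 ≤ 795 * m := by linarith
  have s1 : √((792 * m + 3) * (792 * m * I + 3 * (1 + M) ^ 2)) ≤ c * m / 2 := by
    apply Real.sqrt_le_iff.2 ⟨by positivity, ?_⟩
    have k1 : 795 * 792 * I ≤ c ^ 2 / 8 := by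
      rw [lt_div_iff₀ (by norm_num)] at hM; linarith
    have k2 : 795 * (3 * (1 + (M:ℝ)) ^ 2) ≤ c ^ 2 / 8 * m := by
      have := hN.le.trans hmN
      rw [div_le_iff₀ (by positivity)] at this; linarith
    calc (792 * m + 3) * (792 * m * I + 3 * (1 + (M:ℝ)) ^ 2) ≤ 795 * m * (792 * m * I + 3 * (1 + (M:ℝ)) ^ 2) :=
          mul_le_mul_of_nonneg_right hL (by positivity)
      _ = (795 * 792 * I) * m ^ 2 + 795 * (3 * (1 + (M:ℝ)) ^ 2) * m := by ring
      _ ≤ (c ^ 2 / 8) * m ^ 2 + (c ^ 2 / 8 * m) * m :=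
          add_le_add (mul_le_mul_of_nonneg_right k1 (by positivity)) (mul_le_mul_of_nonneg_right k2 (by positivity))
      _ = (c * m / 2) ^ 2 := by ring
  set e := ee (muM m) (pp m)
  set σ := √(8 * √(√e)) with hσ
  have hσ0 : 0 ≤ σ := Real.sqrt_nonneg _
  have s2 : M * (2 * (σ * (792 * m + 3))) ≤ (M + 1) * (2 * (σ * (795 * m))) := by
    apply mul_le_mul (by linarith) _ (by positivity) (by positivity)
    have := mul_le_mul_of_nonneg_left hL hσ0
    linarith
  have s3 : t ≤ σ := by
    rw [ht, div_le_iff₀ (by positivity)]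
    have : c * m / 2 ≤ ((M + 1) * (2 * (σ * 795))) * m := by linarith
    have : c / 2 ≤ ((M + 1) * (2 * (σ * 795))) := le_of_mul_le_mul_right (by linarith) (by linarith : (0:ℝ) < m)
    linarith
  have s4 : t ^ 2 / 8 ≤ √(√e) := by
    have := pow_le_pow_left₀ ht0.le s3 2
    rw [hσ, Real.sq_sqrt (by positivity)] at this
    linarith
  have s5 : (t ^ 2 / 8) ^ 2 ≤ √e := by
    have := pow_le_pow_left₀ (by positivity) s4 2
    rwa [Real.sq_sqrt (Real.sqrt_nonneg _)] at this
  have he : 0 ≤ e := integral_nonneg fun _ => sq_nonneg _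
  have := pow_le_pow_left₀ (by positivity) s5 2
  rwa [Real.sq_sqrt he] at this

theorem DD_eq (m : ℕ) (q : Die m × Die m) :
    ((muM m) {A | 0 < Kb m A q.1 ∧ 0 < Kb m A q.2}).toReal - 1/4 = DD (muM m) (pp m) q := by
  unfold DD
  congr 1
  have hK : ∀ b, Measurable (fun a => Kb m a b) := fun b => by
    have h : Measurable (fun a : Die m => (a, b)) := by fun_prop
    have h2 := (measurable_Kb m).comp h
    simpa only [Function.comp_def] using h2
  have s1 : MeasurableSet {A | 0 < Kb m A q.1} := measurableSet_lt measurable_const (hK q.1)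
  have s2 : MeasurableSet {A | 0 < Kb m A q.2} := measurableSet_lt measurable_const (hK q.2)
  have hs : {A | 0 < Kb m A q.1 ∧ 0 < Kb m A q.2} = {A | 0 < Kb m A q.1} ∩ {A | 0 < Kb m A q.2} := by
    ext A; simp only [mem_ofPred_eq, mem_inter_iff]
  rw [hs]
  change (muM m).real _ = _
  rw [← integral_indicator_one (s1.inter s2)]
  refine integral_congr_ae (Filter.Eventually.of_forall fun a => ?_)
  simp only [indicator, mem_ofPred_eq, mem_inter_iff, Pi.one_apply, pp]
  by_cases h1 : 0 < Kb m a q.1 <;> by_cases h2 : 0 < Kb m a q.2 <;> simp [h1, h2]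

theorem final_m : ∃ ε > (0:ℝ), ∃ N : ℕ, ∀ m, N ≤ m →
    ((muM m).prod (muM m)) {q | |((muM m) {A | 0 < Kb m A q.1 ∧ 0 < Kb m A q.2}).toReal - 1/4| > ε} ≥ ENNReal.ofReal ε := by
  obtain ⟨c0, hc0, N, hN⟩ := main_e
  refine ⟨min (c0 / 2) 1, lt_min (by positivity) one_pos, N + 1, fun m hm => ?_⟩
  have := prob_muM m (by omega)
  have he := hN m (by omega)
  set ε := min (c0 / 2) 1 with hε
  have hε0 : 0 < ε := lt_min (by positivity) one_pos
  have mD := measurable_DD (muM m) (pp m) (measurable_pp m)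
  have bD := DD_abs (muM m) (pp m) (measurable_pp m) (pp_nonneg m) (pp_le m)
  have hset : {q : Die m × Die m | |((muM m) {A | 0 < Kb m A q.1 ∧ 0 < Kb m A q.2}).toReal - 1/4| > ε} = {q | ε < |DD (muM m) (pp m) q|} := by
    ext q
    have := DD_eq m q
    simp only [mem_ofPred_eq, this, gt_iff_lt]
  rw [hset]
  set P := (muM m).prod (muM m) with hP
  set S := {q | ε < |DD (muM m) (pp m) q|} with hS
  have hSm : MeasurableSet S := measurableSet_lt measurable_const mD.abs
  have key : ee (muM m) (pp m) ≤ ε ^ 2 + P.real S := by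
    unfold ee
    have : ∫ q, (ε ^ 2 + S.indicator 1 q) ∂P = ε ^ 2 + P.real S := by
      have hI : Integrable (S.indicator (1 : Die m × Die m → ℝ)) P := (integrable_const (1:ℝ)).indicator hSm
      rw [integral_add (integrable_const _) hI, integral_indicator_one hSm]
      simp [hP]
    rw [← this]
    refine integral_mono (integrable_of_bdd (C := 1) (by fun_prop) (fun q => ?_))
      ((integrable_const _).add ((integrable_const (1:ℝ)).indicator hSm)) (fun q => ?_)
    · rw [abs_pow]; exact pow_le_one₀ (abs_nonneg _) (bD q)
    · have h1 := bD q
      have h0 := abs_nonneg (DD (muM m) (pp m) q)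
      simp only
      rw [← sq_abs]
      by_cases hq : q ∈ S
      · rw [indicator_of_mem hq, Pi.one_apply]; nlinarith [sq_nonneg ε]
      · rw [indicator_of_notMem hq, add_zero]
        exact pow_le_pow_left₀ h0 (not_lt.1 hq) 2
  have e1 : ε ≤ c0 / 2 := min_le_left _ _
  have e2 : ε ≤ 1 := min_le_right _ _
  have : ε ≤ P.real S := by nlinarith
  rw [ge_iff_le, ENNReal.ofReal_le_iff_le_toReal (measure_ne_top _ _)]
  exact this

theorem three_dice_beats_both_deviates :
    ∃ ε > (0 : ℝ), ∃ N : ℕ, ∀ n : ℕ, N ≤ n → Odd n →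
      ((diceMeasure n 0 1 ((n : ℝ) / 2)).prod (diceMeasure n 0 1 ((n : ℝ) / 2)))
          {p : (Fin n → ℝ) × (Fin n → ℝ) |
            |((diceMeasure n 0 1 ((n : ℝ) / 2))
                {A : Fin n → ℝ | beats A p.1 ∧ beats A p.2}).toReal - 1 / 4| > ε}
        ≥ ENNReal.ofReal ε := by
  obtain ⟨ε, hε, N, hN⟩ := final_m
  refine ⟨ε, hε, 2 * N + 1, fun n hn hodd => ?_⟩
  obtain ⟨m, hm⟩ := hodd
  have hm2 : n = m + m + 1 := by omega
  subst hm2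
  rw [dice_eq m]
  exact hN m (by omega)
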